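/- Let k be a field of characteristic zero and X a set with seven elements. Then the Jacobson radical J(𝓡_X) of the monoid algebra 𝓡_X = k𝓒(X,X) of the monoid of relations on X has dimension 562649705679642 as a k-vector space. -/

import Mathlib

/-- Composition of correspondences: `rcomp R S = {(z,x) | ∃ y, (z,y) ∈ R ∧ (y,x) ∈ S}`. -/
def rcomp {α β γ : Type*} (R : Set (γ × β)) (S : Set (β × α)) : Set (γ × α) :=
  {p | ∃ y, (p.1, y) ∈ R ∧ (y, p.2) ∈ S}

/-- The diagonal relation. -/
def diag (X : Type*) : Set (X × X) := {p | p.1 = p.2}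

theorem rcomp_assoc {α β γ δ : Type*} (R : Set (δ × γ)) (S : Set (γ × β)) (T : Set (β × α)) :
    rcomp (rcomp R S) T = rcomp R (rcomp S T) := by
  ext ⟨z, x⟩
  constructor
  · rintro ⟨y, ⟨w, hw1, hw2⟩, hy⟩
    exact ⟨w, hw1, y, hw2, hy⟩
  · rintro ⟨w, hw, y, hy1, hy2⟩
    exact ⟨y, ⟨w, hw, hy1⟩, hy2⟩

theorem diag_rcomp {α β : Type*} (R : Set (β × α)) : rcomp (diag β) R = R := by
  ext ⟨z, x⟩
  simp [rcomp, diag]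

theorem rcomp_diag {α β : Type*} (R : Set (β × α)) : rcomp R (diag α) = R := by
  ext ⟨z, x⟩
  simp [rcomp, diag]

/-- The monoid `𝓒(X,X)` of all relations on `X` under composition of correspondences,
with identity the diagonal `Δ_X`. -/
instance relMonoid (X : Type*) : Monoid (Set (X × X)) where
  mul := rcomp
  one := diag X
  mul_assoc := rcomp_assoc
  one_mul := diag_rcomp
  mul_one := rcomp_diag

section MonoidRadical

open MonoidAlgebra

theorem exists_mul_mul_eq_of_eq_mul_mul {M : Type*} [Monoid M] [Finite M] {a u w : M}
    (h : a = u * a * w) : ∃ t, a * w * t = a := by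
  have hpow : ∀ i : ℕ, a = u ^ i * a * w ^ i := by
    intro i
    induction i with
    | zero => simp
    | succ i ih =>
      calc a = u ^ i * (u * a * w) * w ^ i := by rw [← h]; exact ih
        _ = _ := by rw [pow_succ, pow_succ']; simp only [mul_assoc]
  obtain ⟨i, j, hij, he⟩ : ∃ i j : ℕ, i < j ∧ w ^ i = w ^ j := by
    obtain ⟨i, j, hne, he⟩ := Finite.exists_ne_map_eq_of_infinite (fun i : ℕ => w ^ i)
    rcases lt_or_gt_of_ne hne with h | h
    · exact ⟨i, j, h, he⟩
    · exact ⟨j, i, h, he.symm⟩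
  obtain ⟨p, rfl⟩ := Nat.exists_eq_add_of_lt hij
  refine ⟨w ^ p, ?_⟩
  calc a * w * w ^ p = (u ^ i * a * w ^ i) * w * w ^ p := by rw [← hpow i]
    _ = u ^ i * a * w ^ (i + p + 1) := by
      rw [show i + p + 1 = i + (1 + p) by ring, pow_add, pow_add, pow_one]
      simp only [mul_assoc]
    _ = a := by rw [← he, ← hpow i]

theorem exists_mul_mul_eq_of_eq_mul_mul' {M : Type*} [Monoid M] [Finite M] {a u w : M}
    (h : a = u * a * w) : ∃ t, t * (u * a) = a := by
  have : Finite Mᵐᵒᵖ := Finite.of_equiv M MulOpposite.opEquiv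
  have : MulOpposite.op a = MulOpposite.op w * MulOpposite.op a * MulOpposite.op u := by
    rw [← MulOpposite.op_mul, ← MulOpposite.op_mul, ← mul_assoc, ← h]
  obtain ⟨t, ht⟩ := exists_mul_mul_eq_of_eq_mul_mul this
  refine ⟨t.unop, ?_⟩
  have := congrArg MulOpposite.unop ht
  simpa [mul_assoc] using this

/-- In a finite monoid, an equation `a * m * b = c` whose three parameters generate the same
two-sided ideal can be rewritten as an equation in a local monoid. -/
theorem exists_idempotent_equation {M : Type*} [Monoid M] [Finite M] {a b c m₀ : M}
    (hc : a * m₀ * b = c) (ha : ∃ u v, a = u * c * v) (hb : ∃ u v, b = u * c * v) :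
    ∃ e a' b' : M, e * e = e ∧ ∀ m, a * m * b = c ↔ e * a' * m * b' * e = e := by
  obtain ⟨u, v, ha⟩ := ha
  obtain ⟨u', v', hb⟩ := hb
  obtain ⟨t, ht⟩ := exists_mul_mul_eq_of_eq_mul_mul (a := a) (u := u) (w := m₀ * b * v) (by
    rw [← hc] at ha; simpa only [mul_assoc] using ha)
  obtain ⟨t', ht'⟩ := exists_mul_mul_eq_of_eq_mul_mul' (a := b) (u := u' * a * m₀) (w := v') (by
    rw [← hc] at hb; simpa only [mul_assoc] using hb)
  obtain ⟨y, hy⟩ : ∃ y, c * y = a := ⟨v * t, by rw [← hc]; simpa only [mul_assoc] using ht⟩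
  obtain ⟨y', hy'⟩ : ∃ y', y' * c = b := ⟨t' * u', by rw [← hc]; simpa only [mul_assoc] using ht'⟩
  have h1 : a * m₀ * y' * a = a := by
    calc a * m₀ * y' * a = a * m₀ * (y' * c) * y := by
          nth_rewrite 2 [← hy]; simp only [mul_assoc]
      _ = a := by rw [hy', hc, hy]
  have hw : b * (y * m₀) = y' * a * m₀ := by
    rw [← hy', ← hy]; simp only [mul_assoc]
  have heb : y' * a * m₀ * b = b := by
    rw [mul_assoc, mul_assoc, ← mul_assoc a, hc, hy']
  have hid : y' * a * m₀ * (y' * a * m₀) = y' * a * m₀ := by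
    calc y' * a * m₀ * (y' * a * m₀) = y' * (a * m₀ * y' * a) * m₀ := by simp only [mul_assoc]
      _ = _ := by rw [h1]
  refine ⟨y' * a * m₀, y' * a, b * (y * m₀), hid, fun m => ?_⟩
  have key : y' * a * m₀ * (y' * a) = y' * a := by
    calc y' * a * m₀ * (y' * a) = y' * (a * m₀ * y' * a) := by simp only [mul_assoc]
      _ = _ := by rw [h1]
  have step : a * m * b = c ↔ y' * a * m * b = b := by
    constructor
    · intro h
      calc y' * a * m * b = y' * (a * m * b) := by simp only [mul_assoc]
        _ = b := by rw [h, hy']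
    · intro h
      calc a * m * b = a * m₀ * (y' * a * m * b) := by
            nth_rewrite 1 [← h1]; simp only [mul_assoc]
        _ = c := by rw [h, hc]
  rw [step, key]
  constructor
  · intro h
    calc y' * a * m * (b * (y * m₀)) * (y' * a * m₀)
        = (y' * a * m * b) * (y * m₀) * (y' * a * m₀) := by simp only [mul_assoc]
      _ = _ := by rw [h, hw, hid]
  · intro h
    calc y' * a * m * b = y' * a * m * (y' * a * m₀ * b) := by rw [heb]
      _ = y' * a * m * (b * (y * m₀)) * (y' * a * m₀) * b := by
        rw [hw]
        nth_rewrite 1 [← heb]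
        simp only [mul_assoc]
      _ = b := by rw [h, heb]

variable {k M : Type*} [Field k] [Monoid M] [Fintype M]

open Classical in
/-- The functional on the monoid algebra summing the coefficients of the elements satisfying `P`. -/
noncomputable def coeffSum (P : M → Prop) (x : MonoidAlgebra k M) : k :=
  ∑ m, x.coeff m * (if P m then 1 else 0)

theorem coeffSum_add (P : M → Prop) (x y : MonoidAlgebra k M) :
    coeffSum P (x + y) = coeffSum P x + coeffSum P y := by
  simp only [coeffSum, MonoidAlgebra.coeff_add, Finsupp.add_apply, add_mul, Finset.sum_add_distrib]

theorem coeffSum_single (P : M → Prop) [DecidablePred P] (m : M) (r : k) :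
    coeffSum P (single m r) = if P m then r else 0 := by
  classical
  rw [coeffSum, Finset.sum_eq_single m]
  · simp
  · intro b _ hb
    simp [hb.symm]
  · simp

theorem coeffSum_single_mul (P : M → Prop) (a : M) (r : k) (x : MonoidAlgebra k M) :
    coeffSum P (single a r * x) = r * coeffSum (fun m => P (a * m)) x := by
  classical
  induction x using MonoidAlgebra.induction_linear with
  | zero => simp [coeffSum]
  | add x y hx hy => rw [mul_add, coeffSum_add, coeffSum_add, hx, hy, mul_add]
  | single m s => rw [single_mul_single, coeffSum_single, coeffSum_single]; simp

theorem coeffSum_mul_single (P : M → Prop) (b : M) (r : k) (x : MonoidAlgebra k M) :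
    coeffSum P (x * single b r) = r * coeffSum (fun m => P (m * b)) x := by
  classical
  induction x using MonoidAlgebra.induction_linear with
  | zero => simp [coeffSum]
  | add x y hx hy => rw [add_mul, coeffSum_add, coeffSum_add, hx, hy, mul_add]
  | single m s =>
    rw [single_mul_single, coeffSum_single, coeffSum_single, mul_comm r]; simp

variable (k M) in
/-- The elements killed by all functionals counting solutions of idempotent equations. -/
def IdemNull (x : MonoidAlgebra k M) : Prop :=
  ∀ e a b : M, e * e = e → coeffSum (fun m => e * a * m * b * e = e) x = 0

theorem IdemNull.mul_left {x : MonoidAlgebra k M} (hx : IdemNull k M x) (y : MonoidAlgebra k M) :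
    IdemNull k M (y * x) := by
  intro e a b he
  induction y using MonoidAlgebra.induction_linear with
  | zero => simp [coeffSum]
  | add y z hy hz => rw [add_mul, coeffSum_add, hy, hz, add_zero]
  | single m s =>
    rw [coeffSum_single_mul]
    have := hx e (a * m) b he
    simp only [mul_assoc] at this ⊢
    rw [this, mul_zero]

variable (M) in
/-- The size of the two-sided ideal generated by an element. -/
noncomputable def idealSize (a : M) : ℕ := Nat.card {c : M | ∃ u v, c = u * a * v}

theorem exists_eq_of_idealSize_le {a u v : M} (h : idealSize M a ≤ idealSize M (u * a * v)) :
    ∃ s t, a = s * (u * a * v) * t := by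
  have hsub : {c : M | ∃ s t, c = s * (u * a * v) * t} ⊆ {c : M | ∃ s t, c = s * a * t} := by
    rintro c ⟨s, t, rfl⟩
    exact ⟨s * u, v * t, by simp only [mul_assoc]⟩
  have := Set.eq_of_subset_of_ncard_le hsub h (Set.toFinite _)
  have ha : a ∈ {c : M | ∃ s t, c = s * a * t} := ⟨1, 1, by simp⟩
  rw [← this] at ha
  exact ha

theorem idealSize_pos (a : M) : 0 < idealSize M a := by
  have : Nonempty {c : M | ∃ u v, c = u * a * v} := ⟨⟨a, 1, 1, by simp⟩⟩
  exact Nat.card_pos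

theorem IdemNull.coeffSum_eq_zero {x : MonoidAlgebra k M} (hx : IdemNull k M x) {r : ℕ} {a b c : M}
    (ha : idealSize M a ≤ r) (hb : idealSize M b ≤ r) (hc : r ≤ idealSize M c) :
    coeffSum (fun m => a * m * b = c) x = 0 := by
  classical
  by_cases h : ∃ m₀, a * m₀ * b = c
  · obtain ⟨m₀, rfl⟩ := h
    obtain ⟨s, t, hst⟩ := exists_eq_of_idealSize_le (a := a) (u := 1) (v := m₀ * b) (by
      rw [one_mul, ← mul_assoc]; omega)
    obtain ⟨s', t', hst'⟩ := exists_eq_of_idealSize_le (a := b) (u := a * m₀) (v := 1) (by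
      rw [mul_one]; omega)
    rw [one_mul, ← mul_assoc a] at hst
    rw [mul_one] at hst'
    obtain ⟨e, a', b', he, hm⟩ := exists_idempotent_equation rfl ⟨s, t, hst⟩ ⟨s', t', hst'⟩
    simp only [hm]
    exact hx e a' b' he
  · push Not at h
    simp [coeffSum, h]

theorem IdemNull.mul_mul_mem {x : MonoidAlgebra k M} (hx : IdemNull k M x) {r : ℕ}
    {y z : MonoidAlgebra k M} (hy : ∀ a, r < idealSize M a → y.coeff a = 0)
    (hz : ∀ a, r < idealSize M a → z.coeff a = 0) (c : M) (hc : r ≤ idealSize M c) :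
    (y * x * z).coeff c = 0 := by
  classical
  have hsum : ∀ w : MonoidAlgebra k M, w = ∑ a, single a (w.coeff a) := by
    intro w
    ext b
    simp
  have hcoef : ∀ w : MonoidAlgebra k M, w.coeff c = coeffSum (fun m => m = c) w := by
    intro w
    simp [coeffSum]
  rw [hsum y, hsum z, Finset.sum_mul, Finset.sum_mul]
  simp only [Finset.mul_sum]
  rw [MonoidAlgebra.coeff_sum, Finsupp.finsetSum_apply]
  refine Finset.sum_eq_zero fun a _ => ?_
  rw [MonoidAlgebra.coeff_sum, Finsupp.finsetSum_apply]
  refine Finset.sum_eq_zero fun b _ => ?_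
  rw [hcoef, coeffSum_mul_single, coeffSum_single_mul]
  by_cases ha : r < idealSize M a
  · simp [hy a ha]
  by_cases hb : r < idealSize M b
  · simp [hz b hb]
  rw [hx.coeffSum_eq_zero (not_lt.1 ha) (not_lt.1 hb) hc]
  simp

theorem IdemNull.isNilpotent {x : MonoidAlgebra k M} (hx : IdemNull k M x) : IsNilpotent x := by
  have key : ∀ j : ℕ, ∃ n, ∀ a, Nat.card M < idealSize M a + j → (x ^ n).coeff a = 0 := by
    intro j
    induction j with
    | zero =>
      refine ⟨0, fun a ha => ?_⟩
      have : idealSize M a ≤ Nat.card M := Nat.card_le_card_of_injective _ Subtype.val_injective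
      omega
    | succ j ih =>
      obtain ⟨n, hn⟩ := ih
      refine ⟨n + 1 + n, fun a ha => ?_⟩
      rw [pow_add, pow_succ]
      by_cases hj : j ≤ Nat.card M
      · exact hx.mul_mul_mem (r := Nat.card M - j) (fun a ha => hn a (by omega))
          (fun a ha => hn a (by omega)) a (by omega)
      · exact hx.mul_mul_mem (r := 0) (fun a ha => hn a (by omega))
          (fun a ha => hn a (by omega)) a (by omega)
  obtain ⟨n, hn⟩ := key (Nat.card M)
  refine ⟨n, ?_⟩
  ext a
  have := idealSize_pos a
  simpa using hn a (by omega)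

theorem IdemNull.mem_jacobson {x : MonoidAlgebra k M} (hx : IdemNull k M x) :
    x ∈ Ideal.jacobson (⊥ : Ideal (MonoidAlgebra k M)) := by
  rw [Ideal.mem_jacobson_iff]
  intro y
  obtain ⟨u, hu⟩ := (hx.mul_left y).isNilpotent.isUnit_one_add
  refine ⟨(↑u⁻¹ : MonoidAlgebra k M), ?_⟩
  have : (↑u⁻¹ : MonoidAlgebra k M) * (1 + y * x) = 1 := by rw [← hu]; simp
  rw [mul_add, mul_one, ← mul_assoc] at this
  rw [Ideal.mem_bot, add_comm, this, sub_self]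

open Classical in
/-- The action of a monoid on the left class of `e`, as matrices. -/
noncomputable def leftClassRep (k : Type*) [Field k] {M : Type*} [Monoid M] [Fintype M] (e : M) :
    M →* Matrix {x : M // (∃ y, y * e = x) ∧ ∃ y, y * x = e}
      {x : M // (∃ y, y * e = x) ∧ ∃ y, y * x = e} k where
  toFun m := Matrix.of fun z x => if z.1 = m * x.1 then 1 else 0
  map_one' := by
    ext z x
    simp [Matrix.one_apply, Subtype.ext_iff]
  map_mul' m n := by
    ext z x
    simp only [Matrix.of_apply, Matrix.mul_apply, mul_ite, mul_one, mul_zero]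
    by_cases h : z.1 = m * n * x.1
    · rw [if_pos h]
      obtain ⟨⟨y, hy⟩, -⟩ := x.2
      obtain ⟨-, y', hy'⟩ := z.2
      rw [Finset.sum_eq_single (⟨n * x.1, ⟨n * y, by rw [mul_assoc, hy]⟩,
        y' * m, by rw [mul_assoc, ← mul_assoc m, ← h, hy']⟩ :
          {x : M // (∃ y, y * e = x) ∧ ∃ y, y * x = e})]
      · simp [h, mul_assoc]
      · intro w _ hw
        rw [if_neg]
        intro h'
        exact hw (Subtype.ext h')
      · simp
    · rw [if_neg h]
      symm
      refine Finset.sum_eq_zero fun w _ => ?_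
      split_ifs with h1 h2
      · exact absurd (by rw [h2, h1, mul_assoc]) h
      · rfl
      · rfl

theorem eq_of_mul_eq_self_of_leftClass {e n x : M} (he : e * e = e) (hn : e * n * e = n)
    (hx : ∃ y, y * e = x) (hx' : ∃ y, y * x = e) (h : n * x = x) : n = e := by
  obtain ⟨y, rfl⟩ := hx
  obtain ⟨z, hz⟩ := hx'
  have hex : e * (y * e) = y * e := by
    rw [← h, ← hn]; simp only [← mul_assoc, he]
  obtain ⟨t, ht⟩ := exists_mul_mul_eq_of_eq_mul_mul (a := e) (u := z) (w := y * e) (by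
    rw [mul_assoc, hex, hz])
  rw [hex] at ht
  calc n = n * e := by rw [← hn]; simp only [mul_assoc, he]
    _ = n * (y * e) * t := by nth_rewrite 1 [← ht]; simp only [mul_assoc]
    _ = e := by rw [h, ht]

theorem idemNull_of_mem_jacobson [CharZero k] {x : MonoidAlgebra k M}
    (hx : x ∈ Ideal.jacobson (⊥ : Ideal (MonoidAlgebra k M))) : IdemNull k M x := by
  classical
  intro e a b he
  have : IsArtinianRing (MonoidAlgebra k M) := by
    have : Module.Finite k (MonoidAlgebra k M) :=
      Module.Finite.equiv (MonoidAlgebra.coeffLinearEquiv (M := M) (S := k) k).symm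
    exact IsArtinianRing.of_finite k _
  have hu : single (e * a) 1 * x * single (b * e) 1 ∈
      Ideal.jacobson (⊥ : Ideal (MonoidAlgebra k M)) :=
    Ideal.mul_mem_right _ _ (Ideal.mul_mem_left _ _ hx)
  have hnil : IsNilpotent (single (e * a) (1 : k) * x * single (b * e) 1) := by
    obtain ⟨n, hn⟩ := IsArtinianRing.isNilpotent_jacobson_bot (R := MonoidAlgebra k M)
    exact ⟨n, by simpa [hn] using Ideal.pow_mem_pow hu n⟩
  have htr := Matrix.isNilpotent_trace_of_isNilpotent
    (hnil.map (MonoidAlgebra.lift k _ M (leftClassRep k e)))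
  rw [isNilpotent_iff_eq_zero] at htr
  set c : k := ∑ z : {x : M // (∃ y, y * e = x) ∧ ∃ y, y * x = e},
    if z.1 = e * z.1 then 1 else 0 with hc
  have hform : ∀ y : MonoidAlgebra k M, Matrix.trace (MonoidAlgebra.lift k _ M (leftClassRep k e)
      (single (e * a) 1 * y * single (b * e) 1)) =
      c * coeffSum (fun m => e * a * m * b * e = e) y := by
    intro y
    induction y using MonoidAlgebra.induction_linear with
    | zero => simp [coeffSum]
    | add y z hy hz => rw [mul_add, add_mul, map_add, Matrix.trace_add, hy, hz, coeffSum_add, mul_add]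
    | single m s =>
      rw [single_mul_single, single_mul_single, MonoidAlgebra.lift_single, Matrix.trace_smul,
        coeffSum_single]
      have hsw : e * a * m * (b * e) = e * a * m * b * e := by simp only [mul_assoc]
      rw [hsw]
      by_cases h : e * a * m * b * e = e
      · simp [h, hc, leftClassRep, Matrix.trace, mul_comm]
      · rw [if_neg h]
        have : (leftClassRep k e (e * a * m * b * e)).trace = 0 := by
          refine Finset.sum_eq_zero fun z _ => ?_
          simp only [leftClassRep, MonoidHom.coe_mk, OneHom.coe_mk, Matrix.diag_apply,
            Matrix.of_apply, ite_eq_right_iff, one_ne_zero, imp_false]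
          intro hz
          refine h (eq_of_mul_eq_self_of_leftClass he ?_ z.2.1 z.2.2 hz.symm)
          simp only [← mul_assoc, he]
          simp only [mul_assoc, he]
        rw [this]; simp
  rw [hform] at htr
  refine (mul_eq_zero.1 htr).resolve_left ?_
  rw [hc, Finset.sum_boole]
  refine Nat.cast_ne_zero.2 ?_
  refine (Finset.card_pos.2 ⟨⟨e, ⟨1, one_mul e⟩, 1, one_mul e⟩, ?_⟩).ne'
  simp [he]

theorem mem_jacobson_iff_idemNull [CharZero k] {x : MonoidAlgebra k M} :
    x ∈ Ideal.jacobson (⊥ : Ideal (MonoidAlgebra k M)) ↔ IdemNull k M x :=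
  ⟨idemNull_of_mem_jacobson, IdemNull.mem_jacobson⟩

end MonoidRadical

section Splitting

/-- A type with `n` elements that carries no preferred order. -/
def Pt (n : ℕ) : Type := Fin n

instance (n : ℕ) : Fintype (Pt n) := inferInstanceAs (Fintype (Fin n))

instance (n : ℕ) : DecidableEq (Pt n) := inferInstanceAs (DecidableEq (Fin n))

theorem card_pt (n : ℕ) : Fintype.card (Pt n) = n := Fintype.card_fin n

/-- The pair `(F, G)` of families of subsets of an ordered set `E` hits the order relation
exactly. -/
def Hits {X E : Type*} [LE E] (F G : X → Set E) : Prop :=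
  ∀ a b : E, a ≤ b ↔ ∃ x, a ∈ F x ∧ b ∈ G x

/-- The action of a relation on families of subsets. -/
def relAct {X E : Type*} (m : Set (X × X)) (G : X → Set E) (x : X) : Set E :=
  {b | ∃ y, (x, y) ∈ m ∧ b ∈ G y}

/-- The order relation as a set of pairs. -/
def leRel (E : Type*) [LE E] : Set (E × E) := {p | p.1 ≤ p.2}

theorem hits_relAct_iff {X E : Type*} [LE E] (F G : X → Set E) (m : Set (X × X)) :
    Hits F (relAct m G) ↔
      rcomp {p : E × X | p.1 ∈ F p.2} (rcomp m {p : X × E | p.2 ∈ G p.1}) = leRel E := by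
  simp only [Hits, relAct, rcomp, leRel, Set.ext_iff, Set.mem_ofPred_eq, Prod.forall]
  exact forall_congr' fun a => forall_congr' fun b => iff_comm

theorem rcomp_sandwich_iff {X E : Type*} {r u : Set (E × E)} {f : Set (E × X)} {g : Set (X × E)}
    (hfg : rcomp f g = r) (hf : rcomp r f = f) (hg : rcomp g r = g) (hr : rcomp r r = r)
    (hu : rcomp r u = u) (hu' : rcomp u r = u) :
    rcomp g (rcomp u f) = rcomp g f ↔ u = r := by
  constructor
  · intro h
    have := congrArg (fun w => rcomp f (rcomp w g)) h
    simp only [rcomp_assoc, hfg, hu'] at this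
    simpa only [← rcomp_assoc, hfg, hu, hr] using this
  · rintro rfl
    rw [hf]

theorem rcomp_leRel_self (E : Type*) [Preorder E] : rcomp (leRel E) (leRel E) = leRel E := by
  ext ⟨a, b⟩
  exact ⟨fun ⟨c, h1, h2⟩ => le_trans (show a ≤ c from h1) h2, fun h => ⟨a, le_refl a, h⟩⟩

theorem leRel_rcomp {X E : Type*} [Preorder E] {F : X → Set E} (hF : ∀ x, IsLowerSet (F x)) :
    rcomp (leRel E) {p : E × X | p.1 ∈ F p.2} = {p : E × X | p.1 ∈ F p.2} := by
  ext ⟨a, x⟩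
  exact ⟨fun ⟨c, h1, h2⟩ => hF x h1 h2, fun h => ⟨a, le_refl a, h⟩⟩

theorem rcomp_leRel {X E : Type*} [Preorder E] {G : X → Set E} (hG : ∀ x, IsUpperSet (G x)) :
    rcomp {p : X × E | p.2 ∈ G p.1} (leRel E) = {p : X × E | p.2 ∈ G p.1} := by
  ext ⟨x, a⟩
  exact ⟨fun ⟨c, h1, h2⟩ => hG x h2 h1, fun h => ⟨a, h, le_refl a⟩⟩

theorem exists_refl_between {X : Type*} [Finite X] {e : Set (X × X)} (he : rcomp e e = e)
    {x y : X} (h : (x, y) ∈ e) : ∃ z, (x, z) ∈ e ∧ (z, z) ∈ e ∧ (z, y) ∈ e := by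
  have htr : ∀ a b c, (a, b) ∈ e → (b, c) ∈ e → (a, c) ∈ e := fun a b c h1 h2 => by
    rw [← he]; exact ⟨b, h1, h2⟩
  have hsp : ∀ a c, (a, c) ∈ e → ∃ b, (a, b) ∈ e ∧ (b, c) ∈ e := fun a c h => by
    rw [← he] at h; exact h
  by_contra! hno
  let S := {z // (x, z) ∈ e ∧ (z, y) ∈ e}
  have : IsTrans S fun b a => (a.1, b.1) ∈ e := ⟨fun a b c h1 h2 => htr _ _ _ h2 h1⟩
  have : Std.Irrefl fun b a : S => (a.1, b.1) ∈ e := ⟨fun a h' => hno a.1 a.2.1 h' a.2.2⟩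
  have hwf := Finite.wellFounded_of_trans_of_irrefl fun b a : S => (a.1, b.1) ∈ e
  obtain ⟨z0, hz0, hz0'⟩ := hsp x y h
  obtain ⟨z, -, hz⟩ := hwf.has_min (Set.univ : Set S) ⟨⟨z0, hz0, hz0'⟩, trivial⟩
  obtain ⟨w, hw, hw'⟩ := hsp z.1 y z.2.2
  exact hz ⟨w, htr _ _ _ z.2.1 hw, hw'⟩ trivial hw

/-- An idempotent relation on a finite set splits through a finite partially ordered set. -/
theorem exists_splitting {X : Type*} [Finite X] {e : Set (X × X)} (he : rcomp e e = e) :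
    ∃ (n : ℕ) (_ : PartialOrder (Pt n)) (f : Set (Pt n × X)) (g : Set (X × Pt n)),
      rcomp g f = e ∧ rcomp f g = leRel (Pt n) ∧ rcomp (leRel (Pt n)) f = f ∧
        rcomp g (leRel (Pt n)) = g := by
  have htr : ∀ a b c, (a, b) ∈ e → (b, c) ∈ e → (a, c) ∈ e := fun a b c h1 h2 => by
    rw [← he]; exact ⟨b, h1, h2⟩
  let E := {z // (z, z) ∈ e}
  let _ : Preorder E :=
    { le := fun a b => (a.1, b.1) ∈ e
      le_refl := fun a => a.2
      le_trans := fun a b c => htr _ _ _ }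
  let Q := Antisymmetrization E (· ≤ ·)
  have : Finite Q := Quotient.finite _
  obtain ⟨n, ⟨eq⟩⟩ : ∃ n, Nonempty (Q ≃ Pt n) := Finite.exists_equiv_fin Q
  let rep : Pt n → E := fun i => ofAntisymmetrization (· ≤ ·) (eq.symm i)
  let P : PartialOrder (Pt n) := PartialOrder.lift eq.symm eq.symm.injective
  have hle : ∀ i j : Pt n, i ≤ j ↔ ((rep i).1, (rep j).1) ∈ e := fun i j =>
    (ofAntisymmetrization_le_ofAntisymmetrization_iff (a := eq.symm i) (b := eq.symm j)).symm
  have hrep : ∀ z, (z, z) ∈ e → ∃ i, (z, (rep i).1) ∈ e ∧ ((rep i).1, z) ∈ e := by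
    intro z hz
    refine ⟨eq (toAntisymmetrization (· ≤ ·) ⟨z, hz⟩), ?_⟩
    have h := toAntisymmetrization_ofAntisymmetrization (· ≤ · : E → E → Prop)
      (toAntisymmetrization (· ≤ ·) ⟨z, hz⟩)
    have h' : AntisymmRel (· ≤ · : E → E → Prop) (rep (eq (toAntisymmetrization (· ≤ ·) ⟨z, hz⟩)))
        ⟨z, hz⟩ := by
      simp only [rep, Equiv.symm_apply_apply]
      exact Quotient.exact h
    exact ⟨h'.2, h'.1⟩
  refine ⟨n, P, {p | ((rep p.1).1, p.2) ∈ e}, {p | (p.1, (rep p.2).1) ∈ e}, ?_, ?_, ?_, ?_⟩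
  · ext ⟨x, y⟩
    constructor
    · rintro ⟨i, h1, h2⟩
      exact htr _ _ _ h1 h2
    · intro h
      obtain ⟨z, h1, h2, h3⟩ := exists_refl_between he h
      obtain ⟨i, h4, h5⟩ := hrep z h2
      exact ⟨i, htr _ _ _ h1 h4, htr _ _ _ h5 h3⟩
  · ext ⟨i, j⟩
    change _ ↔ i ≤ j
    rw [hle]
    constructor
    · rintro ⟨x, h1, h2⟩
      exact htr _ _ _ h1 h2
    · intro h
      exact ⟨(rep i).1, (rep i).2, h⟩
  · ext ⟨i, x⟩
    exact ⟨fun ⟨j, h1, h2⟩ => htr _ _ _ ((hle _ _).1 h1) h2, fun h => ⟨i, le_refl i, h⟩⟩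
  · ext ⟨x, i⟩
    exact ⟨fun ⟨j, h1, h2⟩ => htr _ _ _ h1 ((hle _ _).1 h2), fun h => ⟨i, h, le_refl i⟩⟩

theorem idemNull_iff_hits {k X : Type*} [Field k] [Fintype X] [Fintype (Set (X × X))]
    {x : MonoidAlgebra k (Set (X × X))} :
    IdemNull k (Set (X × X)) x ↔ ∀ (n : ℕ) (_ : PartialOrder (Pt n)) (F G : X → Set (Pt n)),
      (∀ x, IsLowerSet (F x)) → (∀ x, IsUpperSet (G x)) →
        coeffSum (fun m => Hits F (relAct m G)) x = 0 := by
  constructor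
  · intro hx n P F G hF hG
    by_cases h : ∃ m₀, Hits F (relAct m₀ G)
    · obtain ⟨m₀, hm₀⟩ := h
      rw [hits_relAct_iff] at hm₀
      set f := {p : Pt n × X | p.1 ∈ F p.2}
      set g := {p : X × Pt n | p.2 ∈ G p.1}
      have hf : rcomp (leRel (Pt n)) f = f := leRel_rcomp hF
      have hg : rcomp g (leRel (Pt n)) = g := rcomp_leRel hG
      have hrr := rcomp_leRel_self (Pt n)
      have hg' : rcomp (rcomp m₀ g) (leRel (Pt n)) = rcomp m₀ g := by rw [rcomp_assoc, hg]
      have he : rcomp (rcomp m₀ g) f * rcomp (rcomp m₀ g) f = rcomp (rcomp m₀ g) f := by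
        change rcomp (rcomp (rcomp m₀ g) f) (rcomp (rcomp m₀ g) f) = _
        rw [rcomp_assoc (rcomp m₀ g), ← rcomp_assoc f, hm₀, hf]
      have := hx (rcomp (rcomp m₀ g) f) 1 (rcomp g f) he
      rw [← this]
      congr 1
      funext m
      rw [hits_relAct_iff, mul_one]
      refine propext ((rcomp_sandwich_iff hm₀ hf hg' hrr ?_ ?_).symm.trans ?_)
      · rw [← rcomp_assoc, hf]
      · rw [rcomp_assoc, rcomp_assoc, hg]
      · have : rcomp (rcomp m₀ g) f * m * rcomp g f * rcomp (rcomp m₀ g) f =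
            rcomp (rcomp m₀ g) (rcomp (rcomp f (rcomp m g)) f) := by
          change rcomp (rcomp (rcomp (rcomp (rcomp m₀ g) f) m) (rcomp g f))
            (rcomp (rcomp m₀ g) f) = _
          rw [rcomp_assoc _ (rcomp g f), rcomp_assoc g f, ← rcomp_assoc f _ f, hm₀, hf]
          simp only [rcomp_assoc]
        rw [this]
    · push Not at h
      simp [coeffSum, h]
  · intro hx e a b he
    obtain ⟨n, P, f, g, hgf, hfg, hf, hg⟩ := exists_splitting (e := e) he
    have hF : rcomp (leRel (Pt n)) (rcomp f a) = rcomp f a := by rw [← rcomp_assoc, hf]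
    have hG : rcomp (rcomp b g) (leRel (Pt n)) = rcomp b g := by rw [rcomp_assoc, hg]
    have := hx n P (fun x => {i | (i, x) ∈ rcomp f a}) (fun x => {i | (x, i) ∈ rcomp b g})
      (fun x i j hij hi => by
        change (j, x) ∈ rcomp f a
        rw [← hF]; exact ⟨i, hij, hi⟩)
      (fun x i j hij hi => by
        change (x, j) ∈ rcomp b g
        rw [← hG]; exact ⟨i, hi, hij⟩)
    rw [← this]
    congr 1
    funext m
    rw [hits_relAct_iff]
    change (e * a * m * b * e = e) = (rcomp (rcomp f a) (rcomp m (rcomp b g)) = leRel (Pt n))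
    refine propext (Iff.trans ?_ (rcomp_sandwich_iff hfg hf hg (rcomp_leRel_self _) ?_ ?_))
    · have : e * a * m * b * e = rcomp g (rcomp (rcomp (rcomp f a) (rcomp m (rcomp b g))) f) := by
        change rcomp (rcomp (rcomp (rcomp e a) m) b) e = _
        rw [← hgf]
        simp only [rcomp_assoc]
      rw [this, hgf]
    · rw [← rcomp_assoc, hF]
    · simp only [rcomp_assoc, hg]

end Splitting

section DimensionFormula

open Classical in
/-- The values on all relations of the functional attached to an order and two families. -/
noncomputable def hitsVec (k : Type*) [Field k] {X E : Type*} [LE E] (F G : X → Set E)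
    (m : Set (X × X)) : k :=
  if Hits F (relAct m G) then 1 else 0

/-- The space spanned by all functionals attached to finite posets. -/
noncomputable def hitsSpan (k X : Type*) [Field k] : Submodule k (Set (X × X) → k) :=
  Submodule.span k {v | ∃ (n : ℕ) (_ : PartialOrder (Pt n)) (F G : X → Set (Pt n)),
    (∀ x, IsLowerSet (F x)) ∧ (∀ x, IsUpperSet (G x)) ∧ v = hitsVec k F G}

theorem finrank_jacobson_add_finrank_hitsSpan {k X : Type*} [Field k] [CharZero k] [Fintype X] :
    Module.finrank k (Submodule.restrictScalars k
      (Ideal.jacobson (⊥ : Ideal (MonoidAlgebra k (Set (X × X)))))) +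
      Module.finrank k (hitsSpan k X) = 2 ^ (Fintype.card X * Fintype.card X) := by
  classical
  let eq : MonoidAlgebra k (Set (X × X)) ≃ₗ[k] (Set (X × X) → k) :=
    (MonoidAlgebra.coeffLinearEquiv k).trans (Finsupp.linearEquivFunOnFinite k k _)
  let D := dotProductEquiv k (Set (X × X))
  have h1 := Subspace.finrank_add_finrank_dualCoannihilator_eq
    ((hitsSpan k X).map D.toLinearMap)
  rw [LinearEquiv.finrank_map_eq, Module.finrank_fintype_fun_eq_card] at h1
  have h2 : (Submodule.restrictScalars k
      (Ideal.jacobson (⊥ : Ideal (MonoidAlgebra k (Set (X × X)))))).map eq.toLinearMap =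
      ((hitsSpan k X).map D.toLinearMap).dualCoannihilator := by
    ext y
    obtain ⟨x, rfl⟩ := eq.surjective y
    have : eq x ∈ (Submodule.restrictScalars k
      (Ideal.jacobson (⊥ : Ideal (MonoidAlgebra k (Set (X × X)))))).map eq.toLinearMap ↔
        x ∈ Ideal.jacobson (⊥ : Ideal (MonoidAlgebra k (Set (X × X)))) := by
      constructor
      · rintro ⟨z, hz, h⟩
        rwa [← eq.injective h]
      · intro h
        exact ⟨x, h, rfl⟩
    rw [this, mem_jacobson_iff_idemNull, idemNull_iff_hits, Submodule.mem_dualCoannihilator]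
    have hD : ∀ (n : ℕ) (_ : PartialOrder (Pt n)) (F G : X → Set (Pt n)),
        D (hitsVec k F G) (eq x) = coeffSum (fun m => Hits F (relAct m G)) x := by
      intro n _ F G
      simp only [D, dotProductEquiv_apply_apply, coeffSum, dotProduct]
      exact Finset.sum_congr rfl fun m _ => mul_comm _ _
    constructor
    · rintro h _ ⟨v, hv, rfl⟩
      change D v (eq x) = 0
      induction hv using Submodule.span_induction with
      | mem v hv =>
        obtain ⟨n, _, F, G, hF, hG, rfl⟩ := hv
        rw [hD]
        exact h n _ F G hF hG
      | zero => simp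
      | add v w _ _ hv hw => rw [map_add, LinearMap.add_apply, hv, hw, add_zero]
      | smul c v _ hv => rw [map_smul, LinearMap.smul_apply, hv, smul_zero]
    · intro h n _ F G hF hG
      rw [← hD]
      exact h _ ⟨_, Submodule.subset_span ⟨n, _, F, G, hF, hG, rfl⟩, rfl⟩
  have h3 := LinearEquiv.finrank_map_eq eq (Submodule.restrictScalars k
      (Ideal.jacobson (⊥ : Ideal (MonoidAlgebra k (Set (X × X))))))
  rw [← h3]
  have h4 : Fintype.card (Set (X × X)) = 2 ^ (Fintype.card X * Fintype.card X) := by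
    rw [Fintype.card_set, Fintype.card_prod]
  rw [← h4, ← h1, add_comm, h2]

end DimensionFormula

section OrderBasis

open Set

variable {E : Type*} [PartialOrder E]

/-- `e'` is both the only upper cover of `e` from below and `e` the only lower cover of `e'`. -/
def Link (e e' : E) : Prop := Ioi e = Ici e' ∧ Iio e' = Iic e

/-- The element `t` is the meet of the elements strictly above it. -/
def MeetTop (t : E) : Prop := lowerBounds (Ioi t) = Iic t

/-- The element `e` is the join of the elements strictly below it. -/
def JoinBot (e : E) : Prop := upperBounds (Iio e) = Ici e

/-- The chain of links starting at `e` ends at an element that is a meet. -/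
def Good (e : E) : Prop := ∃ t, Relation.ReflTransGen Link e t ∧ MeetTop t

variable (E) in
/-- The values taken by the row basis. -/
def basisValues : Set (Set E) :=
  {a | lowerBounds (upperBounds a) = a ∨ ∃ e, Good e ∧ JoinBot e ∧ a = Iio e}

/-- The principal lower sets of good elements. -/
def IsGoodIic (a : Set E) : Prop := ∃ e, Good e ∧ a = Iic e

/-- The punctured principal lower sets of good elements that are joins. -/
def IsGoodIio (a : Set E) : Prop := ∃ e, Good e ∧ JoinBot e ∧ a = Iio e

theorem Link.lt {e e' : E} (h : Link e e') : e < e' := by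
  have : e' ∈ Ioi e := by rw [h.1]; exact self_mem_Ici
  exact this

theorem Link.good {e e' : E} (h : Link e e') (h' : Good e') : Good e := by
  obtain ⟨t, ht, hq⟩ := h'
  exact ⟨t, ht.head h, hq⟩

theorem le_of_reflTransGen_link {e t : E} (h : Relation.ReflTransGen Link e t) : e ≤ t := by
  induction h with
  | refl => exact le_rfl
  | tail _ h ih => exact ih.trans h.lt.le

theorem Ici_inj' {a b : E} (h : Ici a = Ici b) : a = b := by
  have h1 : b ∈ Ici a := by rw [h]; exact self_mem_Ici
  have h2 : a ∈ Ici b := by rw [← h]; exact self_mem_Ici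
  exact le_antisymm h1 h2

theorem Iic_inj' {a b : E} (h : Iic a = Iic b) : a = b := by
  have h1 : b ∈ Iic a := by rw [h]; exact self_mem_Iic
  have h2 : a ∈ Iic b := by rw [← h]; exact self_mem_Iic
  exact le_antisymm h2 h1

theorem MeetTop.Ioi_ne {t : E} (h : MeetTop t) (d : E) : Ioi t ≠ Ici d := by
  intro hd
  have : t < d := by
    have : d ∈ Ioi t := by rw [hd]; exact self_mem_Ici
    exact this
  rw [MeetTop, hd, lowerBounds_Ici] at h
  exact this.ne (Iic_inj' h.symm)

theorem JoinBot.Iio_ne {e : E} (h : JoinBot e) (d : E) : Iio e ≠ Iic d := by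
  intro hd
  have : d < e := by
    have : d ∈ Iio e := by rw [hd]; exact self_mem_Iic
    exact this
  rw [JoinBot, hd, upperBounds_Iic] at h
  exact this.ne (Ici_inj' h)

theorem JoinBot.not_link {e d : E} (h : JoinBot e) : ¬ Link d e := fun hl => h.Iio_ne d hl.2

theorem Link.unique_left {c d e : E} (h : Link c e) (h' : Link d e) : c = d :=
  Iic_inj' (h.2.symm.trans h'.2)

theorem IsLowerSet.eq_Iic_of_mem {a : Set E} (ha : IsLowerSet a) {e : E} (h : a ⊆ Iic e)
    (he : e ∈ a) : a = Iic e :=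
  h.antisymm fun _ hx => ha hx he

theorem IsLowerSet.subset_Iio {a : Set E} (h : IsLowerSet a) {e : E} (hsub : a ⊆ Iic e)
    (he : a ≠ Iic e) : a ⊆ Iio e := by
  intro x hx
  refine lt_of_le_of_ne (hsub hx) ?_
  rintro rfl
  exact he (h.eq_Iic_of_mem hsub hx)

theorem IsUpperSet.subset_Ioi {b : Set E} (h : IsUpperSet b) {e : E} (hsub : b ⊆ Ici e)
    (he : b ≠ Ici e) : b ⊆ Ioi e := by
  intro x hx
  refine lt_of_le_of_ne (hsub hx) ?_
  rintro rfl
  exact he (hsub.antisymm fun _ hy => h hy hx)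

/-- The end of the chain of links starting at a good element. -/
noncomputable def topOf (e : E) (h : Good e) : E := h.choose

theorem reach_topOf {e : E} (h : Good e) : Relation.ReflTransGen Link e (topOf e h) :=
  h.choose_spec.1

theorem meetTop_topOf {e : E} (h : Good e) : MeetTop (topOf e h) := h.choose_spec.2

theorem le_topOf {e : E} (h : Good e) : e ≤ topOf e h := le_of_reflTransGen_link (reach_topOf h)

theorem subset_Ici_of_reach {b : Set E} (hb : IsUpperSet b) (hne : ∀ d, Good d → b ≠ Ici d)
    {c t : E} (h : Relation.ReflTransGen Link c t) (ht : MeetTop t) (hc : b ⊆ Ici c) :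
    b ⊆ Ici t := by
  induction h using Relation.ReflTransGen.head_induction_on with
  | refl => exact hc
  | head hl hr ih =>
    refine ih ?_
    rw [← hl.1]
    exact hb.subset_Ioi hc (hne _ (hl.good ⟨t, hr, ht⟩))

theorem topOf_le {c t : E} (hc : Good c) (ht : MeetTop t) (h : c ≤ t) : topOf c hc ≤ t := by
  have h1 : Ioi t ⊆ Ici (topOf c hc) :=
    subset_Ici_of_reach (isUpperSet_Ioi t) (fun d _ => ht.Ioi_ne d) (reach_topOf hc)
      (meetTop_topOf hc) fun x hx => h.trans (le_of_lt hx)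
  have h2 : topOf c hc ∈ lowerBounds (Ioi t) := fun x hx => h1 hx
  rw [ht] at h2
  exact h2

theorem topOf_eq {c t : E} (hc : Good c) (ht : MeetTop t) (h : Relation.ReflTransGen Link c t) :
    topOf c hc = t := by
  refine le_antisymm (topOf_le hc ht (le_of_reflTransGen_link h)) ?_
  by_contra hlt
  have h1 : Ioi (topOf c hc) ⊆ Ici t :=
    subset_Ici_of_reach (isUpperSet_Ioi _) (fun d _ => (meetTop_topOf hc).Ioi_ne d) h ht
      fun x hx => (le_topOf hc).trans (le_of_lt hx)
  have h2 : t ∈ lowerBounds (Ioi (topOf c hc)) := fun x hx => h1 hx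
  rw [meetTop_topOf hc] at h2
  exact hlt h2

theorem reach_total {c d t : E} (h : Relation.ReflTransGen Link c t)
    (h' : Relation.ReflTransGen Link d t) :
    Relation.ReflTransGen Link c d ∨ Relation.ReflTransGen Link d c := by
  induction h with
  | refl => exact Or.inr h'
  | @tail u v h hl ih =>
    cases h' with
    | refl => exact Or.inl (h.tail hl)
    | tail h' hl' =>
      rw [hl'.unique_left hl] at h'
      exact ih h'

theorem JoinBot.eq_of_reach {c e : E} (he : JoinBot e) (h : Relation.ReflTransGen Link c e) :
    c = e := by
  cases h with
  | refl => rfl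
  | tail _ hl => exact absurd hl he.not_link

theorem eq_Iic_of_subset_of_not_subset {a : Set E} (ha : IsLowerSet a) {e t : E}
    (h : Relation.ReflTransGen Link e t) (hat : a ⊆ Iic t) (hae : ¬ a ⊆ Iic e) :
    ∃ c, a = Iic c ∧ e < c ∧ Relation.ReflTransGen Link c t := by
  induction h using Relation.ReflTransGen.head_induction_on with
  | refl => exact absurd hat hae
  | @head e e₁ hl hr ih =>
    by_cases h1 : a ⊆ Iic e₁
    · by_cases h2 : a = Iic e₁
      · exact ⟨e₁, h2, hl.lt, hr⟩
      · exact absurd (hl.2 ▸ ha.subset_Iio h1 h2) hae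
    · obtain ⟨c, hc, hlt, hr'⟩ := ih h1
      exact ⟨c, hc, hl.lt.trans hlt, hr'⟩

theorem isLowerSet_of_mem_basisValues {a : Set E} (ha : a ∈ basisValues E) : IsLowerSet a := by
  rcases ha with ha | ⟨e, -, -, rfl⟩
  · rw [← ha]
    exact fun x y hyx hx z hz => hyx.trans (hx hz)
  · exact isLowerSet_Iio e

theorem lowerBounds_upperBounds_Iic (e : E) : lowerBounds (upperBounds (Iic e)) = Iic e := by
  rw [upperBounds_Iic, lowerBounds_Ici]

theorem Iic_mem_basisValues (e : E) : Iic e ∈ basisValues E := Or.inl (lowerBounds_upperBounds_Iic e)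

theorem upperBounds_lowerBounds_upperBounds (a : Set E) :
    upperBounds (lowerBounds (upperBounds a)) = upperBounds a := by
  refine Subset.antisymm ?_ ?_
  · exact upperBounds_mono_set fun x hx y hy => hy hx
  · exact fun x hx y hy => hy hx

theorem lowerBounds_upperBounds_lowerBounds (b : Set E) :
    lowerBounds (upperBounds (lowerBounds b)) = lowerBounds b := by
  refine Subset.antisymm ?_ ?_
  · exact lowerBounds_mono_set fun x hx y hy => hy hx
  · exact fun x hx y hy => hy hx

theorem isUpperSet_upperBounds (a : Set E) : IsUpperSet (upperBounds a) :=
  fun _ _ hxy hx _ hz => (hx hz).trans hxy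

theorem not_isGoodIio_of_closed {a : Set E} (ha : lowerBounds (upperBounds a) = a) :
    ¬ IsGoodIio a := by
  rintro ⟨e, -, hj, rfl⟩
  rw [hj, lowerBounds_Ici] at ha
  exact lt_irrefl e (ha ▸ self_mem_Iic : e ∈ Iio e)

open Classical in
/-- The upper set testing against a value of the row basis. -/
noncomputable def testSet (a : Set E) : Set E :=
  if h : ∃ e, ∃ _ : Good e, a = Iic e ∨ (JoinBot e ∧ a = Iio e) then
    Ioi (topOf h.choose h.choose_spec.choose) else upperBounds a

theorem testSet_Iic {e : E} (h : Good e) : testSet (Iic e) = Ioi (topOf e h) := by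
  have hex : ∃ e', ∃ h : Good e', Iic e = Iic e' ∨ (JoinBot e' ∧ Iic e = Iio e') :=
    ⟨e, h, Or.inl rfl⟩
  rw [testSet, dif_pos hex]
  rcases hex.choose_spec.choose_spec with h' | ⟨h', h''⟩
  · congr! 2
    exact (Iic_inj' h').symm
  · exact absurd h''.symm (h'.Iio_ne _)

theorem testSet_Iio {e : E} (h : Good e) (hj : JoinBot e) :
    testSet (Iio e) = Ioi (topOf e h) := by
  have hex : ∃ e', ∃ h : Good e', Iio e = Iic e' ∨ (JoinBot e' ∧ Iio e = Iio e') :=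
    ⟨e, h, Or.inr ⟨hj, rfl⟩⟩
  rw [testSet, dif_pos hex]
  rcases hex.choose_spec.choose_spec with h' | ⟨h', h''⟩
  · exact absurd h' (hj.Iio_ne _)
  · congr! 2
    refine (Ici_inj' ?_).symm
    exact hj.symm.trans ((congrArg upperBounds h'').trans h')

theorem testSet_of_not {a : Set E} (h : ¬ IsGoodIic a) (h' : ¬ IsGoodIio a) :
    testSet a = upperBounds a := by
  rw [testSet, dif_neg]
  rintro ⟨e, he, rfl | ⟨hj, rfl⟩⟩
  · exact h ⟨e, he, rfl⟩
  · exact h' ⟨e, he, hj, rfl⟩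

theorem isUpperSet_testSet (a : Set E) : IsUpperSet (testSet a) := by
  rw [testSet]
  split_ifs
  · exact isUpperSet_Ioi _
  · exact isUpperSet_upperBounds a

theorem testSet_ne_Ici {a : Set E} (ha : a ∈ basisValues E) {d : E} (hd : Good d) :
    testSet a ≠ Ici d := by
  by_cases h : IsGoodIic a
  · obtain ⟨e, he, rfl⟩ := h
    rw [testSet_Iic he]
    exact (meetTop_topOf he).Ioi_ne d
  by_cases h' : IsGoodIio a
  · obtain ⟨e, he, hj, rfl⟩ := h'
    rw [testSet_Iio he hj]
    exact (meetTop_topOf he).Ioi_ne d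
  rw [testSet_of_not h h']
  intro hu
  have ha := ha.resolve_right h'
  rw [hu, lowerBounds_Ici] at ha
  exact h ⟨d, hd, ha.symm⟩

theorem lowerBounds_testSet_Iic {e : E} (h : Good e) :
    lowerBounds (testSet (Iic e)) = Iic (topOf e h) := by
  rw [testSet_Iic h]; exact meetTop_topOf h

theorem lowerBounds_testSet_Iio {e : E} (h : Good e) (hj : JoinBot e) :
    lowerBounds (testSet (Iio e)) = Iic (topOf e h) := by
  rw [testSet_Iio h hj]; exact meetTop_topOf h

theorem lowerBounds_testSet_of_not {a : Set E} (ha : a ∈ basisValues E) (h : ¬ IsGoodIic a)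
    (h' : ¬ IsGoodIio a) : lowerBounds (testSet a) = a := by
  rw [testSet_of_not h h']
  exact ha.resolve_right h'

theorem lowerBounds_testSet_mono {a h : Set E} (ha : a ∈ basisValues E) (hh : h ∈ basisValues E)
    (hle : a ⊆ lowerBounds (testSet h)) :
    lowerBounds (testSet a) ⊆ lowerBounds (testSet h) := by
  have main : ∀ {c : E} (hc : Good c), testSet h ⊆ Ici c →
      Iic (topOf c hc) ⊆ lowerBounds (testSet h) := by
    intro c hc hsub x hx y hy
    exact le_trans hx (subset_Ici_of_reach (isUpperSet_testSet h)
      (fun d hd => testSet_ne_Ici hh hd) (reach_topOf hc) (meetTop_topOf hc) hsub hy)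
  by_cases h1 : IsGoodIic a
  · obtain ⟨c, hc, rfl⟩ := h1
    rw [lowerBounds_testSet_Iic hc]
    exact main hc fun y hy => hle self_mem_Iic hy
  by_cases h2 : IsGoodIio a
  · obtain ⟨c, hc, hj, rfl⟩ := h2
    rw [lowerBounds_testSet_Iio hc hj]
    refine main hc ?_
    rw [← hj]
    exact fun y hy x hx => hle hx hy
  · rwa [lowerBounds_testSet_of_not ha h1 h2]

open Classical in
/-- The rank making the row basis triangular. -/
noncomputable def testRank [Fintype E] (a : Set E) : ℕ :=
  (lowerBounds (testSet a)).ncard * (Fintype.card E + 2) +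
    (if IsGoodIic a then Fintype.card E - a.ncard else
      if IsGoodIio a then Fintype.card E + 1 else 0)

theorem testRank_lt_of_ssubset [Fintype E] {a h : Set E}
    (hlt : lowerBounds (testSet a) ⊂ lowerBounds (testSet h)) : testRank a < testRank h := by
  classical
  have h1 := Set.ncard_lt_ncard hlt (Set.toFinite _)
  rw [testRank, testRank]
  generalize (lowerBounds (testSet a)).ncard = u at *
  generalize (lowerBounds (testSet h)).ncard = v at *
  have h2 : (u + 1) * (Fintype.card E + 2) ≤ v * (Fintype.card E + 2) :=
    Nat.mul_le_mul_right _ h1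
  have h3 : (if IsGoodIic a then Fintype.card E - a.ncard else
      if IsGoodIio a then Fintype.card E + 1 else 0) < Fintype.card E + 2 := by
    split_ifs <;> omega
  rw [add_mul, one_mul] at h2
  omega

/-- Away from good principal lower sets, the test set of `h` only detects `h` and values of smaller
rank. -/
theorem testRank_lt_of_not_isGoodIic [Fintype E] {a h : Set E} (ha : a ∈ basisValues E)
    (hh : h ∈ basisValues E) (hg : ¬ IsGoodIic h) (hle : a ⊆ lowerBounds (testSet h))
    (hne : a ≠ h) : testRank a < testRank h := by
  rcases (lowerBounds_testSet_mono ha hh hle).eq_or_ssubset with heq | hlt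
  swap
  · exact testRank_lt_of_ssubset hlt
  by_cases hi : IsGoodIio h
  · obtain ⟨e, he, hj, rfl⟩ := hi
    rw [lowerBounds_testSet_Iio he hj] at heq
    by_cases h1 : IsGoodIic a
    · rw [testRank, testRank, if_pos h1, if_neg hg, if_pos ⟨e, he, hj, rfl⟩, heq,
        lowerBounds_testSet_Iio he hj]
      omega
    by_cases h2 : IsGoodIio a
    · obtain ⟨c, hc, hjc, rfl⟩ := h2
      rw [lowerBounds_testSet_Iio hc hjc] at heq
      have htop := Iic_inj' heq
      rcases reach_total (reach_topOf he) (htop ▸ reach_topOf hc) with h | h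
      · exact absurd (by rw [hjc.eq_of_reach h]) hne
      · exact absurd (by rw [hj.eq_of_reach h]) hne
    · rw [lowerBounds_testSet_of_not ha h1 h2] at heq
      exact absurd ⟨_, ⟨_, .refl, meetTop_topOf he⟩, heq⟩ h1
  · rw [lowerBounds_testSet_of_not hh hg hi] at heq
    by_cases h1 : IsGoodIic a
    · obtain ⟨c, hc, rfl⟩ := h1
      rw [lowerBounds_testSet_Iic hc] at heq
      exact absurd ⟨_, ⟨_, .refl, meetTop_topOf hc⟩, heq.symm⟩ hg
    by_cases h2 : IsGoodIio a
    · obtain ⟨c, hc, hjc, rfl⟩ := h2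
      rw [lowerBounds_testSet_Iio hc hjc] at heq
      exact absurd ⟨_, ⟨_, .refl, meetTop_topOf hc⟩, heq.symm⟩ hg
    · rw [lowerBounds_testSet_of_not ha h1 h2] at heq
      exact absurd heq hne

theorem testRank_lt_of_isGoodIic [Fintype E] {a : Set E} (ha : a ∈ basisValues E) {e : E}
    (he : Good e) (hle : a ⊆ Iic (topOf e he)) (hne : ¬ a ⊆ Iic e) :
    testRank a < testRank (Iic e) := by
  obtain ⟨c, rfl, hlt, hr⟩ := eq_Iic_of_subset_of_not_subset (isLowerSet_of_mem_basisValues ha)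
    (reach_topOf he) hle hne
  have hc : Good c := ⟨_, hr, meetTop_topOf he⟩
  rw [testRank, testRank, if_pos ⟨c, hc, rfl⟩, if_pos ⟨e, he, rfl⟩, lowerBounds_testSet_Iic hc,
    lowerBounds_testSet_Iic he, topOf_eq hc (meetTop_topOf he) hr]
  have h1 : (Iic e).ncard < (Iic c).ncard :=
    Set.ncard_lt_ncard (Iic_ssubset_Iic.2 hlt) (Set.toFinite _)
  have h2 : (Iic c).ncard ≤ Fintype.card E := by
    rw [← Nat.card_eq_fintype_card, ← Set.ncard_univ]
    exact Set.ncard_le_ncard (subset_univ _) (Set.toFinite _)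
  omega

end OrderBasis

section SignedSums

/-- The sign attached to a Boolean. -/
def boolSign (k : Type*) [Field k] (c : Bool) : k := if c then -1 else 1

/-- A signed sum over all Boolean vectors of a product that looks at one coordinate per factor
decomposes as a product over the coordinates. -/
theorem sum_sign_prod_label {k X ι : Type*} [Field k] [Fintype X] [Fintype ι] [DecidableEq ι]
    (lab : X → Option ι) (τ : X → Bool → k) :
    ∑ s : ι → Bool, (∏ e, boolSign k (s e)) * ∏ x, τ x ((lab x).elim false s) =
      (∏ x with lab x = none, τ x false) *
        ∏ e, ∑ c, boolSign k c * ∏ x with lab x = some e, τ x c := by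
  rw [Finset.prod_univ_sum, Fintype.piFinset_univ, Finset.mul_sum]
  refine Finset.sum_congr rfl fun s _ => ?_
  have hfib : ∏ o, ∏ x with lab x = o, τ x ((lab x).elim false s) =
      ∏ x, τ x ((lab x).elim false s) := Finset.prod_fiberwise _ _ _
  rw [Finset.prod_mul_distrib, ← hfib, Fintype.prod_option, mul_left_comm]
  rw [Finset.prod_congr (s₁ := Finset.univ.filter fun x => lab x = none) rfl
    (g := fun x => τ x false) fun x hx => by rw [(Finset.mem_filter.1 hx).2]; rfl]
  congr 2
  refine Finset.prod_congr rfl fun e _ => Finset.prod_congr rfl fun x hx => ?_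
  rw [(Finset.mem_filter.1 hx).2]
  rfl

theorem sum_sign_prod_label_eq_zero {k X ι : Type*} [Field k] [Fintype X] [Fintype ι]
    [DecidableEq ι]
    (lab : X → Option ι) (τ : X → Bool → k) (e : ι) (he : ∀ x, lab x ≠ some e) :
    ∑ s : ι → Bool, (∏ e, boolSign k (s e)) * ∏ x, τ x ((lab x).elim false s) = 0 := by
  classical
  rw [sum_sign_prod_label, Finset.prod_eq_zero (Finset.mem_univ e), mul_zero]
  simp [he, boolSign]

end SignedSums

section RowBasis

open Set

variable {E : Type*} [PartialOrder E]

open Classical in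
/-- The index of a principal lower set. -/
noncomputable def labelVia {ι : Type*} (j : ι → E) (a : Set E) : Option ι :=
  if h : ∃ i, a = Iic (j i) then some h.choose else none

theorem labelVia_eq_some {ι : Type*} {j : ι → E} (hj : j.Injective) {a : Set E} {i : ι} :
    labelVia j a = some i ↔ a = Iic (j i) := by
  rw [labelVia]
  split_ifs with h
  · rw [Option.some_inj]
    constructor
    · rintro rfl
      exact h.choose_spec
    · intro h'
      exact hj (Iic_inj' (h.choose_spec.symm.trans h'))
  · simp only [false_iff]
    exact fun h' => h ⟨i, h'⟩

theorem labelVia_eq_none {ι : Type*} {j : ι → E} {a : Set E} :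
    labelVia j a = none ↔ ∀ i, a ≠ Iic (j i) := by
  rw [labelVia]
  split_ifs with h
  · simpa using h
  · simpa using h

open Classical in
/-- The local factor in the expansion of the indicator of `Hits` as a signed sum. -/
noncomputable def localFactor (k : Type*) [Field k] (a b : Set E) (c : Bool) : k :=
  if b ⊆ upperBounds a ∧ ¬ (c = true ∧ ∃ e, a = Iic e ∧ b = Ici e) then 1 else 0

theorem localFactor_false (k : Type*) [Field k] (a b : Set E) [Decidable (b ⊆ upperBounds a)] :
    localFactor k a b false = if b ⊆ upperBounds a then 1 else 0 := by
  simp [localFactor]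

theorem hits_iff {X : Type*} {F G : X → Set E} (hF : ∀ x, IsLowerSet (F x))
    (hG : ∀ x, IsUpperSet (G x)) :
    Hits F G ↔ (∀ x, G x ⊆ upperBounds (F x)) ∧ ∀ e, ∃ x, F x = Iic e ∧ G x = Ici e := by
  constructor
  · intro h
    have h1 : ∀ x, G x ⊆ upperBounds (F x) := fun x b hb a ha => (h a b).2 ⟨x, ha, hb⟩
    refine ⟨h1, fun e => ?_⟩
    obtain ⟨x, ha, hb⟩ := (h e e).1 le_rfl
    exact ⟨x, Subset.antisymm (fun y hy => h1 x hb hy) (fun y hy => hF x hy ha),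
      Subset.antisymm (fun y hy => h1 x hy ha) (fun y hy => hG x hy hb)⟩
  · rintro ⟨h1, h2⟩ a b
    constructor
    · intro hab
      obtain ⟨x, hx, hx'⟩ := h2 a
      exact ⟨x, hx ▸ self_mem_Iic, hx' ▸ hab⟩
    · rintro ⟨x, ha, hb⟩
      exact h1 x hb ha

open Classical in
/-- The entry of the hitting matrix. -/
noncomputable def hitsEntry (k : Type*) [Field k] {X : Type*} (F G : X → Set E) : k :=
  if Hits F G then 1 else 0

/-- The families indexing the row basis of the hitting matrix. -/
def hitBasis (X E : Type*) [PartialOrder E] : Set (X → Set E) :=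
  {F | (∀ x, F x ∈ basisValues E) ∧ ∀ e, ∃ x, F x = Iic e}

open Classical in
/-- The test functional attached to a value of the row basis. -/
noncomputable def testVec (k : Type*) [Field k] (h b : Set E) : k :=
  (if b = testSet h then 1 else 0) *
    (if IsGoodIic h then -1 else 1) + if IsGoodIic h ∧ b = upperBounds h then 1 else 0

theorem isUpperSet_of_testVec_ne_zero {k : Type*} [Field k] {h b : Set E}
    (hb : testVec k h b ≠ 0) : IsUpperSet b := by
  by_contra hu
  have h1 : b ≠ testSet h := fun h' => hu (h' ▸ isUpperSet_testSet h)
  have h2 : b ≠ upperBounds h := fun h' => hu (h' ▸ isUpperSet_upperBounds h)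
  exact hb (by simp [testVec, h1, h2])

variable [Fintype E]

theorem hitsEntry_eq_sum [DecidableEq E] (k : Type*) [Field k] {X : Type*} [Fintype X] {F G : X → Set E}
    (hF : ∀ x, IsLowerSet (F x)) (hG : ∀ x, IsUpperSet (G x)) :
    hitsEntry k F G = ∑ s : E → Bool, (∏ e, boolSign k (s e)) *
      ∏ x, localFactor k (F x) (G x) ((labelVia id (F x)).elim false s) := by
  classical
  by_cases h : ∀ x, G x ⊆ upperBounds (F x)
  · rw [sum_sign_prod_label (fun x => labelVia id (F x)) (fun x => localFactor k (F x) (G x))]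
    rw [Finset.prod_eq_one fun x _ => by simp [localFactor_false, h x], one_mul]
    have : ∀ e : E, (∑ c, boolSign k c *
        ∏ x with labelVia id (F x) = some e, localFactor k (F x) (G x) c) =
        if ∃ x, F x = Iic e ∧ G x = Ici e then 1 else 0 := by
      intro e
      rw [Fintype.sum_bool, Finset.prod_eq_one (f := fun x => localFactor k (F x) (G x) false)
        fun x _ => by simp [localFactor_false, h x]]
      have h2 : ∏ x with labelVia id (F x) = some e, localFactor k (F x) (G x) true =
          if ∃ x, F x = Iic e ∧ G x = Ici e then 0 else 1 := by
        split_ifs with hx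
        · obtain ⟨x, hx, hx'⟩ := hx
          refine Finset.prod_eq_zero (i := x) ?_ ?_
          · simp [labelVia_eq_some Function.injective_id, hx]
          · rw [localFactor, if_neg]
            exact fun h' => h'.2 ⟨rfl, e, hx, hx'⟩
        · refine Finset.prod_eq_one fun x hx1 => ?_
          simp only [Finset.mem_filter, Finset.mem_univ, true_and,
            labelVia_eq_some Function.injective_id, id] at hx1
          rw [localFactor, if_pos]
          refine ⟨h x, ?_⟩
          rintro ⟨-, d, hd, hd'⟩
          rw [Iic_inj' (hd.symm.trans hx1)] at hd'
          exact hx ⟨x, hx1, hd'⟩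
      rw [h2]
      split_ifs <;> simp [boolSign]
    simp only [this]
    rw [Finset.prod_boole, hitsEntry]
    simp [hits_iff hF hG, h]
  · rw [hitsEntry, if_neg (by rw [hits_iff hF hG]; exact fun h' => h h'.1)]
    push Not at h
    obtain ⟨x, hx⟩ := h
    symm
    refine Finset.sum_eq_zero fun s _ => ?_
    rw [Finset.prod_eq_zero (Finset.mem_univ x), mul_zero]
    rw [localFactor, if_neg]
    exact fun h' => hx h'.1

/-- The value of a test functional on a local factor. -/
noncomputable def testFactor (k : Type*) [Field k] (h a : Set E) (c : Bool) : k :=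
  ∑ b, testVec k h b * localFactor k a b c

open Classical in
theorem testFactor_eq (k : Type*) [Field k] (h a : Set E) (c : Bool) :
    testFactor k h a c = localFactor k a (testSet h) c * (if IsGoodIic h then -1 else 1) +
      if IsGoodIic h then localFactor k a (upperBounds h) c else 0 := by
  simp only [testFactor, testVec, add_mul, Finset.sum_add_distrib]
  by_cases hg : IsGoodIic h
  · simp [hg]
  · simp [hg]

theorem testFactor_ne_zero {k : Type*} [Field k] {h a : Set E} {c : Bool}
    (ha : a ∈ basisValues E) (hh : h ∈ basisValues E) (hne : testFactor k h a c ≠ 0) :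
    a = h ∨ testRank a < testRank h := by
  classical
  by_contra! hcon
  obtain ⟨hah, hr⟩ := hcon
  refine hne ?_
  rw [testFactor_eq]
  by_cases hg : IsGoodIic h
  · obtain ⟨e, he, rfl⟩ := hg
    rw [if_pos ⟨e, he, rfl⟩, if_pos ⟨e, he, rfl⟩, testSet_Iic he, upperBounds_Iic]
    have hsub : Ioi (topOf e he) ⊆ Ici e := fun x hx => (le_topOf he).trans (le_of_lt hx)
    by_cases hat : a ⊆ Iic (topOf e he)
    · by_cases hae : a ⊆ Iic e
      · have h1 : localFactor k a (Ici e) c = 1 := by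
          rw [localFactor, if_pos]
          refine ⟨fun x hx y hy => le_trans (hae hy) hx, ?_⟩
          rintro ⟨-, d, rfl, hd⟩
          exact hah (by rw [Ici_inj' hd])
        have h2 : localFactor k a (Ioi (topOf e he)) c = 1 := by
          rw [localFactor, if_pos]
          refine ⟨fun x hx y hy => le_trans (hae hy) (hsub hx), ?_⟩
          rintro ⟨-, d, rfl, hd⟩
          exact (meetTop_topOf he).Ioi_ne d hd
        rw [h1, h2]; simp
      · exact absurd (testRank_lt_of_isGoodIic ha he hat hae) (not_lt.2 hr)
    · have h2 : localFactor k a (Ioi (topOf e he)) c = 0 := by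
        rw [localFactor, if_neg]
        rintro ⟨h', -⟩
        refine hat ?_
        rw [← meetTop_topOf he]
        exact fun x hx y hy => h' hy hx
      have h1 : localFactor k a (Ici e) c = 0 := by
        rw [localFactor, if_neg]
        rintro ⟨h', -⟩
        refine hat fun x hx => ?_
        exact (h' (self_mem_Ici : e ∈ Ici e) hx).trans (le_topOf he)
      rw [h1, h2]; simp
  · rw [if_neg hg, if_neg hg, localFactor, if_neg]
    · simp
    · rintro ⟨h', -⟩
      refine absurd (testRank_lt_of_not_isGoodIic ha hh hg (fun x hx y hy => h' hy hx) hah)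
        (not_lt.2 hr)

theorem sum_testVec_mul_hitsEntry [DecidableEq E] (k : Type*) [Field k] {X : Type*} [Fintype X] [DecidableEq X]
    {F : X → Set E} (hF : ∀ x, IsLowerSet (F x)) (H : X → Set E) :
    ∑ G : X → Set E, (∏ x, testVec k (H x) (G x)) * hitsEntry k F G =
      ∑ s : E → Bool, (∏ e, boolSign k (s e)) *
        ∏ x, testFactor k (H x) (F x) ((labelVia id (F x)).elim false s) := by
  have h1 : ∀ G : X → Set E, (∏ x, testVec k (H x) (G x)) * hitsEntry k F G =
      ∑ s : E → Bool, (∏ e, boolSign k (s e)) * ∏ x, (testVec k (H x) (G x) *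
        localFactor k (F x) (G x) ((labelVia id (F x)).elim false s)) := by
    intro G
    by_cases hG : ∀ x, IsUpperSet (G x)
    · rw [hitsEntry_eq_sum k hF hG, Finset.mul_sum]
      refine Finset.sum_congr rfl fun s _ => ?_
      rw [Finset.prod_mul_distrib, mul_left_comm]
    · push Not at hG
      obtain ⟨x, hx⟩ := hG
      have h0 : testVec k (H x) (G x) = 0 := by
        by_contra h
        exact hx (isUpperSet_of_testVec_ne_zero h)
      rw [Finset.prod_eq_zero (Finset.mem_univ x) h0, zero_mul]
      symm
      refine Finset.sum_eq_zero fun s _ => ?_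
      rw [Finset.prod_eq_zero (Finset.mem_univ x) (by rw [h0, zero_mul]), mul_zero]
  simp only [h1]
  rw [Finset.sum_comm]
  refine Finset.sum_congr rfl fun s _ => ?_
  rw [← Finset.mul_sum]
  congr 1
  simp only [testFactor]
  rw [Finset.prod_univ_sum, Fintype.piFinset_univ]

theorem sum_testVec_mul_hitsEntry_self (k : Type*) [Field k] [CharZero k] {X : Type*} [Fintype X]
    [DecidableEq X] {H : X → Set E} (hH : H ∈ hitBasis X E) :
    ∑ G : X → Set E, (∏ x, testVec k (H x) (G x)) * hitsEntry k H G ≠ 0 := by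
  classical
  rw [sum_testVec_mul_hitsEntry k fun x => isLowerSet_of_mem_basisValues (hH.1 x),
    sum_sign_prod_label (fun x => labelVia id (H x)) fun x => testFactor k (H x) (H x)]
  refine mul_ne_zero ?_ ?_
  · refine Finset.prod_ne_zero_iff.2 fun x hx => ?_
    simp only [Finset.mem_filter, Finset.mem_univ, true_and, labelVia_eq_none, id] at hx
    have hg : ¬ IsGoodIic (H x) := fun ⟨e, _, he⟩ => hx e he
    have hsub : testSet (H x) ⊆ upperBounds (H x) := by
      by_cases hi : IsGoodIio (H x)
      · obtain ⟨e, he, hj, hx'⟩ := hi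
        rw [hx', testSet_Iio he hj, hj]
        exact fun y hy => (le_topOf he).trans (le_of_lt hy)
      · rw [testSet_of_not hg hi]
    rw [testFactor_eq, localFactor_false, if_neg hg, if_neg hg, if_pos hsub]
    simp
  · refine Finset.prod_ne_zero_iff.2 fun e _ => ?_
    obtain ⟨x₀, hx₀⟩ := hH.2 e
    have hlab : ∀ x, labelVia id (H x) = some e ↔ H x = Iic e := fun x =>
      labelVia_eq_some Function.injective_id
    simp only [hlab]
    have hprod : ∀ c, ∏ x with H x = Iic e, testFactor k (H x) (H x) c =
        testFactor k (Iic e) (Iic e) c ^ (Finset.univ.filter fun x => H x = Iic e).card := by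
      intro c
      rw [Finset.prod_congr rfl (g := fun _ => testFactor k (Iic e) (Iic e) c), Finset.prod_const]
      intro x hx
      rw [(Finset.mem_filter.1 hx).2]
    have hpos : (Finset.univ.filter fun x => H x = Iic e).card ≠ 0 :=
      (Finset.card_pos.2 ⟨x₀, by simp [hx₀]⟩).ne'
    have hcrit : localFactor k (Iic e) (Ici e) true = 0 := by
      rw [localFactor, if_neg]
      exact fun h => h.2 ⟨rfl, e, rfl, rfl⟩
    rw [Fintype.sum_bool, hprod, hprod, testFactor_eq, testFactor_eq, localFactor_false,
      localFactor_false]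
    by_cases he : Good e
    · have hI : IsGoodIic (Iic e) := ⟨e, he, rfl⟩
      have hsub : Ioi (topOf e he) ⊆ Ici e := fun y hy => (le_topOf he).trans (le_of_lt hy)
      have hone : localFactor k (Iic e) (Ioi (topOf e he)) true = 1 := by
        rw [localFactor, if_pos]
        refine ⟨by rwa [upperBounds_Iic], ?_⟩
        rintro ⟨-, d, -, hd⟩
        exact (meetTop_topOf he).Ioi_ne d hd
      rw [if_pos hI, if_pos hI, if_pos hI, testSet_Iic he, upperBounds_Iic, if_pos hsub,
        if_pos le_rfl, hcrit, hone]
      simp only [boolSign, if_true, Bool.false_eq_true, if_false, one_mul, add_zero,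
        neg_add_cancel, zero_pow hpos, mul_zero]
      exact mul_ne_zero (neg_ne_zero.2 one_ne_zero) (pow_ne_zero _ (neg_ne_zero.2 one_ne_zero))
    · have hI : ¬ IsGoodIic (Iic e) := fun ⟨d, hd, h⟩ => he (Iic_inj' h ▸ hd)
      have hI' : ¬ IsGoodIio (Iic e) := fun ⟨d, hd, hj, h⟩ => hj.Iio_ne e h.symm
      rw [if_neg hI, if_neg hI, if_neg hI, testSet_of_not hI hI', upperBounds_Iic, hcrit,
        if_pos le_rfl]
      simp [boolSign, zero_pow hpos]

/-- The row of the hitting matrix attached to a family. -/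
noncomputable def hitsRow (k : Type*) [Field k] {X : Type*} (F : X → Set E)
    (G : {G : X → Set E // ∀ x, IsUpperSet (G x)}) : k :=
  hitsEntry k F G.1

theorem linearIndependent_hitsRow (k : Type*) [Field k] [CharZero k] (X E : Type*) [Fintype X]
    [PartialOrder E] [Fintype E] :
    LinearIndependent k fun F : hitBasis X E => hitsRow k F.1 := by
  classical
  rw [Fintype.linearIndependent_iff]
  intro c hc
  by_contra! hne
  obtain ⟨H, hH, hmin⟩ := Finset.exists_min_image (Finset.univ.filter fun F => c F ≠ 0)
    (fun F : hitBasis X E => ∑ x, testRank (F.1 x)) (by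
      obtain ⟨F, hF⟩ := hne
      exact ⟨F, by simpa using hF⟩)
  have hcH : c H ≠ 0 := (Finset.mem_filter.1 hH).2
  have hzero : ∑ F : hitBasis X E, c F *
      ∑ G : X → Set E, (∏ x, testVec k (H.1 x) (G x)) * hitsEntry k F.1 G = 0 := by
    simp only [Finset.mul_sum]
    rw [Finset.sum_comm]
    refine Finset.sum_eq_zero fun G _ => ?_
    by_cases hG : ∀ x, IsUpperSet (G x)
    · have := congrFun hc ⟨G, hG⟩
      simp only [Finset.sum_apply, Pi.smul_apply, hitsRow, smul_eq_mul, Pi.zero_apply] at this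
      rw [← mul_zero (∏ x, testVec k (H.1 x) (G x)), ← this, Finset.mul_sum]
      exact Finset.sum_congr rfl fun F _ => by ring
    · push Not at hG
      obtain ⟨x, hx⟩ := hG
      refine Finset.sum_eq_zero fun F _ => ?_
      rw [Finset.prod_eq_zero (Finset.mem_univ x) (by
        by_contra h
        exact hx (isUpperSet_of_testVec_ne_zero h)), zero_mul, mul_zero]
  rw [Finset.sum_eq_single H] at hzero
  · exact (mul_ne_zero hcH (sum_testVec_mul_hitsEntry_self k H.2)) hzero
  · intro F _ hFH
    by_cases hcF : c F = 0
    · rw [hcF, zero_mul]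
    rw [sum_testVec_mul_hitsEntry k fun x => isLowerSet_of_mem_basisValues (F.2.1 x)]
    rw [Finset.sum_eq_zero, mul_zero]
    intro s _
    by_contra hs
    have hall : ∀ x, F.1 x = H.1 x ∨ testRank (F.1 x) < testRank (H.1 x) := fun x =>
      testFactor_ne_zero (F.2.1 x) (H.2.1 x)
        (Finset.prod_ne_zero_iff.1 (right_ne_zero_of_mul hs) x (Finset.mem_univ x))
    have hle := hmin F (by simpa using hcF)
    have hlt : ∃ x, F.1 x ≠ H.1 x := by
      by_contra! h
      exact hFH (Subtype.ext (funext h))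
    obtain ⟨x, hx⟩ := hlt
    refine absurd hle (not_le.2 (Finset.sum_lt_sum (fun y _ => ?_)
      ⟨x, Finset.mem_univ x, (hall x).resolve_left hx⟩))
    rcases hall y with h | h
    · rw [h]
    · exact h.le
  · simp

end RowBasis

section RowSpan

open Set

variable {E : Type*} [PartialOrder E]

/-- The principal lower sets of elements that are not good. -/
def IsBadIic (h : Set E) : Prop := ∃ e, ¬ Good e ∧ h = Iic e

theorem not_isBadIic_of_forall_ne {p : Set E} (hp : ∀ e, p ≠ Iic e) : ¬ IsBadIic p :=
  fun ⟨e, _, he⟩ => hp e he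

theorem not_isGoodIic_of_forall_ne {p : Set E} (hp : ∀ e, p ≠ Iic e) : ¬ IsGoodIic p :=
  fun ⟨e, _, he⟩ => hp e he

open Classical in
/-- The column factor in the rank factorization of the local factors. -/
noncomputable def colFactor (k : Type*) [Field k] (h b : Set E) (c : Bool) : k :=
  if IsBadIic h then (if b = upperBounds h then 1 else 0) else localFactor k h b c

variable [Fintype E]

open Classical in
/-- The indicator of the subsets of `u` is a combination of column factors of values that are not
good principal lower sets. -/
def IsColComb (k : Type*) [Field k] (u : Set E) : Prop :=
  ∃ n : Set E → k, (∀ h, n h ≠ 0 → h ∈ basisValues E ∧ ¬ IsGoodIic h) ∧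
    ∀ b, IsUpperSet b → (if b ⊆ u then 1 else 0) = ∑ h, n h * colFactor k h b false

theorem isColComb_upperBounds (k : Type*) [Field k] {p : Set E} (hp : p ∈ basisValues E)
    (hne : ∀ e, p ≠ Iic e) : IsColComb k (upperBounds p) := by
  classical
  refine ⟨Pi.single p 1, fun h hh => ?_, fun b _ => ?_⟩
  · obtain rfl : h = p := by
      by_contra hc
      exact hh (Pi.single_eq_of_ne hc 1)
    exact ⟨hp, not_isGoodIic_of_forall_ne hne⟩
  · rw [Finset.sum_eq_single p, Pi.single_eq_same, one_mul, colFactor,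
      if_neg (not_isBadIic_of_forall_ne hne), localFactor_false]
    · intro h _ hh
      rw [Pi.single_eq_of_ne hh, zero_mul]
    · simp

theorem IsColComb.Ici_of_Ioi {k : Type*} [Field k] {e : E} (he : ¬ Good e)
    (h : IsColComb k (Ioi e)) : IsColComb k (Ici e) := by
  classical
  obtain ⟨n, hn, hn'⟩ := h
  have hbad : ¬ IsGoodIic (Iic e) := fun ⟨d, hd, h⟩ => he (Iic_inj' h ▸ hd)
  refine ⟨n + Pi.single (Iic e) 1, fun h hh => ?_, fun b hb => ?_⟩
  · by_cases hc : h = Iic e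
    · rw [hc]
      exact ⟨Iic_mem_basisValues e, hbad⟩
    · rw [Pi.add_apply, Pi.single_eq_of_ne hc, add_zero] at hh
      exact hn h hh
  · simp only [Pi.add_apply, add_mul, Finset.sum_add_distrib, ← hn' b hb]
    rw [Finset.sum_eq_single (Iic e), Pi.single_eq_same, one_mul, colFactor,
      if_pos (show IsBadIic (Iic e) from ⟨e, he, rfl⟩), upperBounds_Iic]
    · by_cases h1 : b = Ici e
      · subst h1
        have : ¬ Ici e ⊆ Ioi e := fun h => lt_irrefl e (h self_mem_Ici)
        simp [this]
      · by_cases h2 : b ⊆ Ici e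
        · simp [h1, h2, hb.subset_Ioi h2 h1]
        · have h3 : ¬ b ⊆ Ioi e := fun h => h2 (h.trans Ioi_subset_Ici_self)
          simp [h1, h2, h3]
    · intro h _ hh
      rw [Pi.single_eq_of_ne hh, zero_mul]
    · simp

theorem isColComb_Ici (k : Type*) [Field k] (e : E) (he : ¬ Good e) : IsColComb k (Ici e) := by
  induction e using WellFoundedGT.induction with
  | _ e ih =>
  refine IsColComb.Ici_of_Ioi he ?_
  have hq : lowerBounds (Ioi e) ≠ Iic e := fun h => he ⟨e, .refl, h⟩
  have heq : e ∈ lowerBounds (Ioi e) := fun x hx => le_of_lt hx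
  have hu : upperBounds (lowerBounds (Ioi e)) = Ioi e := by
    refine Subset.antisymm (fun x hx => lt_of_le_of_ne (hx heq) ?_) fun x hx y hy => hy hx
    rintro rfl
    exact hq (Subset.antisymm (fun y hy => hx hy) fun y hy z hz => le_trans hy (heq hz))
  by_cases hp : ∀ d, lowerBounds (Ioi e) ≠ Iic d
  · rw [← hu]
    exact isColComb_upperBounds k (Or.inl (lowerBounds_upperBounds_lowerBounds _)) hp
  · push Not at hp
    obtain ⟨d, hd⟩ := hp
    rw [hd, upperBounds_Iic] at hu
    have hlt : e < d := by
      have : d ∈ Ioi e := hu ▸ self_mem_Ici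
      exact this
    rw [← hu]
    by_cases hgd : Good d
    · have hl : Iio d ≠ Iic e := fun h => he (Link.good ⟨hu.symm, h⟩ hgd)
      have hj : JoinBot d := by
        refine Subset.antisymm (fun x hx => ?_) fun x hx y hy => (le_of_lt hy).trans hx
        rw [hu]
        refine lt_of_le_of_ne (hx hlt) ?_
        rintro rfl
        exact hl (Subset.antisymm (fun y hy => hx hy) fun y hy => lt_of_le_of_lt hy hlt)
      rw [← hj]
      exact isColComb_upperBounds k (Or.inr ⟨d, hgd, hj, rfl⟩) hj.Iio_ne
    · exact ih d hlt hgd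

theorem isColComb_of_isLowerSet (k : Type*) [Field k] {a : Set E} (ha : IsLowerSet a)
    (hg : ¬ IsGoodIic a) : IsColComb k (upperBounds a) := by
  by_cases h : ∃ e, upperBounds a = Ici e
  · obtain ⟨e, he⟩ := h
    by_cases hge : Good e
    · have hsub : a ⊆ Iic e := fun x hx => (he ▸ self_mem_Ici : e ∈ upperBounds a) hx
      have hsub' : a ⊆ Iio e := ha.subset_Iio hsub fun h => hg ⟨e, hge, h⟩
      have hj : JoinBot e := Subset.antisymm
        (he ▸ upperBounds_mono_set hsub') fun x hx y hy => (le_of_lt hy).trans hx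
      rw [he, ← hj]
      exact isColComb_upperBounds k (Or.inr ⟨e, hge, hj, rfl⟩) hj.Iio_ne
    · rw [he]
      exact isColComb_Ici k e hge
  · rw [← upperBounds_lowerBounds_upperBounds]
    refine isColComb_upperBounds k (Or.inl (lowerBounds_upperBounds_lowerBounds _)) fun e he => ?_
    refine h ⟨e, ?_⟩
    rw [← upperBounds_lowerBounds_upperBounds, he, upperBounds_Iic]

open Classical in
/-- The coefficients of a local factor in terms of column factors. -/
noncomputable def combCoeff (k : Type*) [Field k] (a h : Set E) : k :=
  if IsGoodIic a then (if h = a then 1 else 0) else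
    if ha : IsColComb k (upperBounds a) then ha.choose h else 0

open Classical in
/-- The label of the row factor. -/
noncomputable def rowLabel (a h : Set E) : Option {e : E // ¬ Good e} :=
  if a = h then labelVia Subtype.val a else none

/-- The label of the column factor. -/
noncomputable def colLabel (h : Set E) : Option {e : E // Good e} := labelVia Subtype.val h

/-- The row factor in the rank factorization of the local factors. -/
noncomputable def rowFactor (k : Type*) [Field k] (a h : Set E) (c : Bool) : k :=
  combCoeff k a h - if c then 1 else 0

theorem mem_basisValues_of_combCoeff_ne_zero {k : Type*} [Field k] {a h : Set E}
    (hn : combCoeff k a h ≠ 0) : h ∈ basisValues E ∧ (IsGoodIic h → IsGoodIic a) := by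
  rw [combCoeff] at hn
  split_ifs at hn with h1 h2 h3
  · obtain ⟨e, he, rfl⟩ := h1
    exact ⟨h2 ▸ Iic_mem_basisValues e, fun _ => ⟨e, he, rfl⟩⟩
  · exact absurd rfl hn
  · have := h3.choose_spec.1 h hn
    exact ⟨this.1, fun h => absurd h this.2⟩
  · exact absurd rfl hn

theorem localFactor_eq_sum [DecidableEq E] (k : Type*) [Field k] {a b : Set E} (ha : IsLowerSet a)
    (hb : IsUpperSet b) (s : E → Bool) :
    localFactor k a b ((labelVia id a).elim false s) =
      ∑ h, rowFactor k a h ((rowLabel a h).elim false fun e => s e) *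
        colFactor k h b ((colLabel h).elim false fun e => s e) := by
  classical
  by_cases hg : IsGoodIic a
  · have hrow : ∀ h, rowFactor k a h ((rowLabel a h).elim false fun e => s e) =
        if h = a then 1 else 0 := by
      intro h
      have : rowLabel a h = none := by
        rw [rowLabel]
        split_ifs
        · rw [labelVia_eq_none]
          rintro ⟨d, hd⟩ rfl
          obtain ⟨e, he, h⟩ := hg
          exact hd ((Iic_inj' h : d = e) ▸ he)
        · rfl
      simp [rowFactor, this, combCoeff, hg]
    obtain ⟨e, he, rfl⟩ := hg
    have h1 : labelVia id (Iic e) = some e := (labelVia_eq_some Function.injective_id).2 rfl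
    have h2 : colLabel (Iic e) = some ⟨e, he⟩ := (labelVia_eq_some Subtype.val_injective).2 rfl
    have h3 : ¬ IsBadIic (Iic e) := fun ⟨d, hd, h⟩ => hd (Iic_inj' h ▸ he)
    simp only [hrow, ite_mul, one_mul, zero_mul, Finset.sum_ite_eq', Finset.mem_univ, if_true]
    rw [colFactor, if_neg h3, h1, h2]
    rfl
  · have hcomb := isColComb_of_isLowerSet k ha hg
    have hcoef : ∀ h, combCoeff k a h = hcomb.choose h := fun h => by
      rw [combCoeff, if_neg hg, dif_pos hcomb]
    have hcol : ∀ h, combCoeff k a h * colFactor k h b ((colLabel h).elim false fun e => s e) =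
        hcomb.choose h * colFactor k h b false := by
      intro h
      rw [hcoef]
      by_cases h0 : hcomb.choose h = 0
      · rw [h0, zero_mul, zero_mul]
      · have : colLabel h = none := by
          rw [colLabel, labelVia_eq_none]
          rintro ⟨e, he⟩ rfl
          exact (hcomb.choose_spec.1 _ h0).2 ⟨e, he, rfl⟩
        rw [this]
        rfl
    simp only [rowFactor, sub_mul, Finset.sum_sub_distrib, hcol]
    rw [← hcomb.choose_spec.2 b hb, Finset.sum_eq_single a]
    · by_cases hp : ∃ e, a = Iic e
      · obtain ⟨e, rfl⟩ := hp
        have he : ¬ Good e := fun he => hg ⟨e, he, rfl⟩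
        have h1 : labelVia id (Iic e) = some e := (labelVia_eq_some Function.injective_id).2 rfl
        have h2 : rowLabel (Iic e) (Iic e) = some ⟨e, he⟩ := by
          rw [rowLabel, if_pos rfl]
          exact (labelVia_eq_some Subtype.val_injective).2 rfl
        have h3 : (∃ d, Iic e = Iic d ∧ b = Ici d) ↔ b = Ici e :=
          ⟨fun ⟨d, hd, hb⟩ => Iic_inj' hd ▸ hb, fun h => ⟨e, rfl, h⟩⟩
        rw [h1, h2, colFactor,
          if_pos (show IsBadIic (Iic e) from ⟨e, he, rfl⟩), localFactor, upperBounds_Iic, h3]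
        simp only [Option.elim]
        by_cases hbe : b = Ici e
        · subst hbe
          by_cases hs : s e = true <;> simp [hs]
        · simp [hbe]
      · push Not at hp
        have h1 : labelVia id a = none := labelVia_eq_none.2 hp
        have h2 : rowLabel a a = none := by
          rw [rowLabel, if_pos rfl]
          exact labelVia_eq_none.2 fun e => hp e
        rw [h1, h2]
        simp [localFactor_false]
    · intro h _ hh
      rw [rowLabel, if_neg (Ne.symm hh)]
      simp
    · simp

/-- The coefficient of a family in the expansion of a row of the hitting matrix. -/
noncomputable def rowCoeff (k : Type*) [Field k] {X : Type*} [Fintype X] (F H : X → Set E) : k := by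
  classical
  exact ∑ s : {e : E // ¬ Good e} → Bool, (∏ e, boolSign k (s e)) *
    ∏ x, rowFactor k (F x) (H x) ((rowLabel (F x) (H x)).elim false s)

/-- The vectors in terms of which the rows of the hitting matrix are expanded. -/
noncomputable def colVec (k : Type*) [Field k] {X : Type*} [Fintype X] (H G : X → Set E) : k := by
  classical
  exact ∑ s : {e : E // Good e} → Bool, (∏ e, boolSign k (s e)) *
    ∏ x, colFactor k (H x) (G x) ((colLabel (H x)).elim false s)

theorem hitsEntry_eq_sum_rowCoeff (k : Type*) [Field k] {X : Type*} [Fintype X] [DecidableEq X]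
    {F G : X → Set E} (hF : ∀ x, IsLowerSet (F x)) (hG : ∀ x, IsUpperSet (G x)) :
    hitsEntry k F G = ∑ H : X → Set E, rowCoeff k F H * colVec k H G := by
  classical
  rw [hitsEntry_eq_sum k hF hG]
  simp only [fun x => localFactor_eq_sum k (hF x) (hG x)]
  simp only [Finset.prod_univ_sum, Fintype.piFinset_univ, Finset.mul_sum]
  rw [Finset.sum_comm]
  refine Finset.sum_congr rfl fun H _ => ?_
  rw [rowCoeff, colVec, mul_comm, Finset.sum_mul_sum, ← Finset.sum_product',
    Finset.univ_product_univ]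
  refine Fintype.sum_equiv (Equiv.piEquivPiSubtypeProd Good fun _ => Bool) _ _ fun s => ?_
  simp only [Equiv.piEquivPiSubtypeProd_apply]
  rw [Finset.prod_mul_distrib, ← Fintype.prod_subtype_mul_prod_subtype Good]
  ring

theorem mem_hitBasis_of_ne_zero (k : Type*) [Field k] {X : Type*} [Fintype X]
    {F H G : X → Set E} (h : rowCoeff k F H * colVec k H G ≠ 0) : H ∈ hitBasis X E := by
  classical
  have hrow := left_ne_zero_of_mul h
  have hcol := right_ne_zero_of_mul h
  refine ⟨fun x => ?_, fun e => ?_⟩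
  · rw [rowCoeff] at hrow
    obtain ⟨s, -, hs⟩ := Finset.exists_ne_zero_of_sum_ne_zero hrow
    have hx := Finset.prod_ne_zero_iff.1 (right_ne_zero_of_mul hs) x (Finset.mem_univ x)
    by_cases h0 : combCoeff k (F x) (H x) = 0
    · rw [rowFactor, h0, rowLabel] at hx
      split_ifs at hx with h1 h2
      · have h3 : labelVia (Subtype.val : {e : E // ¬ Good e} → E) (F x) ≠ none := by
          intro h3
          rw [h3] at h2
          exact absurd h2 (by simp)
        rw [Ne, labelVia_eq_none] at h3
        push Not at h3
        obtain ⟨e, he⟩ := h3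
        rw [← h1, he]
        exact Iic_mem_basisValues _
      all_goals simp_all
    · exact (mem_basisValues_of_combCoeff_ne_zero h0).1
  · by_contra! hne
    by_cases he : Good e
    · refine hcol ?_
      rw [colVec, sum_sign_prod_label_eq_zero (fun x => colLabel (H x))
        (fun x => colFactor k (H x) (G x)) ⟨e, he⟩]
      intro x hx
      exact hne x ((labelVia_eq_some Subtype.val_injective).1 hx)
    · refine hrow ?_
      rw [rowCoeff, sum_sign_prod_label_eq_zero (fun x => rowLabel (F x) (H x))
        (fun x => rowFactor k (F x) (H x)) ⟨e, he⟩]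
      intro x hx
      rw [rowLabel] at hx
      split_ifs at hx with h1
      exact hne x (h1 ▸ (labelVia_eq_some Subtype.val_injective).1 hx)

theorem hitsRow_mem_span (k : Type*) [Field k] [CharZero k] {X : Type*} [Fintype X]
    {F : X → Set E} (hF : ∀ x, IsLowerSet (F x)) :
    hitsRow k F ∈ Submodule.span k (range fun F : hitBasis X E => hitsRow k F.1) := by
  classical
  let V : hitBasis X E → {G : X → Set E // ∀ x, IsUpperSet (G x)} → k :=
    fun H G => colVec k H.1 G.1
  have hmem : ∀ {F : X → Set E}, (∀ x, IsLowerSet (F x)) →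
      hitsRow k F ∈ Submodule.span k (range V) := by
    intro F hF
    have : hitsRow k F = ∑ H : hitBasis X E, rowCoeff k F H.1 • V H := by
      funext G
      rw [hitsRow, hitsEntry_eq_sum_rowCoeff k hF G.2]
      simp only [Finset.sum_apply, Pi.smul_apply, smul_eq_mul, V]
      rw [← Finset.sum_subset (Finset.subset_univ (hitBasis X E).toFinset)]
      · exact (Finset.sum_subtype _ (fun _ => by simp) fun H => rowCoeff k F H * colVec k H G.1)
      · intro H _ hH
        by_contra h0
        exact hH (by simpa using mem_hitBasis_of_ne_zero k h0)
    rw [this]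
    exact Submodule.sum_mem _ fun H _ =>
      Submodule.smul_mem _ _ (Submodule.subset_span (mem_range_self H))
  have hle : Submodule.span k (range fun F : hitBasis X E => hitsRow k F.1) ≤
      Submodule.span k (range V) := by
    rw [Submodule.span_le]
    rintro _ ⟨H, rfl⟩
    exact hmem fun x => isLowerSet_of_mem_basisValues (H.2.1 x)
  rw [Submodule.eq_of_le_of_finrank_le hle]
  · exact hmem hF
  · rw [finrank_span_eq_card (linearIndependent_hitsRow k X E)]
    exact finrank_range_le_card V

end RowSpan

section Columns

open Set

theorem exists_linearIndependent_columns {k ι Y : Type*} [Field k] [Fintype ι] [Fintype Y]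
    {v : ι → Y → k} (hv : LinearIndependent k v) :
    ∃ C : ι → Y, LinearIndependent k (fun j i => v i (C j)) := by
  classical
  have hrank : Module.finrank k (Submodule.span k (range fun y i => v i y)) = Fintype.card ι := by
    have h1 := LinearIndependent.rank_matrix (M := Matrix.of v) hv
    rw [Matrix.rank_eq_finrank_span_cols] at h1
    exact h1
  obtain ⟨κ, a, ha, hspan, hli⟩ := exists_linearIndependent' k fun (y : Y) (i : ι) => v i y
  have : Fintype κ := Fintype.ofInjective a ha
  have hcard : Fintype.card ι = Fintype.card κ := by
    rw [← hrank, ← hspan, finrank_span_eq_card hli]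
  let e := Fintype.equivOfCardEq hcard
  exact ⟨a ∘ e, hli.comp e e.injective⟩

theorem exists_column_basis (k : Type*) [Field k] [CharZero k] (X E : Type*) [Fintype X]
    [PartialOrder E] [Fintype E] :
    ∃ C : hitBasis X E → X → Set E, (∀ H x, IsUpperSet (C H x)) ∧
      LinearIndependent k (fun (H F : hitBasis X E) => hitsEntry k F.1 (C H)) ∧
      ∀ G : X → Set E, (∀ x, IsUpperSet (G x)) → ∃ d : hitBasis X E → k,
        ∀ F : X → Set E, (∀ x, IsLowerSet (F x)) →
          hitsEntry k F G = ∑ᶠ H, d H * hitsEntry k F (C H) := by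
  classical
  obtain ⟨C, hC⟩ := exists_linearIndependent_columns (linearIndependent_hitsRow k X E)
  refine ⟨fun H => (C H).1, fun H => (C H).2, hC, fun G hG => ?_⟩
  have htop : Submodule.span k (range fun (H F : hitBasis X E) => hitsRow k F.1 (C H)) = ⊤ :=
    hC.span_eq_top_of_card_eq_finrank' (by simp)
  have hmem : (fun F : hitBasis X E => hitsEntry k F.1 G) ∈
      Submodule.span k (range fun (H F : hitBasis X E) => hitsRow k F.1 (C H)) := by
    rw [htop]; trivial
  obtain ⟨d, hd⟩ := (Submodule.mem_span_range_iff_exists_fun k).1 hmem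
  refine ⟨d, fun F hF => ?_⟩
  rw [finsum_eq_sum_of_fintype]
  obtain ⟨c, hc⟩ := (Submodule.mem_span_range_iff_exists_fun k).1 (hitsRow_mem_span k hF)
  have hrow : ∀ G', (hG' : ∀ x, IsUpperSet (G' x)) → hitsEntry k F G' =
      ∑ F' : hitBasis X E, c F' * hitsEntry k F'.1 G' := by
    intro G' hG'
    have := congrFun hc ⟨G', hG'⟩
    simp only [Finset.sum_apply, Pi.smul_apply, smul_eq_mul, hitsRow] at this
    exact this.symm
  rw [hrow G hG]
  simp only [fun H => hrow _ (C H).2, Finset.mul_sum]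
  rw [Finset.sum_comm]
  refine Finset.sum_congr rfl fun F' _ => ?_
  have := congrFun hd F'
  simp only [Finset.sum_apply, Pi.smul_apply, smul_eq_mul, hitsRow] at this
  rw [← this, Finset.mul_sum]
  exact Finset.sum_congr rfl fun H _ => by ring

end Columns

section Pairing

open Set

variable {X E E' : Type*} [PartialOrder E] [PartialOrder E']

/-- The image of a family of subsets under an order isomorphism. -/
def imgFam (s : E ≃o E') (F : X → Set E) (x : X) : Set E' := s '' F x

/-- The relation on `X` that tests functionals attached to other posets. -/
def testRel (G' F' : X → Set E') : Set (X × X) := {p | ∃ e, e ∈ G' p.1 ∧ e ∈ F' p.2}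

theorem mem_imgFam {s : E ≃o E'} {F : X → Set E} {x : X} {b : E'} :
    b ∈ imgFam s F x ↔ s.symm b ∈ F x := by
  constructor
  · rintro ⟨a, ha, rfl⟩
    simpa using ha
  · exact fun h => ⟨_, h, by simp⟩

omit [PartialOrder E'] in
theorem hits_relAct_testRel_iff {F G : X → Set E} {F' G' : X → Set E'} :
    Hits F (relAct (testRel G' F') G) ↔
      ∀ a b, a ≤ b ↔ ∃ e, (∃ x, a ∈ F x ∧ e ∈ G' x) ∧ ∃ y, e ∈ F' y ∧ b ∈ G y := by
  refine forall₂_congr fun a b => iff_congr Iff.rfl ?_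
  constructor
  · rintro ⟨x, ha, y, ⟨e, he, he'⟩, hb⟩
    exact ⟨e, ⟨x, ha, he⟩, y, he', hb⟩
  · rintro ⟨e, ⟨x, ha, he⟩, y, he', hb⟩
    exact ⟨x, ha, y, ⟨e, he, he'⟩, hb⟩

theorem exists_map_of_hits {F G : X → Set E} {F' G' : X → Set E'}
    (hG' : ∀ x, IsUpperSet (G' x)) (h : Hits F (relAct (testRel G' F') G)) :
    ∃ s : E → E', (∀ a b, s a ≤ s b → a ≤ b) ∧ (∀ a, ∃ x, a ∈ F x ∧ s a ∈ G' x) ∧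
      ∀ a, ∃ y, s a ∈ F' y ∧ a ∈ G y := by
  rw [hits_relAct_testRel_iff] at h
  choose s hs1 hs2 using fun a => (h a a).1 le_rfl
  refine ⟨s, fun a b hab => (h a b).2 ⟨s b, ?_, hs2 b⟩, hs1, hs2⟩
  obtain ⟨x, hx, hx'⟩ := hs1 a
  exact ⟨x, hx, hG' x hab hx'⟩

theorem injective_of_reflects_le {s : E → E'} (hs : ∀ a b, s a ≤ s b → a ≤ b) : s.Injective :=
  fun a b hab => le_antisymm (hs a b hab.le) (hs b a hab.ge)

theorem imgFam_refl (F : X → Set E) : imgFam (OrderIso.refl E) F = F := by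
  funext x
  ext b
  simp [mem_imgFam]

variable [Fintype E] [Fintype E']

theorem card_le_of_hits {F G : X → Set E} {F' G' : X → Set E'}
    (hG' : ∀ x, IsUpperSet (G' x)) (h : Hits F (relAct (testRel G' F') G)) :
    Fintype.card E ≤ Fintype.card E' := by
  obtain ⟨s, hs, -⟩ := exists_map_of_hits hG' h
  exact Fintype.card_le_of_injective s (injective_of_reflects_le hs)

theorem exists_orderIso_of_hits {F G : X → Set E} {F' G' : X → Set E'}
    (hG' : ∀ x, IsUpperSet (G' x)) (hF' : ∀ x, IsLowerSet (F' x))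
    (hcard : Fintype.card E = Fintype.card E')
    (hle : (leRel E).ncard ≤ (leRel E').ncard) (h : Hits F (relAct (testRel G' F') G)) :
    ∃ s : E ≃o E', Hits (imgFam s F) G' ∧ Hits F' (imgFam s G) := by
  obtain ⟨s, hs, hs1, hs2⟩ := exists_map_of_hits hG' h
  rw [hits_relAct_testRel_iff] at h
  have hinj := injective_of_reflects_le hs
  have hbij : s.Bijective := (Fintype.bijective_iff_injective_and_card s).2 ⟨hinj, hcard⟩
  have hpre : Prod.map s s ⁻¹' leRel E' = leRel E := by
    refine Set.eq_of_subset_of_ncard_le (fun p hp => hs _ _ hp) ?_ (Set.toFinite _)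
    rw [Set.ncard_preimage_of_injective_subset_range (hinj.prodMap hinj)]
    · exact hle
    · rw [(hbij.2.prodMap hbij.2).range_eq]
      exact subset_univ _
  have hmono : ∀ a b, s a ≤ s b ↔ a ≤ b := fun a b => by
    have : (a, b) ∈ Prod.map s s ⁻¹' leRel E' ↔ (a, b) ∈ leRel E := by rw [hpre]
    exact this
  let t : E ≃o E' := ⟨Equiv.ofBijective s hbij, fun {a b} => hmono a b⟩
  have ht : ∀ a, t a = s a := fun _ => rfl
  refine ⟨t, fun a b => ?_, fun a b => ?_⟩
  · obtain ⟨a, rfl⟩ := t.surjective a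
    obtain ⟨b, rfl⟩ := t.surjective b
    simp only [mem_imgFam, OrderIso.symm_apply_apply, OrderIso.le_iff_le]
    constructor
    · intro hab
      obtain ⟨x, hx, hx'⟩ := hs1 a
      exact ⟨x, hx, hG' x ((hmono a b).2 hab) hx'⟩
    · rintro ⟨x, hx, hx'⟩
      exact (h a b).2 ⟨s b, ⟨x, hx, hx'⟩, hs2 b⟩
  · obtain ⟨a, rfl⟩ := t.surjective a
    obtain ⟨b, rfl⟩ := t.surjective b
    simp only [mem_imgFam, OrderIso.symm_apply_apply, OrderIso.le_iff_le]
    constructor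
    · intro hab
      obtain ⟨x, hx, hx'⟩ := hs2 b
      exact ⟨x, hF' x ((hmono a b).2 hab) hx, hx'⟩
    · rintro ⟨x, hx, hx'⟩
      exact (h a b).2 ⟨s a, hs1 a, x, hx, hx'⟩

omit [Fintype E] [Fintype E'] in
theorem hits_of_orderIso {F G : X → Set E} {F' G' : X → Set E'} (s : E ≃o E')
    (h1 : Hits (imgFam s F) G') (h2 : Hits F' (imgFam s G)) :
    Hits F (relAct (testRel G' F') G) := by
  rw [hits_relAct_testRel_iff]
  have hp : ∀ a e, (∃ x, a ∈ F x ∧ e ∈ G' x) ↔ s a ≤ e := fun a e => by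
    rw [h1 (s a) e]
    simp only [mem_imgFam, OrderIso.symm_apply_apply]
  have hq : ∀ e b, (∃ x, e ∈ F' x ∧ b ∈ G x) ↔ e ≤ s b := fun e b => by
    rw [h2 e (s b)]
    simp only [mem_imgFam, OrderIso.symm_apply_apply]
  intro a b
  simp only [hp, hq]
  constructor
  · exact fun hab => ⟨s a, le_rfl, s.monotone hab⟩
  · rintro ⟨e, he, he'⟩
    exact s.le_iff_le.1 (he.trans he')

omit [Fintype E] [Fintype E'] in
theorem eq_of_hits_imgFam {F : X → Set E} {G' : X → Set E'} {s t : E ≃o E'}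
    (h1 : Hits (imgFam s F) G') (h2 : Hits (imgFam t F) G') : s = t := by
  have key : ∀ a e, s a ≤ e ↔ t a ≤ e := fun a e => by
    rw [h1 (s a) e, h2 (t a) e]
    simp only [mem_imgFam, OrderIso.symm_apply_apply]
  ext a
  exact le_antisymm ((key a _).2 le_rfl) ((key a _).1 le_rfl)

omit [Fintype E] [Fintype E'] in
theorem eq_of_imgFam_eq {F : X → Set E} (hF : ∀ e, ∃ x, F x = Iic e) {s t : E ≃o E'}
    (h : imgFam s F = imgFam t F) : s = t := by
  ext a
  obtain ⟨x, hx⟩ := hF a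
  have := congrFun h x
  rw [imgFam, imgFam, hx, OrderIso.image_Iic, OrderIso.image_Iic] at this
  exact Iic_inj' this

noncomputable instance : Fintype (E ≃o E') :=
  @Fintype.ofFinite _ (Finite.of_injective (fun s : E ≃o E' => (s : E → E')) DFunLike.coe_injective)

theorem hitsEntry_relAct_testRel (k : Type*) [Field k] {F G : X → Set E} {F' G' : X → Set E'}
    (hG' : ∀ x, IsUpperSet (G' x)) (hF' : ∀ x, IsLowerSet (F' x))
    (hcard : Fintype.card E = Fintype.card E')
    (hle : (leRel E).ncard ≤ (leRel E').ncard) :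
    hitsEntry k F (relAct (testRel G' F') G) =
      ∑ s : E ≃o E', hitsEntry k (imgFam s F) G' * hitsEntry k F' (imgFam s G) := by
  classical
  by_cases h : Hits F (relAct (testRel G' F') G)
  · obtain ⟨s, h1, h2⟩ := exists_orderIso_of_hits hG' hF' hcard hle h
    rw [Finset.sum_eq_single s]
    · simp [hitsEntry, h, h1, h2]
    · intro t _ hts
      have : ¬ Hits (imgFam t F) G' := fun h' => hts (eq_of_hits_imgFam h' h1)
      simp [hitsEntry, this]
    · simp
  · rw [Finset.sum_eq_zero]
    · simp [hitsEntry, h]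
    · intro s _
      by_cases h1 : Hits (imgFam s F) G'
      · have : ¬ Hits F' (imgFam s G) := fun h2 => h (hits_of_orderIso s h1 h2)
        simp [hitsEntry, this]
      · simp [hitsEntry, h1]

end Pairing

section Transport

open Set

variable {X E E' : Type*} [PartialOrder E] [PartialOrder E']

theorem Link.map (s : E ≃o E') {a b : E} (h : Link a b) : Link (s a) (s b) :=
  ⟨by rw [← s.image_Ioi, ← s.image_Ici, h.1], by rw [← s.image_Iio, ← s.image_Iic, h.2]⟩

theorem MeetTop.map (s : E ≃o E') {a : E} (h : MeetTop a) : MeetTop (s a) := by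
  rw [MeetTop, ← s.image_Ioi, ← s.image_Iic, s.lowerBounds_image, h]

theorem JoinBot.map (s : E ≃o E') {a : E} (h : JoinBot a) : JoinBot (s a) := by
  rw [JoinBot, ← s.image_Iio, ← s.image_Ici, s.upperBounds_image, h]

theorem Good.map (s : E ≃o E') {a : E} (h : Good a) : Good (s a) := by
  obtain ⟨t, ht, hm⟩ := h
  exact ⟨s t, ht.lift s fun _ _ h => h.map s, hm.map s⟩

theorem image_mem_basisValues (s : E ≃o E') {a : Set E} (h : a ∈ basisValues E) :
    s '' a ∈ basisValues E' := by
  rcases h with h | ⟨e, hg, hj, rfl⟩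
  · left
    rw [s.upperBounds_image, s.lowerBounds_image, h]
  · exact Or.inr ⟨s e, hg.map s, hj.map s, s.image_Iio e⟩

theorem imgFam_mem_hitBasis (s : E ≃o E') {F : X → Set E} (h : F ∈ hitBasis X E) :
    imgFam s F ∈ hitBasis X E' := by
  refine ⟨fun x => image_mem_basisValues s (h.1 x), fun e => ?_⟩
  obtain ⟨x, hx⟩ := h.2 (s.symm e)
  exact ⟨x, by rw [imgFam, hx, s.image_Iic, s.apply_symm_apply]⟩

theorem imgFam_symm_imgFam (s : E ≃o E') (G : X → Set E) : imgFam s.symm (imgFam s G) = G := by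
  funext x
  ext b
  simp [mem_imgFam]

theorem isUpperSet_imgFam (s : E ≃o E') {G : X → Set E} (h : ∀ x, IsUpperSet (G x)) (x : X) :
    IsUpperSet (imgFam s G x) := by
  intro a b hab ha
  rw [mem_imgFam] at ha ⊢
  exact h x (s.symm.monotone hab) ha

theorem Hits.imgFam (s : E ≃o E') {F G : X → Set E} (h : Hits F G) :
    Hits (imgFam s F) (imgFam s G) := by
  intro a b
  rw [← s.symm.le_iff_le, h]
  simp only [mem_imgFam]

theorem relAct_imgFam (s : E ≃o E') (m : Set (X × X)) (G : X → Set E) :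
    relAct m (imgFam s G) = imgFam s (relAct m G) := by
  funext x
  ext b
  simp only [mem_imgFam, relAct, Set.mem_ofPred_eq]

theorem hitsVec_imgFam (k : Type*) [Field k] (s : E ≃o E') (F G : X → Set E) :
    hitsVec k (imgFam s F) (imgFam s G) = hitsVec k F G := by
  funext m
  have : Hits (imgFam s F) (imgFam s (relAct m G)) ↔ Hits F (relAct m G) :=
    ⟨fun h => by simpa only [imgFam_symm_imgFam] using h.imgFam s.symm, fun h => h.imgFam s⟩
  rw [hitsVec, hitsVec, relAct_imgFam]
  classical exact if_congr this rfl rfl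

/-- The left action of a relation on families of subsets. -/
def actRel (m : Set (X × X)) (F : X → Set E) (y : X) : Set E := {a | ∃ x, (x, y) ∈ m ∧ a ∈ F x}

theorem hitsVec_apply (k : Type*) [Field k] (F G : X → Set E) (m : Set (X × X)) :
    hitsVec k F G m = hitsEntry k F (relAct m G) := rfl

theorem hitsVec_apply' (k : Type*) [Field k] (F G : X → Set E) (m : Set (X × X)) :
    hitsVec k F G m = hitsEntry k (actRel m F) G := by
  have : Hits F (relAct m G) ↔ Hits (actRel m F) G := by
    refine forall₂_congr fun a b => iff_congr Iff.rfl ?_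
    constructor
    · rintro ⟨x, ha, y, hm, hb⟩
      exact ⟨y, ⟨x, hm, ha⟩, hb⟩
    · rintro ⟨y, ⟨x, hm, ha⟩, hb⟩
      exact ⟨x, ha, y, hm, hb⟩
  rw [hitsVec, hitsEntry]
  classical exact if_congr this rfl rfl

theorem isUpperSet_relAct (m : Set (X × X)) {G : X → Set E} (h : ∀ x, IsUpperSet (G x)) (x : X) :
    IsUpperSet (relAct m G x) := by
  rintro a b hab ⟨y, hm, hy⟩
  exact ⟨y, hm, h y hab hy⟩

theorem isLowerSet_actRel (m : Set (X × X)) {F : X → Set E} (h : ∀ x, IsLowerSet (F x)) (y : X) :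
    IsLowerSet (actRel m F y) := by
  rintro a b hab ⟨x, hm, hx⟩
  exact ⟨x, hm, h x hab hx⟩

end Transport

section ColumnFamily

open Set

variable (k : Type*) [Field k] [CharZero k] (X E : Type*) [Fintype X] [PartialOrder E] [Fintype E]

/-- The families of upper sets indexing a column basis of the hitting matrix. -/
noncomputable def colFam : hitBasis X E → X → Set E := (exists_column_basis k X E).choose

theorem isUpperSet_colFam (H : hitBasis X E) (x : X) : IsUpperSet (colFam k X E H x) :=
  (exists_column_basis k X E).choose_spec.1 H x

theorem linearIndependent_colFam :
    LinearIndependent k fun (H F : hitBasis X E) => hitsEntry k F.1 (colFam k X E H) :=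
  (exists_column_basis k X E).choose_spec.2.1

variable {X E}

theorem hitsVec_mem_span_colFam {F G : X → Set E} (hF : ∀ x, IsLowerSet (F x))
    (hG : ∀ x, IsUpperSet (G x)) :
    hitsVec k F G ∈ Submodule.span k (range fun H => hitsVec k F (colFam k X E H)) := by
  classical
  obtain ⟨d, hd⟩ := (exists_column_basis k X E).choose_spec.2.2 G hG
  refine (Submodule.mem_span_range_iff_exists_fun k).2 ⟨d, ?_⟩
  funext m
  rw [hitsVec_apply', hd _ (isLowerSet_actRel m hF), finsum_eq_sum_of_fintype]
  simp only [Finset.sum_apply, Pi.smul_apply, smul_eq_mul, hitsVec_apply']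
  rfl

theorem hitsVec_mem_span_hitBasis {F G : X → Set E} (hF : ∀ x, IsLowerSet (F x))
    (hG : ∀ x, IsUpperSet (G x)) :
    hitsVec k F G ∈ Submodule.span k (range fun F : hitBasis X E => hitsVec k F.1 G) := by
  classical
  obtain ⟨c, hc⟩ := (Submodule.mem_span_range_iff_exists_fun k).1 (hitsRow_mem_span k hF)
  refine (Submodule.mem_span_range_iff_exists_fun k).2 ⟨c, ?_⟩
  funext m
  have := congrFun hc ⟨_, isUpperSet_relAct m hG⟩
  simp only [Finset.sum_apply, Pi.smul_apply, smul_eq_mul, hitsRow] at this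
  simp only [Finset.sum_apply, Pi.smul_apply, smul_eq_mul, hitsVec_apply]
  exact this

end ColumnFamily

section PosetFamilies

open Set

/-- The set `Pt n` ordered by `r`. -/
def Carrier {n : ℕ} (_ : PartialOrder (Pt n)) : Type := Pt n

instance {n : ℕ} (r : PartialOrder (Pt n)) : PartialOrder (Carrier r) := r

instance {n : ℕ} (r : PartialOrder (Pt n)) : Fintype (Carrier r) :=
  inferInstanceAs (Fintype (Pt n))

theorem card_carrier {n : ℕ} (r : PartialOrder (Pt n)) : Fintype.card (Carrier r) = n := card_pt n

/-- The orders on `Pt n` together with a member of the row basis. -/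
def PosetFam (X : Type*) (n : ℕ) : Type _ :=
  {p : PartialOrder (Pt n) × (X → Set (Pt n)) // p.2 ∈ hitBasis X (Carrier p.1)}

namespace PosetFam

variable {X : Type*} {n : ℕ}

/-- The order of a pair. -/
abbrev order (t : PosetFam X n) : PartialOrder (Pt n) := t.1.1

/-- The family of a pair. -/
abbrev fam (t : PosetFam X n) : X → Set (Carrier t.order) := t.1.2

theorem fam_mem (t : PosetFam X n) : t.fam ∈ hitBasis X (Carrier t.order) := t.2

/-- Isomorphism of orders with a family. -/
instance setoid (X : Type*) (n : ℕ) : Setoid (PosetFam X n) where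
  r t u := ∃ s : Carrier t.order ≃o Carrier u.order, imgFam s t.fam = u.fam
  iseqv :=
    { refl := fun t => ⟨OrderIso.refl _, by funext x; ext b; simp [mem_imgFam]⟩
      symm := fun ⟨s, hs⟩ => ⟨s.symm, by rw [← hs, imgFam_symm_imgFam]⟩
      trans := fun ⟨s, hs⟩ ⟨t, ht⟩ => ⟨s.trans t, by
        rw [← ht, ← hs]; funext x; ext b; simp [mem_imgFam]⟩ }

end PosetFam

/-- The order transported along a permutation. -/
@[reducible] def pushOrder {n : ℕ} (r : PartialOrder (Pt n)) (σ : Equiv.Perm (Pt n)) : PartialOrder (Pt n) :=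
  @PartialOrder.lift (Pt n) (Carrier r) _ σ.symm σ.symm.injective

/-- The permutation as an isomorphism onto the transported order. -/
def pushIso {n : ℕ} (r : PartialOrder (Pt n)) (σ : Equiv.Perm (Pt n)) :
    Carrier r ≃o Carrier (pushOrder r σ) :=
  ⟨σ, fun {a b} => by
    exact iff_of_eq (congrArg₂ r.le (σ.symm_apply_apply a) (σ.symm_apply_apply b))⟩

theorem eq_pushOrder {n : ℕ} {r r' : PartialOrder (Pt n)} (s : Carrier r ≃o Carrier r') :
    pushOrder r s.toEquiv = r' :=
  PartialOrder.ext fun _ _ => s.symm.le_iff_le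

noncomputable instance {A : Type*} [Finite A] : Fintype (PartialOrder A) :=
  @Fintype.ofFinite _ (Finite.of_injective (fun r : PartialOrder A => r.le) fun _ _ h =>
    PartialOrder.ext fun x y => iff_of_eq (congrFun (congrFun h x) y))

namespace PosetFam

variable {X : Type*} {n : ℕ}

noncomputable instance [Finite X] : Fintype (PosetFam X n) :=
  @Fintype.ofFinite _ Subtype.finite

/-- The transport of a pair along a permutation. -/
def push (t : PosetFam X n) (σ : Equiv.Perm (Pt n)) : PosetFam X n :=
  let F : X → Set (Carrier (pushOrder t.order σ)) := imgFam (pushIso t.order σ) t.fam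
  have hF : F ∈ hitBasis X (Carrier (pushOrder t.order σ)) :=
    imgFam_mem_hitBasis (pushIso t.order σ) t.fam_mem
  ⟨(pushOrder t.order σ, F), hF⟩

theorem push_equiv (t : PosetFam X n) (σ : Equiv.Perm (Pt n)) : t ≈ t.push σ :=
  ⟨pushIso t.order σ, rfl⟩

theorem push_injective (t : PosetFam X n) : Function.Injective t.push := by
  intro σ τ h
  have hr : pushOrder t.order σ = pushOrder t.order τ := congrArg (fun u => u.1.1) h
  have hf : (t.push σ).1.2 = (t.push τ).1.2 := congrArg (fun u => u.1.2) h
  let s' : Carrier t.order ≃o Carrier (pushOrder t.order σ) :=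
    ⟨τ, fun {a b} => by
      rw [← (pushIso t.order τ).le_iff_le]
      change (pushOrder t.order σ).le (τ a) (τ b) ↔ (pushOrder t.order τ).le (τ a) (τ b)
      rw [hr]⟩
  have hs : pushIso t.order σ = s' := eq_of_imgFam_eq t.fam_mem.2 hf
  ext a
  exact DFunLike.congr_fun hs a

theorem exists_push_eq {t u : PosetFam X n} (h : t ≈ u) : ∃ σ, t.push σ = u := by
  obtain ⟨s, hs⟩ := h
  exact ⟨s.toEquiv, Subtype.ext (Prod.ext (eq_pushOrder s) hs)⟩

theorem card_class [Fintype X] [DecidableEq (Quotient (setoid X n))] (ω : Quotient (setoid X n)) :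
    (Finset.univ.filter fun t : PosetFam X n => ⟦t⟧ = ω).card = n.factorial := by
  classical
  have : (Finset.univ.filter fun t : PosetFam X n => ⟦t⟧ = ω) =
      Finset.univ.map ⟨ω.out.push, ω.out.push_injective⟩ := by
    ext t
    simp only [Finset.mem_filter, Finset.mem_univ, true_and, Finset.mem_map,
      Function.Embedding.coeFn_mk]
    constructor
    · rintro rfl
      exact exists_push_eq (Quotient.mk_out t)
    · rintro ⟨σ, rfl⟩
      rw [← Quotient.sound (push_equiv ω.out σ), Quotient.out_eq]
  rw [this, Finset.card_map, Finset.card_univ, Fintype.card_perm, card_pt]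

noncomputable instance [Finite X] : Fintype (Quotient (setoid X n)) :=
  @Fintype.ofFinite _ inferInstance

/-- The order of a representative of an isomorphism class. -/
@[reducible] noncomputable def repOrder (ω : Quotient (setoid X n)) : PartialOrder (Pt n) := ω.out.order

theorem card_hitBasis_congr {E E' : Type*} [PartialOrder E] [PartialOrder E'] (s : E ≃o E') :
    Nat.card (hitBasis X E) = Nat.card (hitBasis X E') :=
  Nat.card_congr
    { toFun := fun F => ⟨imgFam s F.1, imgFam_mem_hitBasis s F.2⟩
      invFun := fun F => ⟨imgFam s.symm F.1, imgFam_mem_hitBasis s.symm F.2⟩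
      left_inv := fun F => Subtype.ext (imgFam_symm_imgFam s F.1)
      right_inv := fun F => Subtype.ext (imgFam_symm_imgFam s.symm F.1) }

theorem factorial_mul_sum_card_hitBasis [Fintype X] :
    n.factorial * ∑ ω : Quotient (setoid X n), Nat.card (hitBasis X (Carrier (repOrder ω))) =
      ∑ r : PartialOrder (Pt n), Nat.card (hitBasis X (Carrier r)) ^ 2 := by
  classical
  have h1 : ∑ t : PosetFam X n, Nat.card (hitBasis X (Carrier t.order)) =
      n.factorial * ∑ ω : Quotient (setoid X n), Nat.card (hitBasis X (Carrier (repOrder ω))) := by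
    rw [← Finset.sum_fiberwise Finset.univ fun t : PosetFam X n => (⟦t⟧ : Quotient (setoid X n)),
      Finset.mul_sum]
    refine Finset.sum_congr rfl fun ω _ => ?_
    rw [Finset.sum_congr rfl (g := fun _ => Nat.card (hitBasis X (Carrier (repOrder ω)))),
      Finset.sum_const, card_class, smul_eq_mul]
    intro t ht
    obtain rfl := (Finset.mem_filter.1 ht).2
    obtain ⟨s, -⟩ : (⟦t⟧ : Quotient (setoid X n)).out ≈ t := Quotient.mk_out t
    exact (card_hitBasis_congr s).symm
  rw [← h1]
  let e : PosetFam X n ≃ Σ r : PartialOrder (Pt n), hitBasis X (Carrier r) :=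
    { toFun := fun t => ⟨t.order, t.fam, t.2⟩
      invFun := fun p => ⟨(p.1, p.2.1), p.2.2⟩
      left_inv := fun _ => rfl
      right_inv := fun _ => rfl }
  refine (Fintype.sum_equiv e (fun t : PosetFam X n => Nat.card (hitBasis X (Carrier t.order)))
    (fun p => Nat.card (hitBasis X (Carrier p.1))) fun _ => rfl).trans ?_
  rw [Fintype.sum_sigma]
  refine Finset.sum_congr rfl fun r _ => ?_
  change ∑ _ : hitBasis X (Carrier r), Nat.card (hitBasis X (Carrier r)) = _
  rw [Finset.sum_const, Finset.card_univ, smul_eq_mul, sq, Nat.card_eq_fintype_card]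

end PosetFam

end PosetFamilies

section Basis

open Set PosetFam

variable (k : Type*) [Field k] [CharZero k] (X : Type*) [Fintype X]

/-- The index set of a basis of the space spanned by the functionals. -/
abbrev BasisIndex : Type _ :=
  Σ n : Fin (Fintype.card X + 1), Σ ω : Quotient (setoid X n), hitBasis X (Carrier (repOrder ω))

variable {X}

/-- The family of lower sets of a basis vector. -/
noncomputable def BasisIndex.fam (i : BasisIndex X) : X → Set (Carrier (repOrder i.2.1)) :=
  i.2.1.out.fam

theorem BasisIndex.fam_mem (i : BasisIndex X) : i.fam ∈ hitBasis X (Carrier (repOrder i.2.1)) :=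
  i.2.1.out.fam_mem

/-- The basis vectors. -/
noncomputable def basisVec (i : BasisIndex X) : Set (X × X) → k :=
  hitsVec k i.fam (colFam k X (Carrier (repOrder i.2.1)) i.2.2)

theorem le_card_of_mem_hitBasis {E : Type*} [PartialOrder E] [Fintype E] {F : X → Set E}
    (hF : F ∈ hitBasis X E) : Fintype.card E ≤ Fintype.card X := by
  choose g hg using hF.2
  exact Fintype.card_le_of_injective g fun a b hab => Iic_inj' (by rw [← hg, ← hg, hab])

theorem span_basisVec : Submodule.span k (range (basisVec k (X := X))) = hitsSpan k X := by
  apply le_antisymm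
  · rw [Submodule.span_le]
    rintro _ ⟨i, rfl⟩
    exact Submodule.subset_span ⟨_, repOrder i.2.1, i.fam, _,
      fun x => isLowerSet_of_mem_basisValues (E := Carrier (repOrder i.2.1)) (i.fam_mem.1 x),
      isUpperSet_colFam k X (Carrier (repOrder i.2.1)) i.2.2, rfl⟩
  · rw [hitsSpan, Submodule.span_le]
    rintro _ ⟨n, r, F, G, hF, hG, rfl⟩
    refine Submodule.span_le.2 ?_ (hitsVec_mem_span_hitBasis k (E := Carrier r) hF hG)
    rintro _ ⟨F', rfl⟩
    have hn : n < Fintype.card X + 1 := by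
      have := le_card_of_mem_hitBasis F'.2
      rw [card_carrier] at this
      omega
    let t : PosetFam X n := ⟨(r, F'.1), F'.2⟩
    obtain ⟨s, hs⟩ : (⟦t⟧ : Quotient (setoid X n)).out ≈ t := Quotient.mk_out t
    let ω : Quotient (setoid X n) := ⟦t⟧
    have h1 : hitsVec k (E := Carrier r) F'.1 G =
        hitsVec k (E := Carrier (repOrder ω)) ω.out.fam (imgFam s.symm G) := by
      rw [← hitsVec_imgFam k s]
      have h2 : imgFam s (imgFam s.symm G) = G := imgFam_symm_imgFam s.symm G
      rw [h2]
      exact congrArg (fun F => hitsVec k (E := Carrier r) F G) hs.symm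
    have h2 := hitsVec_mem_span_colFam k (E := Carrier (repOrder ω)) (F := ω.out.fam)
      (G := imgFam s.symm G) (fun x => isLowerSet_of_mem_basisValues (ω.out.fam_mem.1 x))
      (isUpperSet_imgFam s.symm hG)
    change hitsVec k (E := Carrier r) F'.1 G ∈ _
    rw [h1]
    refine Submodule.span_mono ?_ h2
    rintro _ ⟨H, rfl⟩
    exact ⟨⟨⟨n, hn⟩, ω, H⟩, rfl⟩

theorem linearIndependent_basisVec : LinearIndependent k (basisVec k (X := X)) := by
  classical
  rw [Fintype.linearIndependent_iff]
  intro c hc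
  by_contra! hne
  obtain ⟨i₀, hi₀, hmin⟩ := Finset.exists_min_image
    (Finset.univ.filter fun i : BasisIndex X => c i ≠ 0)
    (fun i => toLex ((i.1 : ℕ), Fintype.card X ^ 2 - (leRel (Carrier (repOrder i.2.1))).ncard))
    (by
      obtain ⟨i, hi⟩ := hne
      exact ⟨i, by simpa using hi⟩)
  obtain ⟨n', ω', H₀⟩ := i₀
  have hbound : ∀ (n : Fin (Fintype.card X + 1)) (r : PartialOrder (Pt n)),
      (leRel (Carrier r)).ncard ≤ Fintype.card X ^ 2 := by
    intro n r
    have h1 : (leRel (Carrier r)).ncard ≤ (univ : Set (Carrier r × Carrier r)).ncard :=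
      ncard_le_ncard (subset_univ _) (toFinite _)
    rw [ncard_univ, Nat.card_eq_fintype_card, Fintype.card_prod, card_carrier, ← sq] at h1
    exact h1.trans (Nat.pow_le_pow_left (by omega) 2)
  -- every basis vector in the support is a sum over isomorphisms onto the minimal poset
  have hterm : ∀ (i : BasisIndex X) (F' G' : X → Set (Carrier (repOrder ω'))),
      (∀ x, IsLowerSet (F' x)) → (∀ x, IsUpperSet (G' x)) →
      c i * basisVec k i (testRel G' F') =
        ∑ s : Carrier (repOrder i.2.1) ≃o Carrier (repOrder ω'),
          c i * hitsEntry k F' (imgFam s (colFam k X _ i.2.2)) *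
            hitsEntry k (imgFam s i.fam) G' := by
    intro i F' G' hF' hG'
    by_cases hci : c i = 0
    · simp [hci]
    have hle := hmin i (by simpa using hci)
    rw [Prod.Lex.toLex_le_toLex] at hle
    by_cases hcond : (i.1 : ℕ) = n' ∧
        (leRel (Carrier (repOrder i.2.1))).ncard ≤ (leRel (Carrier (repOrder ω'))).ncard
    · rw [basisVec, hitsVec_apply, hitsEntry_relAct_testRel k hG' hF' _ hcond.2, Finset.mul_sum]
      · exact Finset.sum_congr rfl fun s _ => by ring
      · rw [card_carrier, card_carrier, hcond.1]
    · have hlt : (n' : ℕ) < i.1 := by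
        rcases hle with h | ⟨h, h'⟩
        · exact h
        · have h1 := hbound _ (repOrder i.2.1)
          have h2 := hbound _ (repOrder ω')
          simp only at h h'
          omega
      have h1 : ¬ Hits i.fam (relAct (testRel G' F') (colFam k X _ i.2.2)) := by
        intro h
        have := card_le_of_hits hG' h
        rw [card_carrier, card_carrier] at this
        omega
      have h2 : IsEmpty (Carrier (repOrder i.2.1) ≃o Carrier (repOrder ω')) :=
        ⟨fun s => by
          have := Fintype.card_congr s.toEquiv
          rw [card_carrier, card_carrier] at this
          omega⟩
      rw [basisVec, hitsVec, if_neg h1, mul_zero, Finset.univ_eq_empty, Finset.sum_empty]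
  -- extract the coefficient of one row
  have hcol : ∀ F' : X → Set (Carrier (repOrder ω')), (∀ x, IsLowerSet (F' x)) →
      ∑ H, c ⟨n', ω', H⟩ * hitsEntry k F' (colFam k X _ H) = 0 := by
    intro F' hF'
    have hli := Fintype.linearIndependent_iff.1
      (linearIndependent_hitsRow k X (Carrier (repOrder ω')))
      (fun F'' => ∑ i : BasisIndex X, ∑ s : Carrier (repOrder i.2.1) ≃o Carrier (repOrder ω'),
        if imgFam s i.fam = F''.1 then c i * hitsEntry k F' (imgFam s (colFam k X _ i.2.2)) else 0)
      (by
        funext G'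
        simp only [Finset.sum_apply, Pi.smul_apply, smul_eq_mul, Pi.zero_apply, Finset.sum_mul]
        have hzero := congrFun hc (testRel G'.1 F')
        simp only [Finset.sum_apply, Pi.smul_apply, smul_eq_mul, Pi.zero_apply] at hzero
        refine Eq.trans ?_ hzero
        rw [Finset.sum_comm]
        refine Finset.sum_congr rfl fun i _ => ?_
        rw [hterm i F' G'.1 hF' G'.2, Finset.sum_comm]
        refine Finset.sum_congr rfl fun s _ => ?_
        rw [Finset.sum_eq_single ⟨imgFam s i.fam, imgFam_mem_hitBasis s i.fam_mem⟩]
        · rw [if_pos rfl]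
          rfl
        · intro F'' _ hF''
          rw [if_neg, zero_mul]
          exact fun h => hF'' (Subtype.ext h.symm)
        · simp)
      ⟨_, BasisIndex.fam_mem ⟨n', ω', H₀⟩⟩
    rw [Fintype.sum_sigma, Finset.sum_eq_single n', Fintype.sum_sigma,
      Finset.sum_eq_single ω'] at hli
    · rw [← hli]
      refine Finset.sum_congr rfl fun H _ => ?_
      rw [Finset.sum_eq_single (OrderIso.refl _)]
      · rw [if_pos]
        · rw [imgFam_refl]
        · exact imgFam_refl _
      · intro s _ hs
        rw [if_neg]
        intro h
        refine hs (eq_of_imgFam_eq (F := BasisIndex.fam ⟨n', ω', H⟩)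
          (BasisIndex.fam_mem ⟨n', ω', H⟩).2 ?_)
        exact h.trans (imgFam_refl _).symm
      · simp
    · intro ω _ hω
      refine Finset.sum_eq_zero fun H _ => Finset.sum_eq_zero fun s _ => if_neg fun h => hω ?_
      rw [← Quotient.out_eq ω, ← Quotient.out_eq ω']
      exact Quotient.sound ⟨s, h⟩
    · simp
    · intro n _ hn
      refine Finset.sum_eq_zero fun p _ => Finset.sum_eq_zero fun s _ => absurd ?_ hn
      have := Fintype.card_congr s.toEquiv
      rw [card_carrier, card_carrier] at this
      exact Fin.ext this
    · simp
  have hfin := Fintype.linearIndependent_iff.1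
    (linearIndependent_colFam k X (Carrier (repOrder ω'))) (fun H => c ⟨n', ω', H⟩) (by
      funext F
      simp only [Finset.sum_apply, Pi.smul_apply, smul_eq_mul, Pi.zero_apply]
      exact hcol F.1 fun x => isLowerSet_of_mem_basisValues (F.2.1 x)) H₀
  exact (Finset.mem_filter.1 hi₀).2 hfin

theorem finrank_hitsSpan : Module.finrank k (hitsSpan k X) =
    ∑ n ∈ Finset.range (Fintype.card X + 1),
      (∑ r : PartialOrder (Pt n), Nat.card (hitBasis X (Carrier r)) ^ 2) / n.factorial := by
  classical
  rw [← span_basisVec, finrank_span_eq_card (linearIndependent_basisVec k), Fintype.card_sigma,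
    ← Fin.sum_univ_eq_sum_range]
  refine Finset.sum_congr rfl fun n _ => ?_
  rw [← factorial_mul_sum_card_hitBasis, Nat.mul_div_cancel_left _ n.1.factorial_pos,
    Fintype.card_sigma]
  refine Finset.sum_congr rfl fun ω _ => ?_
  rw [Nat.card_eq_fintype_card]

end Basis

section Covering

/-- The number of functions from a set of size `m` to a set of size `g` that take `n` prescribed
values. -/
def coverCount : ℕ → ℕ → ℕ → ℕ
  | 0, _, n => if n = 0 then 1 else 0
  | m + 1, g, n => n * coverCount m g (n - 1) + (g - n) * coverCount m g n

theorem card_covering {α : Type*} [DecidableEq α] (A : Finset α) (m : ℕ) {B : Finset α}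
    (hB : B ⊆ A) :
    Nat.card {F : Fin m → A // ∀ b ∈ B, ∃ x, (F x : α) = b} = coverCount m A.card B.card := by
  induction m generalizing B with
  | zero =>
    rw [coverCount]
    split_ifs with h
    · rw [Finset.card_eq_zero] at h
      subst h
      simp
    · have : IsEmpty {F : Fin 0 → A // ∀ b ∈ B, ∃ x, (F x : α) = b} := ⟨fun F => by
        obtain ⟨b, hb⟩ := Finset.card_pos.1 (Nat.pos_of_ne_zero h)
        obtain ⟨x, -⟩ := F.2 b hb
        exact x.elim0⟩
      exact Nat.card_of_isEmpty
  | succ m ih =>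
    let e : {F : Fin (m + 1) → A // ∀ b ∈ B, ∃ x, (F x : α) = b} ≃
        Σ a : A, {F : Fin m → A // ∀ b ∈ B.erase a, ∃ x, (F x : α) = b} :=
      { toFun := fun F => ⟨F.1 0, Fin.tail F.1, fun b hb => by
          obtain ⟨hne, hb⟩ := Finset.mem_erase.1 hb
          obtain ⟨x, hx⟩ := F.2 b hb
          cases x using Fin.cases with
          | zero => exact absurd hx.symm hne
          | succ y => exact ⟨y, hx⟩⟩
        invFun := fun p => ⟨Fin.cons p.1 p.2.1, fun b hb => by
          by_cases h : b = p.1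
          · exact ⟨0, h.symm⟩
          · obtain ⟨y, hy⟩ := p.2.2 b (Finset.mem_erase.2 ⟨h, hb⟩)
            exact ⟨y.succ, hy⟩⟩
        left_inv := fun F => Subtype.ext (Fin.cons_self_tail F.1)
        right_inv := fun p => by rfl }
    rw [Nat.card_congr e, Nat.card_sigma]
    have h1 : ∀ a : A, Nat.card {F : Fin m → A // ∀ b ∈ B.erase a, ∃ x, (F x : α) = b} =
        if (a : α) ∈ B then coverCount m A.card (B.card - 1) else coverCount m A.card B.card := by
      intro a
      rw [ih ((Finset.erase_subset _ _).trans hB)]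
      split_ifs with h
      · rw [Finset.card_erase_of_mem h]
      · rw [Finset.erase_eq_of_notMem h]
    rw [Finset.sum_congr rfl fun a _ => h1 a,
      Finset.sum_coe_sort A fun a => if a ∈ B then coverCount m A.card (B.card - 1) else
        coverCount m A.card B.card, Finset.sum_ite, Finset.sum_const, Finset.sum_const,
      Finset.filter_mem_eq_inter, Finset.inter_eq_right.2 hB, ← Finset.sdiff_eq_filter,
      Finset.card_sdiff_of_subset hB, coverCount, smul_eq_mul, smul_eq_mul]

theorem card_hitBasis (X E : Type*) [Fintype X] [PartialOrder E] [Fintype E] :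
    Nat.card (hitBasis X E) =
      coverCount (Fintype.card X) (Nat.card (basisValues E)) (Fintype.card E) := by
  classical
  let A : Finset (Set E) := (basisValues E).toFinset
  let B : Finset (Set E) := Finset.univ.image Set.Iic
  have hB : B ⊆ A := fun b hb => by
    obtain ⟨e, -, rfl⟩ := Finset.mem_image.1 hb
    exact Set.mem_toFinset.2 (Iic_mem_basisValues e)
  have hA : A.card = Nat.card (basisValues E) := by
    rw [Set.toFinset_card, Nat.card_eq_fintype_card]
  have hBc : B.card = Fintype.card E := Finset.card_image_of_injective _ fun _ _ => Iic_inj'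
  rw [← hA, ← hBc, ← card_covering A _ hB]
  let s := Fintype.equivFin X
  refine Nat.card_congr
    { toFun := fun F => ⟨fun i => ⟨F.1 (s.symm i), Set.mem_toFinset.2 (F.2.1 _)⟩, fun b hb => ?_⟩
      invFun := fun F => ⟨fun x => F.1 (s x), fun x => Set.mem_toFinset.1 (F.1 (s x)).2, fun e => ?_⟩
      left_inv := fun F => by ext; simp
      right_inv := fun F => by ext; simp }
  · obtain ⟨e, -, rfl⟩ := Finset.mem_image.1 hb
    obtain ⟨x, hx⟩ := F.2.2 e
    exact ⟨s x, by simp [hx]⟩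
  · obtain ⟨i, hi⟩ := F.2 _ (Finset.mem_image_of_mem _ (Finset.mem_univ e))
    exact ⟨s.symm i, by simp [hi]⟩

theorem coverCount_seven_seven (g : ℕ) : coverCount 7 g 7 = 5040 := by
  simp [coverCount]

end Covering

section Extension

open Set

variable {E E' : Type} [PartialOrder E] [PartialOrder E']

/-- The extension of a poset by a maximal element whose strict lower set is `D`. -/
def TopExt (_ : LowerSet E) : Type := Option E

/-- The order relation of an extension. -/
def extLE (D : LowerSet E) : Option E → Option E → Prop
  | some a, some b => a ≤ b
  | some a, none => a ∈ D
  | none, some _ => False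
  | none, none => True

instance topExtPartialOrder (D : LowerSet E) : PartialOrder (TopExt D) where
  le := extLE D
  le_refl a := by
    cases a with
    | none => trivial
    | some a => exact le_refl a
  le_trans a b c hab hbc := by
    match a, b, c, hab, hbc with
    | none, none, none, _, _ => trivial
    | some _, none, none, hab, _ => exact hab
    | some _, some _, none, hab, hbc => exact D.lower hab hbc
    | some _, some _, some _, hab, hbc => exact le_trans hab hbc
  le_antisymm a b hab hba := by
    match a, b, hab, hba with
    | none, none, _, _ => rfl
    | some _, some _, hab, hba => exact congrArg some (le_antisymm hab hba)

instance [Finite E] (D : LowerSet E) : Finite (TopExt D) := inferInstanceAs (Finite (Option E))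

/-- The number of maximal elements. -/
noncomputable def maxCount (E : Type) (_ : PartialOrder E) : ℕ := Nat.card {x : E // IsMax x}

/-- Rational functions of posets. -/
abbrev OrderFun : Type 1 := ∀ E : Type, PartialOrder E → ℚ

/-- Functions of posets that only depend on the isomorphism class. -/
def OrderFun.Invariant (h : OrderFun) : Prop :=
  ∀ (E E' : Type) [PartialOrder E] [PartialOrder E'], (E ≃o E') → h E ‹_› = h E' ‹_›

/-- The value of a function of posets divided by the number of maximal elements. -/
noncomputable def OrderFun.divMax (h : OrderFun) : OrderFun := fun E r => h E r / maxCount E r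

/-- The weighted sum of a function of posets over all one-element extensions. -/
noncomputable def OrderFun.step (h : OrderFun) : OrderFun := fun E _ =>
  ∑ᶠ D : LowerSet E, h.divMax (TopExt D) inferInstance

theorem maxCount_congr (s : E ≃o E') : maxCount E ‹_› = maxCount E' ‹_› :=
  Nat.card_congr (s.toEquiv.subtypeEquiv fun _ => s.isMax_apply.symm)

theorem OrderFun.Invariant.divMax {h : OrderFun} (hh : h.Invariant) : h.divMax.Invariant :=
  fun E E' _ _ s => by rw [OrderFun.divMax, OrderFun.divMax, hh E E' s, maxCount_congr s]

/-- An isomorphism of posets induces isomorphisms of extensions. -/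
def extIso (s : E ≃o E') (D : LowerSet E) : TopExt D ≃o TopExt (LowerSet.map s D) :=
  ⟨s.toEquiv.optionCongr, fun {a b} => by
    change extLE (LowerSet.map s D) (s.toEquiv.optionCongr a) (s.toEquiv.optionCongr b) ↔
      extLE D a b
    cases a <;> cases b <;> simp [extLE, LowerSet.mem_map]⟩

theorem OrderFun.Invariant.step {h : OrderFun} (hh : h.Invariant) : h.step.Invariant :=
  fun E E' _ _ s => by
    rw [OrderFun.step, OrderFun.step, ← finsum_comp_equiv (LowerSet.map s).toEquiv]
    exact finsum_congr fun D => hh.divMax _ _ (extIso s D)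

end Extension

section OrderSum

variable {A B : Type}

/-- Transport of orders along a bijection. -/
def orderCongr (σ : A ≃ B) : PartialOrder A ≃ PartialOrder B where
  toFun r := @PartialOrder.lift B A r σ.symm σ.symm.injective
  invFun r := @PartialOrder.lift A B r σ σ.injective
  left_inv r := PartialOrder.ext fun x y =>
    iff_of_eq (congrArg₂ r.le (σ.symm_apply_apply x) (σ.symm_apply_apply y))
  right_inv r := PartialOrder.ext fun x y =>
    iff_of_eq (congrArg₂ r.le (σ.apply_symm_apply x) (σ.apply_symm_apply y))

/-- A bijection is an isomorphism onto the transported order. -/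
def orderCongrIso (σ : A ≃ B) (r : PartialOrder A) :
    @OrderIso A B r.toLE (orderCongr σ r).toLE :=
  @RelIso.mk A B r.le (orderCongr σ r).le σ fun {a b} =>
    iff_of_eq (congrArg₂ r.le (σ.symm_apply_apply a) (σ.symm_apply_apply b))

theorem OrderFun.Invariant.orderCongr {h : OrderFun} (hh : h.Invariant) (σ : A ≃ B)
    (r : PartialOrder A) : h B (orderCongr σ r) = h A r :=
  (@hh A B r (_root_.orderCongr σ r) (orderCongrIso σ r)).symm

theorem sum_order_congr [Finite A] [Finite B] {h : OrderFun} (hh : h.Invariant) (σ : A ≃ B) :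
    ∑ r : PartialOrder A, h A r = ∑ r : PartialOrder B, h B r :=
  Fintype.sum_equiv (orderCongr σ) _ _ fun r => (hh.orderCongr σ r).symm

/-- The order on `Option A` given by an order on `A` and a lower set. -/
abbrev extOrder (p : Σ r : PartialOrder A, @LowerSet A r.toLE) : PartialOrder (Option A) :=
  @topExtPartialOrder A p.1 p.2

theorem extOrder_injective : Function.Injective (extOrder (A := A)) := by
  rintro ⟨r, D⟩ ⟨r', D'⟩ h
  have hle : ∀ a b, (extOrder ⟨r, D⟩).le a b ↔ (extOrder ⟨r', D'⟩).le a b := fun a b => by rw [h]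
  obtain rfl : r = r' := PartialOrder.ext fun a b => hle (some a) (some b)
  obtain rfl : D = D' := @SetLike.ext _ _ _ D D' fun a => hle (some a) none
  rfl

theorem isMax_none_extOrder (p : Σ r : PartialOrder A, @LowerSet A r.toLE) :
    @IsMax (Option A) (extOrder p).toLE none := by
  intro b hb
  cases b with
  | none => exact hb
  | some b => exact hb.elim

theorem exists_extOrder_eq {r : PartialOrder (Option A)} (h : @IsMax (Option A) r.toLE none) :
    ∃ p, extOrder p = r := by
  let r₀ : PartialOrder A := @PartialOrder.lift A (Option A) r some (Option.some_injective A)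
  let D : @LowerSet A r₀.toLE :=
    @LowerSet.mk A r₀.toLE {a | r.le (some a) none} fun a b hba ha => r.le_trans _ _ _ hba ha
  refine ⟨⟨r₀, D⟩, PartialOrder.ext fun a b => ?_⟩
  cases a <;> cases b
  · exact ⟨fun _ => r.le_refl _, fun _ => trivial⟩
  · refine ⟨fun h' => h'.elim, fun h' => ?_⟩
    have := r.le_antisymm _ _ h' (h h')
    simp at this
  · exact Iff.rfl
  · exact Iff.rfl

theorem card_mul_divMax [Fintype A] [Nonempty A] (h : OrderFun) (r : PartialOrder A)
    [DecidablePred (@IsMax A r.toLE)] :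
    (∑ x : A, if @IsMax A r.toLE x then h.divMax A r else 0) = h A r := by
  have h0 : maxCount A r ≠ 0 := by
    obtain ⟨x, hx⟩ := Finite.exists_le_maximal (p := fun _ : A => True) (a := Classical.arbitrary A)
      trivial
    have : Nonempty {x : A // IsMax x} := ⟨x, maximal_true.1 hx.2⟩
    exact Nat.card_pos.ne'
  rw [← Finset.sum_filter, Finset.sum_const, nsmul_eq_mul, OrderFun.divMax, maxCount,
    Nat.card_eq_fintype_card, Fintype.card_subtype]
  rw [maxCount, Nat.card_eq_fintype_card, Fintype.card_subtype] at h0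
  field_simp

theorem sum_order_option [Fintype A] {h : OrderFun} (hh : h.Invariant) :
    ∑ r : PartialOrder (Option A), h (Option A) r =
      (Fintype.card A + 1) * ∑ r : PartialOrder A, h.step A r := by
  classical
  have h1 : ∀ x : Option A,
      (∑ r : PartialOrder (Option A), if @IsMax _ r.toLE x then h.divMax _ r else 0) =
        ∑ r : PartialOrder A, h.step A r := by
    intro x
    let σ : Equiv.Perm (Option A) := Equiv.swap x none
    have h2 : (∑ r : PartialOrder (Option A), if @IsMax _ r.toLE x then h.divMax _ r else 0) =
        ∑ r : PartialOrder (Option A), if @IsMax _ r.toLE none then h.divMax _ r else 0 := by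
      refine Fintype.sum_equiv (orderCongr σ) _ _ fun r => ?_
      have h3 := @OrderIso.isMax_apply _ _ r.toPreorder (orderCongr σ r).toPreorder
        (orderCongrIso σ r) x
      have h4 : orderCongrIso σ r x = none := Equiv.swap_apply_left x none
      rw [h4] at h3
      rw [hh.divMax.orderCongr]
      simp only [h3]
    have hfin : ∀ r : PartialOrder A, Finite (@LowerSet A r.toLE) := fun r =>
      Finite.of_injective (fun D : @LowerSet A r.toLE => D.carrier) fun D D' h' =>
        @SetLike.coe_injective _ _ _ D D' h'
    have hft : ∀ r : PartialOrder A, Fintype (@LowerSet A r.toLE) := fun r => Fintype.ofFinite _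
    rw [h2, ← Finset.sum_filter]
    simp only [OrderFun.step, finsum_eq_sum_of_fintype]
    rw [← Fintype.sum_sigma']
    symm
    refine Finset.sum_bij (fun p _ => extOrder p) ?_ (fun _ _ _ _ h' => extOrder_injective h') ?_ ?_
    · exact fun p _ => Finset.mem_filter.2 ⟨Finset.mem_univ _, isMax_none_extOrder p⟩
    · intro r hr
      obtain ⟨p, hp⟩ := exists_extOrder_eq (Finset.mem_filter.1 hr).2
      exact ⟨p, Finset.mem_univ _, hp⟩
    · exact fun p _ => rfl
  rw [Finset.sum_congr rfl fun r _ => (card_mul_divMax h r).symm, Finset.sum_comm,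
    Finset.sum_congr rfl fun x _ => h1 x, Finset.sum_const, nsmul_eq_mul, Finset.card_univ,
    Fintype.card_option, Nat.cast_add, Nat.cast_one]

theorem sum_order_pt {h : OrderFun} (hh : h.Invariant) (n : ℕ) (r₀ : PartialOrder (Pt 0)) :
    ∑ r : PartialOrder (Pt n), h (Pt n) r = n.factorial * (OrderFun.step^[n] h) (Pt 0) r₀ := by
  induction n generalizing h with
  | zero =>
    have : Subsingleton (PartialOrder (Pt 0)) :=
      ⟨fun r r' => PartialOrder.ext fun x _ => x.elim0⟩
    rw [Fintype.sum_subsingleton _ r₀]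
    simp
  | succ n ih =>
    rw [sum_order_congr (A := Pt (n + 1)) (B := Option (Pt n)) hh (finSuccEquiv n), sum_order_option hh,
      ih hh.step, Function.iterate_succ_apply, card_pt, Nat.factorial_succ]
    push_cast
    ring

end OrderSum

section PosetCodes

/-- Elimination of a Boolean through its recursor. -/
noncomputable abbrev select {α : Type} (b : Bool) (x y : α) : α := Bool.rec y x b

/-- The fold of a list through its recursor. -/
noncomputable abbrev listFold {α β : Type} (f : α → β → β) (b : β) (l : List α) : β :=
  List.rec b (fun a _ r => f a r) l

/-- Application of a function after evaluation of its argument. -/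
noncomputable abbrev evalThen (k : ℕ → ℕ) (n : ℕ) : ℕ := Nat.rec (k 0) (fun m _ => k (Nat.succ m)) n

/-- A poset encoded by natural numbers whose binary digits stand for subsets: `bit` is the first
unused power of two, `pts` lists the masks of `{e}`, `Iic e` and `Ici e`, `lows` the masks of the
lower sets, and `maxs` is the mask of the set of maximal elements. -/
structure PosetCode where
  /-- The first unused power of two. -/
  bit : ℕ
  /-- The masks of `{e}`, `Iic e` and `Ici e` for every element `e`. -/
  pts : List (ℕ × ℕ × ℕ)
  /-- The masks of the lower sets. -/
  lows : List ℕ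
  /-- The mask of the set of maximal elements. -/
  maxs : ℕ

namespace PosetCode

/-- The code of the empty poset. -/
def empty : PosetCode := ⟨1, [], [0], 0⟩

/-- The code of the extension by a maximal element whose strict lower set has mask `d`. -/
noncomputable def ext (c : PosetCode) (d : ℕ) : PosetCode where
  bit := Nat.add c.bit c.bit
  pts := (c.bit, Nat.lor d c.bit, c.bit) :: listFold (fun p r =>
    select (Nat.beq (Nat.land d p.1) 0) p (p.1, p.2.1, Nat.lor p.2.2 c.bit) :: r) [] c.pts
  lows := listFold List.cons (listFold (fun a r =>
    select (Nat.beq (Nat.land d a) d) (Nat.lor a c.bit :: r) r) [] c.lows) c.lows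
  maxs := Nat.lor (Nat.xor c.maxs (Nat.land c.maxs d)) c.bit

/-- The number of elements of a subset of a poset with at most seven elements. -/
noncomputable def size (m : ℕ) : ℕ :=
  listFold (fun i r => select (Nat.testBit m i) (Nat.succ r) r) 0 [0, 1, 2, 3, 4, 5, 6]

/-- The mask of the lower bounds of the upper bounds. -/
noncomputable def closure (c : PosetCode) (d : ℕ) : ℕ :=
  listFold (fun p r => select (Nat.beq (Nat.land d p.2.1) d) (Nat.land p.2.1 r) r)
    (Nat.sub c.bit 1) c.pts

/-- Whether an element is the meet of the elements strictly above it. -/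
noncomputable def meetTop (c : PosetCode) (t : ℕ × ℕ × ℕ) : Bool :=
  Nat.beq (listFold (fun p r => select (Nat.beq (Nat.land t.2.2 p.1) 0) r
    (select (Nat.beq t.1 p.1) r (Nat.land p.2.1 r))) (Nat.sub c.bit 1) c.pts) t.2.1

/-- Whether two elements are linked. -/
noncomputable def link (p q : ℕ × ℕ × ℕ) : Bool :=
  select (Nat.beq q.2.1 (Nat.lor p.2.1 q.1)) (Nat.beq p.2.2 (Nat.lor q.2.2 p.1)) false

/-- Whether the chain of links that starts at an element ends within a given number of steps at an
element that is a meet. -/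
noncomputable def good (c : PosetCode) (k : ℕ) : ℕ × ℕ × ℕ → Bool :=
  Nat.rec (fun _ => false) (fun _ f p => select (c.meetTop p) true
    (listFold (fun q r => select (link p q) (select (f q) true r) r) false c.pts)) k

/-- The number of values of the row basis. -/
noncomputable def values (c : PosetCode) : ℕ :=
  listFold (fun d r => select (Nat.beq (c.closure d) d) (Nat.succ r) r)
    (listFold (fun p r => select (select (Nat.beq (c.closure (Nat.xor p.2.1 p.1)) p.2.1)
      (c.good 7 p) false) (Nat.succ r) r) 0 c.pts) c.lows

/-- The weighted sum of a function over the iterated extensions. -/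
noncomputable def weightedSum (leaf : PosetCode → ℕ) (m : ℕ) : PosetCode → ℕ :=
  Nat.rec leaf (fun _ f c => listFold (fun d r =>
    Nat.add (Nat.mul (evalThen (fun a => Nat.div 420 (size a)) (c.ext d).maxs) (f (c.ext d))) r)
    0 c.lows) m

/-- The square of the number of elements of the row basis. -/
noncomputable def leaf (n : ℕ) (c : PosetCode) : ℕ :=
  evalThen (fun g => coverCount 7 g n ^ 2) c.values

end PosetCode

end PosetCodes

section SetCodes

open Set

variable {E : Type} {n : ℕ}

open Classical in
/-- The number whose binary digits describe a subset. -/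
noncomputable def setCode (l : E ≃ Fin n) (a : Set E) : ℕ :=
  Nat.ofBits fun i => decide (l.symm i ∈ a)

variable (l : E ≃ Fin n)

theorem testBit_setCode (a : Set E) (e : E) : (setCode l a).testBit (l e) = true ↔ e ∈ a := by
  simp [setCode]

theorem setCode_lt (a : Set E) : setCode l a < 2 ^ n := Nat.ofBits_lt_two_pow _

theorem eq_setCode {a : Set E} {m : ℕ} (hm : m < 2 ^ n)
    (h : ∀ e, m.testBit (l e) = true ↔ e ∈ a) : m = setCode l a := by
  refine Nat.eq_of_testBit_eq fun i => ?_
  by_cases hi : i < n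
  · obtain ⟨e, he⟩ := l.surjective ⟨i, hi⟩
    have he' : (l e : ℕ) = i := by rw [he]
    rw [← he', Bool.eq_iff_iff, h, testBit_setCode]
  · have hle : 2 ^ n ≤ 2 ^ i := Nat.pow_le_pow_right (by norm_num) (not_lt.1 hi)
    rw [Nat.testBit_lt_two_pow (hm.trans_le hle),
      Nat.testBit_lt_two_pow ((setCode_lt l a).trans_le hle)]

theorem setCode_injective : Function.Injective (setCode l) := fun a b h => by
  ext e
  rw [← testBit_setCode l, h, testBit_setCode]

theorem land_setCode (a b : Set E) : Nat.land (setCode l a) (setCode l b) = setCode l (a ∩ b) := by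
  refine eq_setCode l ((Nat.and_le_left).trans_lt (setCode_lt l a)) fun e => ?_
  change (setCode l a &&& setCode l b).testBit _ = true ↔ _
  rw [Nat.testBit_and, Bool.and_eq_true, testBit_setCode, testBit_setCode, mem_inter_iff]

theorem lor_setCode (a b : Set E) : Nat.lor (setCode l a) (setCode l b) = setCode l (a ∪ b) := by
  refine eq_setCode l (Nat.or_lt_two_pow (setCode_lt l a) (setCode_lt l b)) fun e => ?_
  change (setCode l a ||| setCode l b).testBit _ = true ↔ _
  rw [Nat.testBit_or, Bool.or_eq_true, testBit_setCode, testBit_setCode, mem_union]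

theorem xor_setCode {a b : Set E} (hab : b ⊆ a) :
    Nat.xor (setCode l a) (setCode l b) = setCode l (a \ b) := by
  refine eq_setCode l (Nat.xor_lt_two_pow (setCode_lt l a) (setCode_lt l b)) fun e => ?_
  change (setCode l a ^^^ setCode l b).testBit _ = true ↔ _
  have h1 := testBit_setCode l a e
  have h2 := testBit_setCode l b e
  have h3 := @hab e
  rw [Nat.testBit_xor, mem_sdiff, ← h1, ← h2]
  rw [← h1, ← h2] at h3
  revert h3
  cases (setCode l a).testBit (l e) <;> cases (setCode l b).testBit (l e) <;> simp

theorem setCode_empty : setCode l ∅ = 0 :=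
  (eq_setCode l (Nat.two_pow_pos n) fun e => by simp).symm

theorem setCode_univ : setCode l univ = 2 ^ n - 1 :=
  (eq_setCode l (Nat.sub_lt (Nat.two_pow_pos n) one_pos) fun e => by simp).symm

theorem beq_setCode {a b : Set E} : Nat.beq (setCode l a) (setCode l b) = true ↔ a = b :=
  ⟨fun h => setCode_injective l (Nat.eq_of_beq_eq_true h), fun h => by
    rw [h]; exact Nat.beq_refl _⟩

theorem size_setCode [Fintype E] (hn : n ≤ 7) (a : Set E) :
    PosetCode.size (setCode l a) = Nat.card a := by
  classical
  have h1 : PosetCode.size (setCode l a) =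
      ∑ i ∈ Finset.range 7, if (setCode l a).testBit i = true then 1 else 0 := by
    have hsel : ∀ (b : Bool) (r : ℕ), select b (Nat.succ r) r = r + if b = true then 1 else 0 :=
      fun b r => by cases b <;> rfl
    simp only [PosetCode.size, hsel, Finset.sum_range_succ, Finset.sum_range_zero]
    ring
  have h2 : ∑ i ∈ Finset.range 7, (if (setCode l a).testBit i = true then 1 else 0) =
      ∑ i ∈ Finset.range n, if (setCode l a).testBit i = true then 1 else 0 := by
    refine (Finset.sum_subset (Finset.range_mono hn) fun i _ hi => ?_).symm
    rw [Nat.testBit_lt_two_pow ((setCode_lt l a).trans_le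
      (Nat.pow_le_pow_right (by norm_num) (by simpa using hi)))]
    rfl
  rw [h1, h2, ← Fin.sum_univ_eq_sum_range
    (fun i => if (setCode l a).testBit i = true then 1 else 0), ← Equiv.sum_comp l]
  simp only [testBit_setCode]
  rw [Finset.sum_boole, Nat.card_eq_fintype_card, Fintype.card_subtype]
  rfl

end SetCodes

section Folds

theorem listFold_eq_foldr {α β : Type} (f : α → β → β) (b : β) (l : List α) :
    listFold f b l = l.foldr f b := by
  induction l with
  | nil => rfl
  | cons a l ih => exact congrArg (f a) ih

theorem select_eq_ite {α : Type} (b : Bool) (x y : α) : select b x y = if b = true then x else y := by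
  cases b <;> rfl

theorem select_false (b b' : Bool) : select b b' false = true ↔ b = true ∧ b' = true := by
  cases b <;> simp

theorem evalThen_eq (f : ℕ → ℕ) (n : ℕ) : evalThen f n = f n := by
  cases n <;> rfl

theorem foldr_select_succ {α : Type} (p : α → Bool) (s : ℕ) (l : List α) :
    l.foldr (fun a r => select (p a) (Nat.succ r) r) s = l.countP p + s := by
  induction l with
  | nil => simp
  | cons a l ih =>
    rw [List.foldr_cons, ih, List.countP_cons, select_eq_ite]
    split_ifs <;> omega

theorem foldr_select_true {α : Type} (p q : α → Bool) (l : List α) :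
    l.foldr (fun a r => select (p a) (select (q a) true r) r) false = true ↔
      ∃ a ∈ l, p a = true ∧ q a = true := by
  induction l with
  | nil => simp
  | cons a l ih =>
    rw [List.foldr_cons, select_eq_ite, select_eq_ite]
    split_ifs with h h' <;> simp_all

theorem foldr_select_cons {α β : Type} (p : α → Bool) (f : α → β) (l : List α) :
    l.foldr (fun a r => select (p a) (f a :: r) r) [] = (l.filter p).map f := by
  induction l with
  | nil => rfl
  | cons a l ih =>
    rw [List.foldr_cons, ih, List.filter_cons, select_eq_ite]
    split_ifs <;> rfl

theorem foldr_add {α : Type} (f : α → ℕ) (l : List α) :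
    l.foldr (fun a r => Nat.add (f a) r) 0 = (l.map f).sum := by
  induction l with
  | nil => rfl
  | cons a l ih => rw [List.foldr_cons, ih, List.map_cons, List.sum_cons]; rfl

theorem countP_eq_ncard {α : Type} {l : List α} (hl : l.Nodup) (hm : ∀ a, a ∈ l) {p : α → Bool}
    {s : Set α} (h : ∀ a, p a = true ↔ a ∈ s) : l.countP p = s.ncard := by
  classical
  have : s = ((l.filter p).toFinset : Set α) := by
    ext a
    simp [hm, h]
  rw [this, Set.ncard_coe_finset, List.toFinset_card_of_nodup (hl.filter _),
    List.countP_eq_length_filter]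

theorem finsum_eq_sum_map {α : Type} {l : List α} (hl : l.Nodup) (hm : ∀ a, a ∈ l) (f : α → ℚ) :
    ∑ᶠ a, f a = (l.map f).sum := by
  classical
  rw [finsum_eq_sum_of_support_subset f (s := l.toFinset) fun a _ => by simp [hm],
    List.sum_toFinset _ hl]

end Folds

section MaskFolds

open Set

theorem foldr_land {E : Type} {n : ℕ} (l : E ≃ Fin n) (p : E → Bool) (s : E → Set E) (es : List E) :
    es.foldr (fun e r => select (p e) (Nat.land (setCode l (s e)) r) r) (setCode l univ) =
      setCode l {x | ∀ e ∈ es, p e = true → x ∈ s e} := by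
  induction es with
  | nil => simp
  | cons e es ih =>
    rw [List.foldr_cons, ih, select_eq_ite]
    split_ifs with h
    · rw [land_setCode]
      congr 1
      ext x
      simp [h]
    · congr 1
      ext x
      simp [h]

end MaskFolds

section Encoding

open Set PosetCode

variable {E : Type} [PartialOrder E] {n : ℕ}

/-- The masks attached to an element. -/
noncomputable def pointCode (l : E ≃ Fin n) (e : E) : ℕ × ℕ × ℕ :=
  (setCode l {e}, setCode l (Iic e), setCode l (Ici e))

/-- The masks of a poset enumerated by `l`, with elements listed by `es` and lower sets by `ds`. -/
structure Encodes (c : PosetCode) (l : E ≃ Fin n) (es : List E) (ds : List (LowerSet E)) :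
    Prop where
  bit : c.bit = 2 ^ n
  pts : c.pts = es.map (pointCode l)
  lows : c.lows = ds.map fun D : LowerSet E => setCode l D
  maxs : c.maxs = setCode l {e | IsMax e}
  nodup_es : es.Nodup
  mem_es : ∀ e, e ∈ es
  nodup_ds : ds.Nodup
  mem_ds : ∀ D, D ∈ ds

namespace Encodes

variable {c : PosetCode} {l : E ≃ Fin n} {es : List E} {ds : List (LowerSet E)}

theorem closure_eq (hc : Encodes c l es ds) (a : Set E) :
    c.closure (setCode l a) = setCode l (lowerBounds (upperBounds a)) := by
  rw [PosetCode.closure, listFold_eq_foldr, hc.pts, List.foldr_map, hc.bit]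
  change es.foldr _ (2 ^ n - 1) = _
  rw [← setCode_univ l]
  refine (foldr_land l _ Iic es).trans (congrArg _ ?_)
  ext x
  refine ⟨fun h e he => h e (hc.mem_es e) ?_, fun h e _ he => h ?_⟩
  · simp only [pointCode]
    rw [land_setCode, beq_setCode]
    exact inter_eq_left.2 fun y hy => he hy
  · simp only [pointCode] at he
    rw [land_setCode, beq_setCode] at he
    exact fun y hy => inter_eq_left.1 he hy

theorem meetTop_iff (hc : Encodes c l es ds) (e : E) :
    c.meetTop (pointCode l e) = true ↔ MeetTop e := by
  have hsel : ∀ (b b' : Bool) (r y : ℕ), select b r (select b' r y) = select (!b && !b') y r := by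
    intro b b' r y
    cases b <;> cases b' <;> rfl
  rw [meetTop, listFold_eq_foldr, hc.pts, List.foldr_map, hc.bit]
  change Nat.beq (es.foldr _ (2 ^ n - 1)) _ = true ↔ _
  simp only [hsel]
  rw [← setCode_univ l]
  refine (iff_of_eq (congrArg (fun m => Nat.beq m _ = true) (foldr_land l _ Iic es))).trans ?_
  rw [MeetTop]
  refine (beq_setCode l).trans (iff_of_eq (congrArg (· = Iic e) ?_))
  ext x
  have key : ∀ y, (!(Nat.land (pointCode l e).2.2 (pointCode l y).1).beq 0 &&
      !(pointCode l e).1.beq (pointCode l y).1) = true ↔ e < y := by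
    intro y
    simp only [pointCode]
    rw [Bool.and_eq_true, Bool.not_eq_true', Bool.not_eq_true', ← Bool.not_eq_true,
      ← Bool.not_eq_true, ← setCode_empty l, land_setCode, beq_setCode, beq_setCode,
      inter_singleton_eq_empty, not_not, singleton_eq_singleton_iff, lt_iff_le_and_ne]
    rfl
  exact ⟨fun h y hy => h y (hc.mem_es y) ((key y).2 hy), fun h y _ hy => h ((key y).1 hy)⟩

end Encodes

theorem link_iff (l : E ≃ Fin n) (e e' : E) :
    link (pointCode l e) (pointCode l e') = true ↔ e = e' ∨ Link e e' := by
  have h1 : link (pointCode l e) (pointCode l e') = true ↔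
      Iic e' = Iic e ∪ {e'} ∧ Ici e = Ici e' ∪ {e} := by
    rw [link, select_false]
    simp only [pointCode]
    rw [lor_setCode, lor_setCode, beq_setCode, beq_setCode]
  rw [h1]
  constructor
  · rintro ⟨h, h'⟩
    refine or_iff_not_imp_left.2 fun hne => ?_
    have hle : e ≤ e' := by
      have : e ∈ Iic e' := by rw [h]; exact Or.inl self_mem_Iic
      exact this
    have hlt := lt_of_le_of_ne hle hne
    constructor
    · rw [← Ici_sdiff_left, h', union_sdiff_right, sdiff_singleton_eq_self]
      exact hlt.not_ge
    · rw [← Iic_sdiff_right, h, union_sdiff_right, sdiff_singleton_eq_self]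
      exact hlt.not_ge
  · rintro (rfl | h)
    · simp
    · rw [← h.1, ← h.2]
      simp

namespace Encodes

variable {c : PosetCode} {l : E ≃ Fin n} {es : List E} {ds : List (LowerSet E)}

theorem good_succ_iff (hc : Encodes c l es ds) (k : ℕ) (e : E) :
    c.good (k + 1) (pointCode l e) = true ↔
      MeetTop e ∨ ∃ e', (e = e' ∨ Link e e') ∧ c.good k (pointCode l e') = true := by
  change select (c.meetTop (pointCode l e)) true (listFold (fun q r =>
    select (link (pointCode l e) q) (select (c.good k q) true r) r) false c.pts) = true ↔ _
  rw [select_eq_ite, listFold_eq_foldr, hc.pts]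
  split_ifs with h
  · simp [(hc.meetTop_iff e).1 h]
  · rw [foldr_select_true, hc.meetTop_iff] at *
    simp only [h, false_or, List.mem_map]
    constructor
    · rintro ⟨_, ⟨e', -, rfl⟩, h1, h2⟩
      exact ⟨e', (link_iff l e e').1 h1, h2⟩
    · rintro ⟨e', h1, h2⟩
      exact ⟨_, ⟨e', hc.mem_es e', rfl⟩, (link_iff l e e').2 h1, h2⟩

theorem good_of_good_code (hc : Encodes c l es ds) {k : ℕ} {e : E}
    (h : c.good k (pointCode l e) = true) : Good e := by
  induction k generalizing e with
  | zero => exact absurd h Bool.false_ne_true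
  | succ k ih =>
    rcases (hc.good_succ_iff k e).1 h with h | ⟨e', rfl | h', h⟩
    · exact ⟨e, .refl, h⟩
    · exact ih h
    · exact h'.good (ih h)

theorem good_code_of_reach (hc : Encodes c l es ds) {e t : E}
    (h : Relation.ReflTransGen Link e t) (ht : MeetTop t) {k : ℕ} (hk : (Ioi e).ncard < k) :
    c.good k (pointCode l e) = true := by
  have hfin : Finite E := Finite.of_equiv _ l.symm
  induction h using Relation.ReflTransGen.head_induction_on generalizing k with
  | refl =>
    obtain ⟨k, rfl⟩ := Nat.exists_eq_succ_of_ne_zero (Nat.ne_zero_of_lt hk)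
    exact (hc.good_succ_iff k _).2 (Or.inl ht)
  | head hl _ ih =>
    obtain ⟨k, rfl⟩ := Nat.exists_eq_succ_of_ne_zero (Nat.ne_zero_of_lt hk)
    refine (hc.good_succ_iff k _).2 (Or.inr ⟨_, Or.inr hl, ih ?_⟩)
    have := ncard_lt_ncard (Ioi_ssubset_Ioi hl.lt) (toFinite _)
    omega

theorem good_iff (hc : Encodes c l es ds) (hn : n ≤ 7) (e : E) :
    c.good 7 (pointCode l e) = true ↔ Good e := by
  have hfin : Finite E := Finite.of_equiv _ l.symm
  refine ⟨hc.good_of_good_code, fun ⟨t, h, ht⟩ => hc.good_code_of_reach h ht ?_⟩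
  have h1 : (Ioi e).ncard < (univ : Set E).ncard :=
    ncard_lt_ncard (ssubset_univ_iff.2 fun h => lt_irrefl e (h ▸ mem_univ e : e ∈ Ioi e))
      (toFinite _)
  rw [ncard_univ, Nat.card_congr l, Nat.card_fin] at h1
  omega

end Encodes

theorem joinBot_iff (e : E) : JoinBot e ↔ lowerBounds (upperBounds (Iio e)) = Iic e := by
  constructor
  · intro h
    rw [h, lowerBounds_Ici]
  · intro h
    rw [JoinBot, ← upperBounds_lowerBounds_upperBounds, h, upperBounds_Iic]

theorem card_basisValues [Finite E] : Nat.card (basisValues E) =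
    {D : LowerSet E | lowerBounds (upperBounds (D : Set E)) = D}.ncard +
      {e : E | JoinBot e ∧ Good e}.ncard := by
  have h1 : basisValues E =
      (fun D : LowerSet E => (D : Set E)) '' {D | lowerBounds (upperBounds (D : Set E)) = D} ∪
        Iio '' {e | JoinBot e ∧ Good e} := by
    ext a
    constructor
    · intro ha
      rcases ha with h | ⟨e, hg, hj, rfl⟩
      · exact Or.inl ⟨⟨a, fun _ _ => @isLowerSet_of_mem_basisValues _ _ a (Or.inl h) _ _⟩, h, rfl⟩
      · exact Or.inr ⟨e, ⟨hj, hg⟩, rfl⟩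
    · rintro (⟨D, h, rfl⟩ | ⟨e, ⟨hj, hg⟩, rfl⟩)
      · exact Or.inl h
      · exact Or.inr ⟨e, hg, hj, rfl⟩
  rw [Nat.card_coe_set_eq, h1, ncard_union_eq _ (toFinite _) (toFinite _),
    ncard_image_of_injective _ SetLike.coe_injective, InjOn.ncard_image]
  · rintro e ⟨he, -⟩ e' ⟨he', -⟩ h
    exact Ici_inj' (he.symm.trans ((congrArg upperBounds h).trans he'))
  · rw [disjoint_left]
    rintro _ ⟨D, h, rfl⟩ ⟨e, ⟨hj, hg⟩, h'⟩
    exact not_isGoodIio_of_closed h ⟨e, hg, hj, h'.symm⟩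

theorem Encodes.values_eq {c : PosetCode} {l : E ≃ Fin n} {es : List E} {ds : List (LowerSet E)}
    (hc : Encodes c l es ds) (hn : n ≤ 7) : c.values = Nat.card (basisValues E) := by
  have hfin : Finite E := Finite.of_equiv _ l.symm
  rw [values, listFold_eq_foldr, listFold_eq_foldr, foldr_select_succ, foldr_select_succ, hc.lows,
    hc.pts, List.countP_map, List.countP_map, card_basisValues,
    countP_eq_ncard hc.nodup_ds hc.mem_ds, countP_eq_ncard hc.nodup_es hc.mem_es, add_zero]
  · intro e
    simp only [Function.comp_apply, select_false]
    rw [mem_ofPred_eq, ← hc.good_iff hn, joinBot_iff]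
    simp only [pointCode]
    rw [xor_setCode l (singleton_subset_iff.2 self_mem_Iic), Iic_sdiff_right, hc.closure_eq,
      beq_setCode]
  · intro D
    rw [Function.comp_apply, hc.closure_eq, beq_setCode]
    rfl

end Encoding

section ExtensionCodes

open Set PosetCode

variable {E : Type} [PartialOrder E] {n : ℕ} {D : LowerSet E}

namespace TopExt

/-- The inclusion of a poset into an extension. -/
def old (D : LowerSet E) (e : E) : TopExt D := some e

/-- The new element of an extension. -/
def new (D : LowerSet E) : TopExt D := none

theorem eq_new_or_old (x : TopExt D) : x = new D ∨ ∃ e, x = old D e := by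
  cases x with
  | none => exact Or.inl rfl
  | some e => exact Or.inr ⟨e, rfl⟩

theorem forall_iff {p : TopExt D → Prop} : (∀ x, p x) ↔ p (new D) ∧ ∀ e, p (old D e) :=
  ⟨fun h => ⟨h _, fun _ => h _⟩, fun h x => by
    rcases eq_new_or_old x with rfl | ⟨e, rfl⟩
    exacts [h.1, h.2 e]⟩

theorem old_injective (D : LowerSet E) : Function.Injective (old D) := Option.some_injective E

@[simp] theorem old_inj {e e' : E} : old D e = old D e' ↔ e = e' := (old_injective D).eq_iff

@[simp] theorem old_ne_new (e : E) : old D e ≠ new D := Option.some_ne_none e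

@[simp] theorem new_ne_old (e : E) : new D ≠ old D e := (old_ne_new e).symm

@[simp] theorem old_le_old {e e' : E} : old D e ≤ old D e' ↔ e ≤ e' := Iff.rfl

@[simp] theorem old_le_new {e : E} : old D e ≤ new D ↔ e ∈ D := Iff.rfl

@[simp] theorem not_new_le_old (e : E) : ¬ new D ≤ old D e := fun h => h

theorem set_ext {s t : Set (TopExt D)} (h : new D ∈ s ↔ new D ∈ t)
    (h' : ∀ e, old D e ∈ s ↔ old D e ∈ t) : s = t :=
  Set.ext (forall_iff.2 ⟨h, h'⟩)

/-- The enumeration of an extension. -/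
def enum (D : LowerSet E) (l : E ≃ Fin n) : TopExt D ≃ Fin (n + 1) :=
  (show TopExt D ≃ Option (Fin n) from l.optionCongr).trans finSuccEquivLast.symm

variable (l : E ≃ Fin n)

theorem enum_old (e : E) : (enum D l (old D e) : ℕ) = l e :=
  congrArg Fin.val (finSuccEquivLast_symm_some (l e))

theorem enum_new : (enum D l (new D) : ℕ) = n :=
  congrArg Fin.val finSuccEquivLast_symm_none

theorem setCode_image_old (D : LowerSet E) (a : Set E) :
    setCode l a = setCode (enum D l) (old D '' a) := by
  refine eq_setCode _ ((setCode_lt l a).trans_le (Nat.pow_le_pow_right (by norm_num) n.le_succ))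
    (forall_iff.2 ⟨?_, fun e => ?_⟩)
  · rw [enum_new, Nat.testBit_lt_two_pow (setCode_lt l a)]
    simp
  · rw [enum_old, testBit_setCode]
    simp

theorem two_pow_eq_setCode_new (D : LowerSet E) : 2 ^ n = setCode (enum D l) {new D} := by
  refine eq_setCode _ (Nat.pow_lt_pow_right (by norm_num) n.lt_succ_self)
    (forall_iff.2 ⟨?_, fun e => ?_⟩)
  · rw [enum_new]
    simp
  · rw [enum_old, Nat.testBit_two_pow_of_ne (l e).2.ne']
    simp

/-- A lower set of a poset as a lower set of an extension. -/
def lift (D A : LowerSet E) : LowerSet (TopExt D) where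
  carrier := old D '' A
  lower' := by
    rintro _ y h ⟨x, hx, rfl⟩
    rcases eq_new_or_old y with rfl | ⟨y, rfl⟩
    · exact absurd h (not_new_le_old x)
    · exact ⟨y, A.lower h hx, rfl⟩

/-- The lower set of an extension generated by the new element and a lower set of the poset. -/
def adjoin (D A : LowerSet E) : LowerSet (TopExt D) where
  carrier := old D '' (A ∪ D) ∪ {new D}
  lower' := by
    intro x y h hx
    rcases eq_new_or_old y with rfl | ⟨y, rfl⟩
    · exact Or.inr rfl
    · refine Or.inl ⟨y, ?_, rfl⟩
      rcases hx with ⟨x, hx | hx, rfl⟩ | rfl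
      · exact Or.inl (A.lower h hx)
      · exact Or.inr (D.lower h hx)
      · exact Or.inr h

theorem coe_lift (A : LowerSet E) : (lift D A : Set (TopExt D)) = old D '' A := rfl

theorem coe_adjoin {A : LowerSet E} (h : D ≤ A) :
    (adjoin D A : Set (TopExt D)) = old D '' A ∪ {new D} := by
  change old D '' (A ∪ D : Set E) ∪ {new D} = _
  rw [union_eq_left.2 h]

theorem lift_injective (D : LowerSet E) : Function.Injective (lift D) := fun _ _ h =>
  SetLike.coe_injective ((old_injective D).image_injective (congrArg LowerSet.carrier h))

theorem adjoin_inj {A B : LowerSet E} (hA : D ≤ A) (hB : D ≤ B) (h : adjoin D A = adjoin D B) :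
    A = B := by
  have h1 := congrArg (fun L : LowerSet (TopExt D) => (L : Set (TopExt D))) h
  simp only [coe_adjoin hA, coe_adjoin hB] at h1
  ext x
  simpa using Set.ext_iff.1 h1 (old D x)

theorem lift_ne_adjoin (A B : LowerSet E) : lift D A ≠ adjoin D B := fun h => by
  have h1 : new D ∈ adjoin D B := Or.inr rfl
  rw [← h] at h1
  obtain ⟨x, -, hx⟩ := h1
  exact old_ne_new x hx

theorem exists_eq_lift_or_adjoin (L : LowerSet (TopExt D)) :
    (∃ A, L = lift D A) ∨ ∃ A, D ≤ A ∧ L = adjoin D A := by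
  let A : LowerSet E := ⟨old D ⁻¹' L, fun x y hyx hx => L.lower (old_le_old.2 hyx) hx⟩
  have hA : ∀ e, e ∈ A ↔ old D e ∈ L := fun e => Iff.rfl
  by_cases h : new D ∈ L
  · have hDA : D ≤ A := fun x hx => L.lower (old_le_new.2 hx) h
    refine Or.inr ⟨A, hDA, SetLike.coe_injective ?_⟩
    rw [coe_adjoin hDA]
    exact set_ext (by simpa using h) fun e => by simp [hA]
  · refine Or.inl ⟨A, SetLike.coe_injective ?_⟩
    rw [coe_lift]
    exact set_ext (by simpa using h) fun e => by simp [hA]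

theorem setOf_isMax (D : LowerSet E) : {x : TopExt D | IsMax x} =
    old D '' ({e | IsMax e} \ ({e | IsMax e} ∩ D)) ∪ {new D} := by
  refine set_ext ?_ fun e => ?_
  · simp [IsMax, forall_iff]
  · simp [IsMax, forall_iff]
    tauto

theorem pointCode_new (D : LowerSet E) : pointCode (enum D l) (new D) =
    (2 ^ n, Nat.lor (setCode l D) (2 ^ n), 2 ^ n) := by
  rw [two_pow_eq_setCode_new l D, setCode_image_old l D, lor_setCode, pointCode]
  have h1 : Iic (new D) = old D '' D ∪ {new D} := set_ext (by simp) fun e => by simp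
  have h2 : Ici (new D) = {new D} := set_ext (by simp) fun e => by simp
  rw [h1, h2]

theorem pointCode_old (D : LowerSet E) (e : E) : pointCode (enum D l) (old D e) =
    select (Nat.beq (Nat.land (setCode l D) (pointCode l e).1) 0) (pointCode l e)
      ((pointCode l e).1, (pointCode l e).2.1, Nat.lor (pointCode l e).2.2 (2 ^ n)) := by
  have h1 : setCode (enum D l) {old D e} = setCode l {e} := by
    rw [setCode_image_old l D, image_singleton]
  have h2 : setCode (enum D l) (Iic (old D e)) = setCode l (Iic e) := by
    rw [setCode_image_old l D]
    exact congrArg _ (set_ext (by simp) fun e => by simp)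
  have h3 : Nat.beq (Nat.land (setCode l D) (pointCode l e).1) 0 = true ↔ e ∉ D := by
    rw [← setCode_empty l, pointCode, land_setCode, beq_setCode, inter_singleton_eq_empty]
    rfl
  rw [select_eq_ite]
  by_cases he : e ∈ D
  · rw [if_neg (fun h => h3.1 h he), pointCode, pointCode, h1, h2, two_pow_eq_setCode_new l D,
      setCode_image_old l D (Ici e), lor_setCode]
    have h4 : Ici (old D e) = old D '' Ici e ∪ {new D} := set_ext (by simpa) fun e => by simp
    rw [h4]
  · rw [if_pos (h3.2 he), pointCode, pointCode, h1, h2, setCode_image_old l D (Ici e)]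
    have h4 : Ici (old D e) = old D '' Ici e := set_ext (by simpa) fun e => by simp
    rw [h4]

end TopExt

open TopExt

open Classical in
theorem Encodes.ext {c : PosetCode} {l : E ≃ Fin n} {es : List E} {ds : List (LowerSet E)}
    (hc : Encodes c l es ds) (D : LowerSet E) :
    Encodes (c.ext (setCode l D)) (enum D l) (new D :: es.map (old D))
      (ds.map (lift D) ++ (ds.filter (D ≤ ·)).map (adjoin D)) where
  bit := by
    change c.bit + c.bit = _
    rw [hc.bit, pow_succ]
    ring
  pts := by
    refine List.cons_eq_cons.2 ⟨?_, ?_⟩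
    · rw [hc.bit]
      exact (pointCode_new l D).symm
    · rw [listFold_eq_foldr, hc.pts, hc.bit, List.foldr_map]
      clear hc
      induction es with
      | nil => rfl
      | cons e es ih => exact congrArg₂ List.cons (pointCode_old l D e).symm ih
  lows := by
    change listFold List.cons (listFold _ [] c.lows) c.lows = _
    rw [listFold_eq_foldr, listFold_eq_foldr, foldr_select_cons, hc.lows,
      hc.bit, List.map_append, List.map_map, List.filter_map, List.map_map, List.map_map]
    have h1 : (fun a => Nat.beq (Nat.land (setCode l (D : Set E)) a) (setCode l (D : Set E))) ∘
        (fun A : LowerSet E => setCode l A) = fun A => decide (D ≤ A) := by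
      funext A
      rw [Function.comp_apply, land_setCode, Bool.eq_iff_iff, beq_setCode, inter_eq_left,
        decide_eq_true_iff]
      rfl
    rw [h1]
    refine (List.foldr_cons_eq_append' ..).trans (congrArg₂ _ ?_ ?_)
    · exact List.map_congr_left fun A _ => setCode_image_old l D A
    · refine List.map_congr_left fun A hA => ?_
      have hA : D ≤ A := by simpa using (List.mem_filter.1 hA).2
      rw [Function.comp_apply, Function.comp_apply, coe_adjoin hA, setCode_image_old l D,
        two_pow_eq_setCode_new l D, lor_setCode]
  maxs := by
    change Nat.lor (Nat.xor c.maxs (Nat.land c.maxs _)) c.bit = _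
    rw [hc.maxs, hc.bit, land_setCode, xor_setCode l inter_subset_left, setCode_image_old l D,
      two_pow_eq_setCode_new l D, lor_setCode, setOf_isMax]
  nodup_es := List.nodup_cons.2 ⟨by simp, hc.nodup_es.map (old_injective D)⟩
  mem_es := forall_iff.2 ⟨List.mem_cons_self, fun e =>
    List.mem_cons_of_mem _ (List.mem_map_of_mem (hc.mem_es e))⟩
  nodup_ds := by
    refine List.Nodup.append (hc.nodup_ds.map (lift_injective D))
      (List.Nodup.map_on ?_ (hc.nodup_ds.filter _)) ?_
    · intro A hA B hB h
      exact adjoin_inj (by simpa using (List.mem_filter.1 hA).2)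
        (by simpa using (List.mem_filter.1 hB).2) h
    · intro L hL hL'
      obtain ⟨A, -, rfl⟩ := List.mem_map.1 hL
      obtain ⟨B, -, h⟩ := List.mem_map.1 hL'
      exact lift_ne_adjoin A B h.symm
  mem_ds L := by
    rcases exists_eq_lift_or_adjoin L with ⟨A, rfl⟩ | ⟨A, hA, rfl⟩
    · exact List.mem_append_left _ (List.mem_map_of_mem (hc.mem_ds A))
    · exact List.mem_append_right _ (List.mem_map_of_mem
        (List.mem_filter.2 ⟨hc.mem_ds A, by simpa using hA⟩))

theorem encodes_empty [IsEmpty E] (l : E ≃ Fin 0) : Encodes PosetCode.empty l [] [⊥] where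
  bit := rfl
  pts := rfl
  lows := List.cons_eq_cons.2 ⟨(setCode_empty l).symm, rfl⟩
  maxs := (setCode_empty l).symm.trans (congrArg _ (Subsingleton.elim _ _))
  nodup_es := List.nodup_nil
  mem_es e := isEmptyElim e
  nodup_ds := List.nodup_singleton _
  mem_ds _ := List.mem_singleton.2 (SetLike.coe_injective (Subsingleton.elim _ _))

end ExtensionCodes

section WeightedSums

open PosetCode

theorem Encodes.size_maxs {E : Type} [PartialOrder E] {n : ℕ} {c : PosetCode} {l : E ≃ Fin n}
    {es : List E} {ds : List (LowerSet E)} (hc : Encodes c l es ds) (hn : n ≤ 7) :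
    size c.maxs = maxCount E ‹_› := by
  have : Fintype E := Fintype.ofEquiv _ l.symm
  rw [hc.maxs, size_setCode l hn]
  rfl

theorem maxCount_dvd {E : Type} [PartialOrder E] {n : ℕ} (l : E ≃ Fin (n + 1)) (hn : n < 7) :
    maxCount E ‹_› ∣ 420 ∧ maxCount E ‹_› ≠ 0 := by
  have : Finite E := Finite.of_equiv _ l.symm
  have : Nonempty E := ⟨l.symm 0⟩
  have h1 : maxCount E ‹_› ≤ n + 1 := by
    rw [← Nat.card_fin (n + 1), ← Nat.card_congr l]
    exact Finite.card_subtype_le _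
  have h2 : maxCount E ‹_› ≠ 0 := by
    obtain ⟨x, -, hx⟩ := Finite.exists_le_maximal (p := fun _ : E => True)
      (a := Classical.arbitrary E) trivial
    have : Nonempty {x : E // IsMax x} := ⟨x, maximal_true.1 hx⟩
    exact Nat.card_pos.ne'
  refine ⟨?_, h2⟩
  generalize maxCount E ‹_› = m at *
  have : m ≤ 7 := by omega
  interval_cases m <;> first | exact absurd rfl h2 | decide

theorem weightedSum_eq {h : OrderFun} {leaf : PosetCode → ℕ} {N : ℕ} (hN : N ≤ 7)
    (hleaf : ∀ (E : Type) [PartialOrder E] (c : PosetCode) (l : E ≃ Fin N) (es : List E)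
      (ds : List (LowerSet E)), Encodes c l es ds → (leaf c : ℚ) = h E ‹_›)
    (m : ℕ) {n : ℕ} (hnm : n + m = N) {E : Type} [PartialOrder E] {c : PosetCode}
    {l : E ≃ Fin n} {es : List E} {ds : List (LowerSet E)} (hc : Encodes c l es ds) :
    (weightedSum leaf m c : ℚ) = 420 ^ m * (OrderFun.step^[m] h) E ‹_› := by
  induction m generalizing n E c with
  | zero =>
    obtain rfl : n = N := hnm
    rw [pow_zero, one_mul]
    exact hleaf E c l es ds hc
  | succ m ih =>
    rw [Function.iterate_succ_apply', OrderFun.step, finsum_eq_sum_map hc.nodup_ds hc.mem_ds]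
    change ((listFold (fun d r => Nat.add (Nat.mul (evalThen (fun a => Nat.div 420 (size a))
      (c.ext d).maxs) (weightedSum leaf m (c.ext d))) r) 0 c.lows : ℕ) : ℚ) = _
    rw [listFold_eq_foldr, hc.lows, List.foldr_map, foldr_add, Nat.cast_list_sum,
      ← List.sum_map_mul_left, List.map_map]
    refine congrArg List.sum (List.map_congr_left fun D _ => ?_)
    have hD := hc.ext D
    obtain ⟨h1, h2⟩ := maxCount_dvd (TopExt.enum D l) (by omega)
    rw [Function.comp_apply, evalThen_eq, hD.size_maxs (by omega)]
    change ((420 / maxCount (TopExt D) _ * weightedSum leaf m (c.ext _) : ℕ) : ℚ) = _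
    rw [Nat.cast_mul, Nat.cast_div h1 (by exact_mod_cast h2), ih (by omega) hD, OrderFun.divMax,
      pow_succ]
    push_cast
    ring

end WeightedSums

section Evaluation

open PosetCode

/-- The square of the number of elements of the row basis, as a function of the poset. -/
noncomputable def basisSquare (X : Type) : OrderFun := fun E _ => (Nat.card (hitBasis X E) : ℚ) ^ 2

theorem invariant_basisSquare (X : Type) : (basisSquare X).Invariant := fun _ _ _ _ s => by
  rw [basisSquare, basisSquare, PosetFam.card_hitBasis_congr s]

theorem sum_card_hitBasis_sq {X : Type} {n v : ℕ} (hn : n ≤ 7) {leaf : PosetCode → ℕ}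
    (hleaf : ∀ (E : Type) [PartialOrder E] (c : PosetCode) (l : E ≃ Fin n) (es : List E)
      (ds : List (LowerSet E)), Encodes c l es ds → (leaf c : ℚ) = basisSquare X E ‹_›)
    (hv : weightedSum leaf n empty = 420 ^ n * v) :
    (∑ r : PartialOrder (Pt n), Nat.card (hitBasis X (Carrier r)) ^ 2) / n.factorial = v := by
  let r₀ : PartialOrder (Pt 0) := inferInstanceAs (PartialOrder (Fin 0))
  have h1 := weightedSum_eq hn hleaf n (zero_add n)
    (@encodes_empty (Pt 0) r₀ (inferInstanceAs (IsEmpty (Fin 0))) (Equiv.refl (Fin 0)))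
  rw [hv, Nat.cast_mul, Nat.cast_pow] at h1
  have h2 := mul_left_cancel₀ (by norm_num) h1
  refine Nat.div_eq_of_eq_mul_right n.factorial_pos ?_
  have h3 := sum_order_pt (invariant_basisSquare X) n r₀
  rw [← h2] at h3
  have h4 : ((∑ r : PartialOrder (Pt n), Nat.card (hitBasis X (Carrier r)) ^ 2 : ℕ) : ℚ) =
      ∑ r : PartialOrder (Pt n), basisSquare X (Pt n) r := by
    push_cast
    rfl
  exact_mod_cast h4.trans h3

variable {X : Type} [Fintype X]

theorem Encodes.leaf_eq (hX : Fintype.card X = 7) {E : Type} [PartialOrder E] {n : ℕ} (hn : n ≤ 7)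
    {c : PosetCode} {l : E ≃ Fin n} {es : List E} {ds : List (LowerSet E)}
    (hc : Encodes c l es ds) : (leaf n c : ℚ) = basisSquare X E ‹_› := by
  have : Fintype E := Fintype.ofEquiv _ l.symm
  have hE : Fintype.card E = n := by rw [Fintype.card_congr l, Fintype.card_fin]
  rw [leaf, evalThen_eq, hc.values_eq hn, basisSquare, card_hitBasis, hX, hE, Nat.cast_pow]

theorem sum_card_hitBasis_sq_leaf (hX : Fintype.card X = 7) {n v : ℕ} (hn : n ≤ 7)
    (hv : weightedSum (leaf n) n empty = 420 ^ n * v) :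
    (∑ r : PartialOrder (Pt n), Nat.card (hitBasis X (Carrier r)) ^ 2) / n.factorial = v :=
  sum_card_hitBasis_sq hn (fun _ _ _ _ _ _ hc => hc.leaf_eq hX hn) hv

theorem sum_card_hitBasis_sq_seven (hX : Fintype.card X = 7) {v : ℕ}
    (hv : weightedSum (fun _ => 5040 ^ 2) 7 empty = 420 ^ 7 * v) :
    (∑ r : PartialOrder (Pt 7), Nat.card (hitBasis X (Carrier r)) ^ 2) / Nat.factorial 7 = v := by
  refine sum_card_hitBasis_sq le_rfl (fun E _ c l es ds hc => ?_) hv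
  rw [← hc.leaf_eq hX le_rfl, leaf, evalThen_eq, coverCount_seven_seven]

set_option maxRecDepth 100000 in
theorem finrank_hitsSpan_of_card_eq_seven (k : Type) [Field k] [CharZero k]
    (hX : Fintype.card X = 7) : Module.finrank k (hitsSpan k X) = 300247741670 := by
  rw [finrank_hitsSpan, hX]
  simp only [Finset.sum_range_succ, Finset.sum_range_zero]
  rw [sum_card_hitBasis_sq_leaf hX (n := 0) (v := 1) (by norm_num) (by decide +kernel),
    sum_card_hitBasis_sq_leaf hX (n := 1) (v := 16129) (by norm_num) (by decide +kernel),
    sum_card_hitBasis_sq_leaf hX (n := 2) (v := 77398146) (by norm_num) (by decide +kernel),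
    sum_card_hitBasis_sq_leaf hX (n := 3) (v := 2820262914) (by norm_num) (by decide +kernel),
    sum_card_hitBasis_sq_leaf hX (n := 4) (v := 29309918400) (by norm_num) (by decide +kernel),
    sum_card_hitBasis_sq_leaf hX (n := 5) (v := 107521468320) (by norm_num) (by decide +kernel),
    sum_card_hitBasis_sq_leaf hX (n := 6) (v := 129624188400) (by norm_num) (by decide +kernel),
    sum_card_hitBasis_sq_seven hX (v := 30894489360) (by decide +kernel)]

end Evaluation

/-- For a field `k` of characteristic zero and a set `X` with 7 elements, the Jacobson
radical `J(𝓡_X)` of the algebra of relations `𝓡_X = k𝓒(X,X)` has dimension 562649705679642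
as a `k`-vector space. -/
theorem relAlgebra_jacobson_dim (k : Type) [Field k] [CharZero k]
    (X : Type) [Fintype X] (hX : Fintype.card X = 7) :
    Module.finrank k
      (Submodule.restrictScalars k
        (Ideal.jacobson (⊥ : Ideal (MonoidAlgebra k (Set (X × X)))))) = 562649705679642 := by
  have h := finrank_jacobson_add_finrank_hitsSpan (k := k) (X := X)
  rw [finrank_hitsSpan_of_card_eq_seven k hX, hX] at h
  omega
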